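/- arXiv:1507.00547 — 3 statements merged into one kernel-verified Lean document; each statement's English description precedes it below -/
import Mathlib

section
/- There is an integer n₀ such that the following holds for all n ≥ n₀. Let G be a graph on n vertices with exactly p·C(n,2) edges, where 0 < p ≤ 1, and let r and t be positive integers. Then G contains a weakly bi-complete r-sequence of order t if any of the following holds: (a) p ≥ n^{−1/3}, r ≤ 2p^{−1/2} and t ≤ (log n)/(4 log(32/(p r²))); (b) p ≥ n^{−1/5}, 4p^{−1/2} ≤ r ≤ √(p^{−1} log n) and t ≤ (1/16)·e^{p r²/8}·log n; (c) r ≥ 4√(p^{−1} log n) and t ≤ min(p n/(64√(log n)), n/(2r)). In particular, in each case G also contains a weakly complete 2r-sequence of order t. -/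
/-- `S 0, …, S (t-1)` is a weakly complete `r`-sequence of order `t` in `G`: the sets are
pairwise disjoint, of size `r`, and for each `i < j` there is an edge of `G` from a
vertex in `S i` to a vertex in `S j`. -/
def WeaklyCompleteSeq {V : Type*} (G : SimpleGraph V) (r t : ℕ) : Prop :=
  ∃ S : Fin t → Finset V, (∀ i, (S i).card = r) ∧
    (∀ i j, i ≠ j → Disjoint (S i) (S j)) ∧
    ∀ i j, i < j → ∃ u ∈ S i, ∃ v ∈ S j, G.Adj u v

/-- `S 0, …, S (t-1), T 0, …, T (t-1)` is a weakly bi-complete `r`-sequence of order `t`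
in `G`: the `2t` sets are pairwise disjoint, of size `r`, and for each pair `i, j` there
is an edge of `G` from a vertex in `S i` to a vertex in `T j`. -/
def WeaklyBiCompleteSeq {V : Type*} (G : SimpleGraph V) (r t : ℕ) : Prop :=
  ∃ S T : Fin t → Finset V,
    (∀ i, (S i).card = r) ∧ (∀ i, (T i).card = r) ∧
    (∀ i j, i ≠ j → Disjoint (S i) (S j)) ∧
    (∀ i j, i ≠ j → Disjoint (T i) (T j)) ∧
    (∀ i j, Disjoint (S i) (T j)) ∧
    ∀ i j, ∃ u ∈ S i, ∃ v ∈ T j, G.Adj u v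

section

open Finset

open scoped Classical in
theorem exists_small_cover {α β : Type*} (R : α → β → Prop) (A : Finset α) (B : Finset β)
    {δ : ℝ} (hδ : δ ≤ 1) (hA : A.Nonempty)
    (h : ∀ b ∈ B, δ * #A ≤ #{a ∈ A | R a b}) (k : ℕ) :
    ∃ S ⊆ A, #S ≤ k ∧ (#{b ∈ B | ∀ a ∈ S, ¬ R a b} : ℝ) ≤ (1 - δ) ^ k * #B := by
  induction k with
  | zero => exact ⟨∅, by simp, by simp, by simp⟩
  | succ k ih =>
    obtain ⟨S, hSA, hSk, hS⟩ := ih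
    set U : Finset β := {b ∈ B | ∀ a ∈ S, ¬ R a b} with hU
    have hdc : ∑ a ∈ A, (#{b ∈ U | R a b} : ℝ) = ∑ b ∈ U, (#{a ∈ A | R a b} : ℝ) := by
      exact_mod_cast Finset.sum_card_bipartiteAbove_eq_sum_card_bipartiteBelow R
    have hsum : ∑ a ∈ A, δ * (#U : ℝ) ≤ ∑ a ∈ A, (#{b ∈ U | R a b} : ℝ) := by
      rw [hdc]
      calc ∑ a ∈ A, δ * (#U : ℝ) = ∑ b ∈ U, δ * #A := by simp; ring
        _ ≤ _ := Finset.sum_le_sum fun b hb => h b (Finset.mem_filter.1 hb).1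
    obtain ⟨a, ha, hle⟩ := Finset.exists_le_of_sum_le hA hsum
    refine ⟨insert a S, Finset.insert_subset ha hSA,
      (Finset.card_insert_le _ _).trans (by omega), ?_⟩
    have hset : ({b ∈ B | ∀ x ∈ insert a S, ¬ R x b} : Finset β) = {b ∈ U | ¬ R a b} := by
      ext b
      simp only [hU, Finset.mem_filter, Finset.mem_insert, forall_eq_or_imp]
      tauto
    have hsplit : (#{b ∈ U | R a b} : ℝ) + #{b ∈ U | ¬ R a b} = #U := by
      exact_mod_cast Finset.card_filter_add_card_filter_not (s := U) (fun b => R a b)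
    rw [hset]
    calc (#{b ∈ U | ¬ R a b} : ℝ) ≤ (1 - δ) * #U := by linarith
      _ ≤ (1 - δ) * ((1 - δ) ^ k * #B) := by gcongr
      _ = _ := by ring

theorem prod_le_pow_of_sum_le {s : ℕ} (a : Fin s → ℝ) (ha : ∀ k, 0 ≤ a k) {u : ℝ} (hu : 0 < u)
    (h : ∑ k, a k ≤ s * u) : ∏ k, a k ≤ u ^ s := by
  have h1 : ∀ k, a k ≤ u * Real.exp (a k / u - 1) := by
    intro k
    have := Real.add_one_le_exp (a k / u - 1)
    have h2 : a k = u * (a k / u - 1 + 1) := by field_simp; ring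
    calc a k = u * (a k / u - 1 + 1) := h2
      _ ≤ _ := by gcongr
  calc ∏ k, a k ≤ ∏ k, u * Real.exp (a k / u - 1) :=
        Finset.prod_le_prod (fun k _ => ha k) fun k _ => h1 k
    _ = u ^ s * Real.exp (∑ k, a k / u - s) := by
        rw [Finset.prod_mul_distrib, ← Real.exp_sum]; simp
    _ ≤ u ^ s * 1 := by
        gcongr
        rw [Real.exp_le_one_iff, ← Finset.sum_div, sub_nonpos, div_le_iff₀ hu]
        exact h
    _ = _ := mul_one _

open scoped Classical in
theorem exists_disjoint_transversals {β ι : Type*} [Fintype ι] (B : Finset β) {s M : ℕ}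
    (hM : 0 < M) (hB : #B = s * M) (U : ι → Finset β) {u : ℝ} (hu : 0 < u)
    (hU : ∀ i, (#(U i ∩ B) : ℝ) ≤ u * #B) :
    ∃ T : Fin M → Finset β, (∀ j, T j ⊆ B) ∧ (∀ j, #(T j) = s) ∧
      (∀ j j', j ≠ j' → Disjoint (T j) (T j')) ∧
      (#{x : ι × Fin M | T x.2 ⊆ U x.1} : ℝ) ≤ u ^ s * (Fintype.card ι * M) := by
  have : NeZero M := ⟨hM.ne'⟩
  have hcard : Fintype.card (Fin s × Fin M) = Fintype.card B := by simp [hB]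
  let e := Fintype.equivOfCardEq hcard
  let T : (Fin s → Fin M) → Fin M → Finset β :=
    fun f j => univ.image fun k : Fin s => (e (k, j + f k) : β)
  have hinj : ∀ (f : Fin s → Fin M) j, Function.Injective fun k : Fin s => (e (k, j + f k) : β) := by
    intro f j k k' h
    have := e.injective (Subtype.ext h)
    exact (Prod.ext_iff.1 this).1
  have hcount : ∀ i j, (∑ f : Fin s → Fin M, if T f j ⊆ U i then (1 : ℝ) else 0)
      ≤ (u * M) ^ s := by
    intro i j
    have h1 : ∀ f : Fin s → Fin M, (if T f j ⊆ U i then (1 : ℝ) else 0) =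
        ∏ k, if (e (k, j + f k) : β) ∈ U i then (1 : ℝ) else 0 := by
      intro f
      rw [Finset.prod_ite_zero]
      simp [T, Finset.image_subset_iff]
    simp_rw [h1]
    rw [← Fintype.prod_sum fun k x => if (e (k, j + x) : β) ∈ U i then (1 : ℝ) else 0]
    apply prod_le_pow_of_sum_le _ _ (by positivity)
    · have h2 : ∀ k, (∑ x : Fin M, if (e (k, j + x) : β) ∈ U i then (1 : ℝ) else 0)
          = ∑ x : Fin M, if (e (k, x) : β) ∈ U i then (1 : ℝ) else 0 := fun k =>
        Equiv.sum_comp (Equiv.addLeft j) fun x => if (e (k, x) : β) ∈ U i then (1 : ℝ) else 0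
      simp_rw [h2]
      rw [← Fintype.sum_prod_type' fun k x => if (e (k, x) : β) ∈ U i then (1 : ℝ) else 0]
      rw [Equiv.sum_comp e fun b : B => if (b : β) ∈ U i then (1 : ℝ) else 0,
        Finset.sum_coe_sort B fun b => if b ∈ U i then (1 : ℝ) else 0]
      have h3 := hU i
      rw [hB] at h3
      rw [Finset.sum_boole, Finset.filter_mem_eq_inter, Finset.inter_comm]
      push_cast at h3 ⊢
      linarith
    · intro k
      positivity
  have htot : ∑ f : Fin s → Fin M, (#{x : ι × Fin M | T f x.2 ⊆ U x.1} : ℝ) ≤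
      ∑ f : Fin s → Fin M, u ^ s * (Fintype.card ι * M) := by
    calc ∑ f : Fin s → Fin M, (#{x : ι × Fin M | T f x.2 ⊆ U x.1} : ℝ)
        = ∑ x : ι × Fin M, ∑ f : Fin s → Fin M, if T f x.2 ⊆ U x.1 then (1 : ℝ) else 0 := by
          rw [Finset.sum_comm]; simp
      _ ≤ ∑ x : ι × Fin M, (u * M) ^ s := Finset.sum_le_sum fun x _ => hcount x.1 x.2
      _ = _ := by simp [mul_pow]; ring
  obtain ⟨f, -, hf⟩ := Finset.exists_le_of_sum_le Finset.univ_nonempty htot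
  refine ⟨T f, ?_, ?_, ?_, hf⟩
  · intro j x hx
    obtain ⟨k, -, rfl⟩ := Finset.mem_image.1 hx
    exact (e _).2
  · intro j
    rw [Finset.card_image_of_injective _ (hinj f j)]
    simp
  · intro j j' hjj
    rw [Finset.disjoint_left]
    intro x hx hx'
    obtain ⟨k, -, rfl⟩ := Finset.mem_image.1 hx
    obtain ⟨k', -, h⟩ := Finset.mem_image.1 hx'
    have := Prod.ext_iff.1 (e.injective (Subtype.ext h))
    obtain ⟨h1, h2⟩ := this
    simp only at h1 h2
    subst h1
    exact hjj (add_right_cancel h2).symm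

open scoped Classical in
theorem exists_disjoint_parts_card_le {α β : Type*} (R : α → β → Prop) (A : Finset α)
    (B : Finset β) {m N : ℕ} (hm : 0 < m) (hN : 0 < N) (hA : #A ≤ m * N) {μ : ℝ}
    (h : ∀ b ∈ B, μ * N ≤ #{a ∈ A | R a b}) :
    ∃ P : Fin N → Finset α, (∀ i, P i ⊆ A) ∧ (∀ i, #(P i) ≤ m) ∧
      (∀ i j, i ≠ j → Disjoint (P i) (P j)) ∧
      ∑ i, (#{b ∈ B | (#{a ∈ P i | R a b} : ℝ) < μ / 2} : ℝ) ≤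
        Real.exp (-((1 - Real.log 2) / 2 * μ)) * (N * #B) := by
  have : NeZero N := ⟨hN.ne'⟩
  have : NeZero m := ⟨hm.ne'⟩
  have hcard : Fintype.card A ≤ Fintype.card (Fin m × Fin N) := by simpa using hA
  obtain ⟨e₀⟩ := Function.Embedding.nonempty_of_card_le hcard
  let e : α → Fin m × Fin N := fun a => if h : a ∈ A then e₀ ⟨a, h⟩ else (0, 0)
  have he : Set.InjOn e A := by
    intro a ha a' ha' haa
    have ha1 : a ∈ A := ha
    have ha2 : a' ∈ A := ha'
    simp only [e, ha1, ha2, dif_pos] at haa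
    exact congrArg Subtype.val (e₀.injective haa)
  let P : (Fin m → Fin N) → Fin N → Finset α :=
    fun f i => {a ∈ A | (e a).2 = i + f (e a).1}
  have hcount : ∀ i, ∀ b ∈ B, ∑ f : Fin m → Fin N,
      (if (#{a ∈ P f i | R a b} : ℝ) < μ / 2 then (1 : ℝ) else 0) ≤
      Real.exp (-((1 - Real.log 2) / 2 * μ)) * (N : ℝ) ^ m := by
    intro i b hb
    set D : Finset (Fin m × Fin N) := {a ∈ A | R a b}.image e with hD
    have hDcard : μ * N ≤ #D := by
      rw [hD, Finset.card_image_of_injOn (he.mono (by intro a; simp; tauto))]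
      exact h b hb
    have h1 : ∀ f : Fin m → Fin N, (if (#{a ∈ P f i | R a b} : ℝ) < μ / 2 then (1 : ℝ) else 0) ≤
        Real.exp (μ / 2 * Real.log 2) *
          ∏ k, if (k, i + f k) ∈ D then (1 / 2 : ℝ) else 1 := by
      intro f
      have hX : #{k | (k, i + f k) ∈ D} ≤ #{a ∈ P f i | R a b} := by
        refine (Finset.card_le_card (t := {a ∈ P f i | R a b}.image fun a => (e a).1) ?_).trans
          Finset.card_image_le
        intro k hk
        simp only [hD, Finset.mem_filter, Finset.mem_univ, true_and, Finset.mem_image] at hk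
        obtain ⟨a, ⟨ha, hab⟩, hea⟩ := hk
        refine Finset.mem_image.2 ⟨a, ?_, by rw [hea]⟩
        simp [P, ha, hab, hea]
      rw [Finset.prod_ite, Finset.prod_const, Finset.prod_const_one, mul_one]
      split_ifs with hlt
      · have h2 : (1 / 2 : ℝ) ^ #{k | (k, i + f k) ∈ D} =
            Real.exp (-(#{k | (k, i + f k) ∈ D} * Real.log 2)) := by
          rw [Real.exp_neg, Real.exp_nat_mul, Real.exp_log two_pos]; simp
        rw [h2, ← Real.exp_add]
        apply Real.one_le_exp
        have h3 : (#{k | (k, i + f k) ∈ D} : ℝ) ≤ μ / 2 := by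
          have : (#{k | (k, i + f k) ∈ D} : ℝ) ≤ #{a ∈ P f i | R a b} := by exact_mod_cast hX
          linarith
        have := mul_le_mul_of_nonneg_right h3 (Real.log_nonneg one_le_two)
        linarith
      · positivity
    calc _ ≤ ∑ f : Fin m → Fin N, Real.exp (μ / 2 * Real.log 2) *
          ∏ k, (if (k, i + f k) ∈ D then (1 / 2 : ℝ) else 1) :=
          Finset.sum_le_sum fun f _ => h1 f
      _ = Real.exp (μ / 2 * Real.log 2) *
          ∏ k, ∑ x : Fin N, (if (k, i + x) ∈ D then (1 / 2 : ℝ) else 1) := by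
          rw [← Finset.mul_sum,
            ← Fintype.prod_sum fun k x => if (k, i + x) ∈ D then (1 / 2 : ℝ) else 1]
      _ = Real.exp (μ / 2 * Real.log 2) *
          ∏ k, ∑ x : Fin N, (if (k, x) ∈ D then (1 / 2 : ℝ) else 1) := by
          congr 1
          exact Finset.prod_congr rfl fun k _ => Equiv.sum_comp (Equiv.addLeft i)
            fun x => if (k, x) ∈ D then (1 / 2 : ℝ) else 1
      _ ≤ Real.exp (μ / 2 * Real.log 2) *
          ∏ k, ((N : ℝ) * Real.exp (-((∑ x : Fin N, if (k, x) ∈ D then (1 : ℝ) else 0)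
            / (2 * N)))) := by
          refine mul_le_mul_of_nonneg_left (Finset.prod_le_prod (fun k _ =>
            Finset.sum_nonneg fun x _ => by split_ifs <;> norm_num) fun k _ => ?_)
            (Real.exp_pos _).le
          set d := ∑ x : Fin N, if (k, x) ∈ D then (1 : ℝ) else 0 with hd
          have h4 : (∑ x : Fin N, if (k, x) ∈ D then (1 / 2 : ℝ) else 1) = N - d / 2 := by
            have : (N : ℝ) = ∑ x : Fin N, (1 : ℝ) := by simp
            rw [this, hd, Finset.sum_div, ← Finset.sum_sub_distrib]
            exact Finset.sum_congr rfl fun x _ => by split_ifs <;> norm_num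
          rw [h4]
          have h5 := Real.add_one_le_exp (-(d / (2 * N)))
          have hN' : (0 : ℝ) < N := by exact_mod_cast hN
          calc (N : ℝ) - d / 2 = N * (-(d / (2 * N)) + 1) := by field_simp; ring
            _ ≤ _ := by gcongr
      _ = Real.exp (μ / 2 * Real.log 2) * ((N : ℝ) ^ m * Real.exp (-(#D / (2 * N)))) := by
          rw [Finset.prod_mul_distrib, ← Real.exp_sum, Finset.sum_neg_distrib, ← Finset.sum_div,
            ← Fintype.sum_prod_type' fun k x => if (k, x) ∈ D then (1 : ℝ) else 0]
          simp
      _ ≤ Real.exp (μ / 2 * Real.log 2) * ((N : ℝ) ^ m * Real.exp (-(μ / 2))) := by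
          have hN' : (0 : ℝ) < N := by exact_mod_cast hN
          have h6 : μ / 2 ≤ #D / (2 * N) := by
            rw [div_le_div_iff₀ two_pos (by positivity)]
            linarith
          gcongr
      _ = _ := by
          rw [mul_left_comm, ← Real.exp_add, mul_comm]
          congr 2; ring
  have htot : ∑ f : Fin m → Fin N,
      ∑ i, (#{b ∈ B | (#{a ∈ P f i | R a b} : ℝ) < μ / 2} : ℝ) ≤
      ∑ f : Fin m → Fin N, Real.exp (-((1 - Real.log 2) / 2 * μ)) * (N * #B) := by
    calc _ = ∑ i, ∑ b ∈ B, ∑ f : Fin m → Fin N,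
          (if (#{a ∈ P f i | R a b} : ℝ) < μ / 2 then (1 : ℝ) else 0) := by
          rw [Finset.sum_comm]
          refine Finset.sum_congr rfl fun i _ => ?_
          rw [Finset.sum_comm]
          simp
      _ ≤ ∑ i : Fin N, ∑ b ∈ B, Real.exp (-((1 - Real.log 2) / 2 * μ)) * (N : ℝ) ^ m :=
          Finset.sum_le_sum fun i _ => Finset.sum_le_sum fun b hb => hcount i b hb
      _ = _ := by simp; ring
  obtain ⟨f, -, hf⟩ := Finset.exists_le_of_sum_le Finset.univ_nonempty htot
  refine ⟨P f, fun i => Finset.filter_subset _ _, ?_, ?_, hf⟩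
  · intro i
    have : Set.InjOn (fun a => (e a).1) (P f i) := by
      intro a ha a' ha' haa
      simp only [P, Finset.coe_filter, Set.mem_ofPred_eq] at ha ha' haa
      refine he ha.1 ha'.1 (Prod.ext haa ?_)
      rw [ha.2, ha'.2, haa]
    rw [← Finset.card_image_of_injOn this]
    simpa using Finset.card_le_univ ((P f i).image fun a => (e a).1)
  · intro i j hij
    rw [Finset.disjoint_left]
    intro a ha ha'
    simp only [P, Finset.mem_filter] at ha ha'
    exact hij (add_right_cancel (ha.2.symm.trans ha'.2))

open scoped Classical in
theorem exists_bicomplete_of_dense {N M t : ℕ} (hN : 0 < N) (hM : 0 < M) (ht : 0 < t)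
    (R : Fin N → Fin M → Prop) {ρ : ℝ} (hρ : 0 ≤ ρ)
    (hR : ρ * (N * M) ≤ #{x : Fin N × Fin M | R x.1 x.2})
    (h : (t : ℝ) ^ 2 / N + t / M < ρ ^ t) :
    ∃ (f : Fin t ↪ Fin N) (g : Fin t ↪ Fin M), ∀ i j, R (f i) (g j) := by
  have hN' : (0 : ℝ) < N := by exact_mod_cast hN
  have hM' : (0 : ℝ) < M := by exact_mod_cast hM
  by_contra hcon
  have hlt : ∀ f : Fin t ↪ Fin N, (#{j | ∀ i, R (f i) j} : ℝ) ≤ t := by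
    intro f
    by_contra hf
    push Not at hf
    have hf' : Fintype.card (Fin t) ≤ Fintype.card ({j | ∀ i, R (f i) j} : Finset (Fin M)) := by
      simp only [Fintype.card_fin, Fintype.card_coe]
      exact_mod_cast hf.le
    obtain ⟨g⟩ := Function.Embedding.nonempty_of_card_le hf'
    exact hcon ⟨f, g.trans (Function.Embedding.subtype _), fun i j => by
      have := (g j).2
      simp only [Finset.mem_filter, Finset.mem_univ, true_and] at this
      exact this i⟩
  have hlow : ρ ^ t * (N : ℝ) ^ t * M ≤ ∑ f : Fin t → Fin N, (#{j | ∀ i, R (f i) j} : ℝ) := by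
    have h1 : ∑ f : Fin t → Fin N, (#{j | ∀ i, R (f i) j} : ℝ) =
        ∑ j, (#{i | R i j} : ℝ) ^ t := by
      calc _ = ∑ j, ∑ f : Fin t → Fin N, if ∀ i, R (f i) j then (1 : ℝ) else 0 := by
            rw [Finset.sum_comm]; simp
        _ = ∑ j, ∑ f : Fin t → Fin N, ∏ i, if R (f i) j then (1 : ℝ) else 0 := by
            refine Finset.sum_congr rfl fun j _ => Finset.sum_congr rfl fun f _ => ?_
            rw [Finset.prod_ite_zero]; simp
        _ = ∑ j, ∏ i : Fin t, ∑ x : Fin N, if R x j then (1 : ℝ) else 0 := by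
            refine Finset.sum_congr rfl fun j _ => ?_
            rw [← Fintype.prod_sum fun (_ : Fin t) (x : Fin N) => if R x j then (1 : ℝ) else 0]
        _ = _ := by simp
    have h2 : ∑ j, (#{i | R i j} : ℝ) = #{x : Fin N × Fin M | R x.1 x.2} := by
      calc _ = ∑ j, ∑ i, (if R i j then (1 : ℝ) else 0) := by simp
        _ = ∑ x : Fin N × Fin M, (if R x.1 x.2 then (1 : ℝ) else 0) := by
            rw [Fintype.sum_prod_type, Finset.sum_comm]
        _ = _ := by rw [Finset.sum_boole]
    obtain ⟨s, rfl⟩ : ∃ s, t = s + 1 := ⟨t - 1, by omega⟩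
    have h3 := pow_sum_div_card_le_sum_pow (s := univ) (f := fun j => (#{i | R i j} : ℝ))
      (fun j _ => by positivity) s
    rw [h1]
    refine le_trans ?_ h3
    rw [h2, le_div_iff₀ (by simp; positivity), Finset.card_univ, Fintype.card_fin]
    calc ρ ^ (s + 1) * (N : ℝ) ^ (s + 1) * M * (M : ℝ) ^ s = (ρ * (N * M)) ^ (s + 1) := by
          rw [mul_pow, mul_pow]; ring
      _ ≤ _ := by gcongr
  have hinj : (N : ℝ) ^ t - (t : ℝ) ^ 2 / N * (N : ℝ) ^ t ≤
      #{f : Fin t → Fin N | Function.Injective f} := by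
    have h1 : #{f : Fin t → Fin N | Function.Injective f} = N.descFactorial t := by
      rw [← Fintype.card_subtype, Fintype.card_congr (Equiv.subtypeInjectiveEquivEmbedding _ _),
        Fintype.card_embedding_eq]
      simp
    rw [h1]
    by_cases hNt : t ≤ N
    · have h2 : ((N + 1 - t : ℕ) : ℝ) ^ t ≤ N.descFactorial t := by
        exact_mod_cast Nat.pow_sub_le_descFactorial N t
      refine le_trans ?_ h2
      have h3 : ((N + 1 - t : ℕ) : ℝ) = N + 1 - t := by
        rw [Nat.cast_sub (by omega)]; push_cast; ring
      have htN : (t : ℝ) ≤ N := by exact_mod_cast hNt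
      have h4 := one_add_mul_le_pow (a := -(t / N : ℝ)) (by
        have : (t : ℝ) / N ≤ 1 := (div_le_one hN').2 htN
        linarith) t
      calc (N : ℝ) ^ t - (t : ℝ) ^ 2 / N * (N : ℝ) ^ t
          = (1 + t * -(t / N : ℝ)) * (N : ℝ) ^ t := by ring
        _ ≤ (1 + -(t / N : ℝ)) ^ t * (N : ℝ) ^ t := by gcongr
        _ = (N - t : ℝ) ^ t := by rw [← mul_pow]; congr 1; field_simp; ring
        _ ≤ _ := by
          rw [h3]
          gcongr
          linarith
    · have htN : (N : ℝ) ≤ t := by exact_mod_cast (not_le.1 hNt).le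
      have ht1 : (1 : ℝ) ≤ t := by exact_mod_cast ht
      have : 1 ≤ (t : ℝ) ^ 2 / N := by
        rw [le_div_iff₀ hN']; nlinarith
      have h5 : (N : ℝ) ^ t ≤ (t : ℝ) ^ 2 / N * (N : ℝ) ^ t :=
        le_mul_of_one_le_left (by positivity) this
      have : (0 : ℝ) ≤ N.descFactorial t := by positivity
      linarith
  have hup : ∑ f : Fin t → Fin N, (#{j | ∀ i, R (f i) j} : ℝ) ≤
      t * (N : ℝ) ^ t + M * ((t : ℝ) ^ 2 / N * (N : ℝ) ^ t) := by
    have hall : (#{f : Fin t → Fin N | Function.Injective f} : ℝ) +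
        #{f : Fin t → Fin N | ¬ Function.Injective f} = (N : ℝ) ^ t := by
      have := Finset.card_filter_add_card_filter_not (s := (univ : Finset (Fin t → Fin N)))
        Function.Injective
      rw [Finset.card_univ, Fintype.card_fun, Fintype.card_fin, Fintype.card_fin] at this
      exact_mod_cast this
    rw [← Finset.sum_filter_add_sum_filter_not univ Function.Injective]
    have h1 : ∑ f : Fin t → Fin N with Function.Injective f, (#{j | ∀ i, R (f i) j} : ℝ) ≤
        #{f : Fin t → Fin N | Function.Injective f} * (t : ℝ) := by
      rw [← nsmul_eq_mul]
      exact Finset.sum_le_card_nsmul _ _ _ fun f hf => hlt ⟨f, (Finset.mem_filter.1 hf).2⟩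
    have h2 : ∑ f : Fin t → Fin N with ¬ Function.Injective f, (#{j | ∀ i, R (f i) j} : ℝ) ≤
        #{f : Fin t → Fin N | ¬ Function.Injective f} * (M : ℝ) := by
      rw [← nsmul_eq_mul]
      refine Finset.sum_le_card_nsmul _ _ _ fun f hf => ?_
      have := Finset.card_le_univ ({j | ∀ i, R (f i) j} : Finset (Fin M))
      rw [Fintype.card_fin] at this
      exact_mod_cast this
    refine add_le_add (h1.trans ?_) (h2.trans ?_)
    · rw [mul_comm]
      gcongr
      have : (0 : ℝ) ≤ #{f : Fin t → Fin N | ¬ Function.Injective f} := by positivity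
      linarith
    · rw [mul_comm]
      gcongr
      linarith
  have : ((t : ℝ) ^ 2 / N + t / M) * ((N : ℝ) ^ t * M) < ρ ^ t * ((N : ℝ) ^ t * M) := by
    gcongr
  have h6 : ((t : ℝ) ^ 2 / N + t / M) * ((N : ℝ) ^ t * M) =
      t * (N : ℝ) ^ t + M * ((t : ℝ) ^ 2 / N * (N : ℝ) ^ t) := by
    field_simp; ring
  linarith

theorem exists_superset_disjoint_card_eq {V ι : Type*} [Fintype V] [Fintype ι] {r : ℕ}
    (hr : Fintype.card ι * r ≤ Fintype.card V) (S : ι → Finset V)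
    (hS : ∀ i j, i ≠ j → Disjoint (S i) (S j)) (hcard : ∀ i, #(S i) ≤ r) :
    ∃ S' : ι → Finset V, (∀ i, S i ⊆ S' i) ∧ (∀ i, #(S' i) = r) ∧
      ∀ i j, i ≠ j → Disjoint (S' i) (S' j) := by
  classical
  induction h : ∑ i, (r - #(S i)) generalizing S with
  | zero =>
    refine ⟨S, fun i => subset_rfl, fun i => ?_, hS⟩
    have := (Finset.sum_eq_zero_iff.1 h) i (Finset.mem_univ i)
    have := hcard i
    omega
  | succ d ih =>
    obtain ⟨i, hi⟩ : ∃ i, #(S i) < r := by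
      by_contra hcon
      push Not at hcon
      have : ∑ i, (r - #(S i)) = 0 := Finset.sum_eq_zero fun i _ => by have := hcon i; omega
      omega
    have hlt : #(univ.biUnion S) < Fintype.card V := by
      refine (Finset.card_biUnion_le.trans_lt ?_).trans_le hr
      calc ∑ i, #(S i) < ∑ _i : ι, r :=
            Finset.sum_lt_sum (fun i _ => hcard i) ⟨i, Finset.mem_univ i, hi⟩
        _ = _ := by simp
    obtain ⟨v, hv⟩ : ∃ v, v ∉ univ.biUnion S := by
      by_contra hcon
      push Not at hcon
      rw [Finset.eq_univ_iff_forall.2 hcon, Finset.card_univ] at hlt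
      exact lt_irrefl _ hlt
    have hv' : ∀ j, v ∉ S j := by simpa using hv
    have hci : #(insert v (S i)) = #(S i) + 1 := Finset.card_insert_of_notMem (hv' i)
    obtain ⟨S', h1, h2, h3⟩ := ih (Function.update S i (insert v (S i))) (by
      intro j k hjk
      rcases eq_or_ne j i with rfl | hj
      · rw [Function.update_self, Function.update_of_ne hjk.symm, Finset.disjoint_insert_left]
        exact ⟨hv' k, hS _ _ hjk⟩
      · rw [Function.update_of_ne hj]
        rcases eq_or_ne k i with rfl | hk
        · rw [Function.update_self, Finset.disjoint_insert_right]
          exact ⟨hv' j, hS _ _ hjk⟩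
        · rw [Function.update_of_ne hk]
          exact hS _ _ hjk) (by
      intro j
      rcases eq_or_ne j i with rfl | hj
      · rw [Function.update_self]; omega
      · rw [Function.update_of_ne hj]; exact hcard j) (by
      rw [← Finset.add_sum_erase _ _ (Finset.mem_univ i)] at h ⊢
      rw [Function.update_self]
      have : ∑ j ∈ univ.erase i, (r - #(Function.update S i (insert v (S i)) j)) =
          ∑ j ∈ univ.erase i, (r - #(S j)) := Finset.sum_congr rfl fun j hj => by
        rw [Function.update_of_ne (Finset.ne_of_mem_erase hj)]
      rw [this]
      omega)
    refine ⟨S', fun j => ?_, h2, h3⟩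
    refine subset_trans ?_ (h1 j)
    rcases eq_or_ne j i with rfl | hj
    · rw [Function.update_self]; exact Finset.subset_insert _ _
    · rw [Function.update_of_ne hj]

theorem WeaklyBiCompleteSeq.weaklyCompleteSeq {V : Type*} {G : SimpleGraph V} {r t : ℕ}
    (h : WeaklyBiCompleteSeq G r t) : WeaklyCompleteSeq G (2 * r) t := by
  classical
  obtain ⟨S, T, hS, hT, hSS, hTT, hST, hadj⟩ := h
  refine ⟨fun i => S i ∪ T i, fun i => ?_, fun i j hij => ?_, fun i j _ => ?_⟩
  · rw [Finset.card_union_of_disjoint (hST i i), hS, hT, two_mul]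
  · rw [Finset.disjoint_union_left, Finset.disjoint_union_right, Finset.disjoint_union_right]
    exact ⟨⟨hSS i j hij, hST i j⟩, (hST j i).symm, hTT i j hij⟩
  · obtain ⟨u, hu, v, hv, huv⟩ := hadj i j
    exact ⟨u, Finset.mem_union_left _ hu, v, Finset.mem_union_right _ hv, huv⟩

theorem WeaklyBiCompleteSeq.of_card_le {V : Type*} [Fintype V] {G : SimpleGraph V} {r t : ℕ}
    (hr : 2 * t * r ≤ Fintype.card V) {A B : Finset V} (hAB : Disjoint A B)
    (S T : Fin t → Finset V) (hSA : ∀ i, S i ⊆ A) (hTB : ∀ i, T i ⊆ B)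
    (hS : ∀ i, #(S i) ≤ r) (hT : ∀ i, #(T i) ≤ r)
    (hSS : ∀ i j, i ≠ j → Disjoint (S i) (S j)) (hTT : ∀ i j, i ≠ j → Disjoint (T i) (T j))
    (hadj : ∀ i j, ∃ u ∈ S i, ∃ v ∈ T j, G.Adj u v) : WeaklyBiCompleteSeq G r t := by
  obtain ⟨W, h1, h2, h3⟩ := exists_superset_disjoint_card_eq (ι := Fin t ⊕ Fin t) (r := r)
    (by simpa [← two_mul] using hr) (Sum.elim S T) (by
      have hST : ∀ i j, Disjoint (S i) (T j) := fun i j =>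
        Finset.disjoint_of_subset_left (hSA i) (Finset.disjoint_of_subset_right (hTB j) hAB)
      rintro (i | i) (j | j) hij
      · exact hSS i j (by simpa using hij)
      · exact hST i j
      · exact (hST j i).symm
      · exact hTT i j (by simpa using hij)) (by
      rintro (i | i)
      · exact hS i
      · exact hT i)
  refine ⟨fun i => W (.inl i), fun i => W (.inr i), fun i => h2 _, fun i => h2 _,
    fun i j hij => h3 _ _ (by simpa using hij), fun i j hij => h3 _ _ (by simpa using hij),
    fun i j => h3 _ _ (by simp), fun i j => ?_⟩
  obtain ⟨u, hu, v, hv, huv⟩ := hadj i j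
  exact ⟨u, h1 (.inl i) hu, v, h1 (.inr j) hv, huv⟩

theorem exists_sum_le_four_mul_cut {V : Type*} [DecidableEq V] (a : V → V → ℝ)
    (hsymm : ∀ u v, a u v = a v u) (hdiag : ∀ v, a v v = 0)
    (S : Finset V) : ∃ A B : Finset V, Disjoint A B ∧ A ∪ B = S ∧
      ∑ u ∈ S, ∑ v ∈ S, a u v ≤ 4 * ∑ u ∈ A, ∑ v ∈ B, a u v := by
  induction S using Finset.induction_on with
  | empty => exact ⟨∅, ∅, by simp⟩
  | insert x S hx ih =>
    obtain ⟨A, B, hAB, rfl, h⟩ := ih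
    simp only [Finset.mem_union, not_or] at hx
    have hx' : x ∉ A ∪ B := by simp [hx]
    have hsum : ∑ u ∈ insert x (A ∪ B), ∑ v ∈ insert x (A ∪ B), a u v =
        ∑ u ∈ A ∪ B, ∑ v ∈ A ∪ B, a u v + 2 * (∑ v ∈ A, a x v + ∑ v ∈ B, a x v) := by
      rw [Finset.sum_insert hx', Finset.sum_insert hx', hdiag]
      simp_rw [Finset.sum_insert hx']
      rw [Finset.sum_add_distrib, Finset.sum_congr rfl fun u _ => hsymm u x,
        Finset.sum_union hAB]
      ring
    rw [hsum]
    rcases le_total (∑ v ∈ A, a x v) (∑ v ∈ B, a x v) with hle | hle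
    · refine ⟨insert x A, B, Finset.disjoint_insert_left.2 ⟨hx.2, hAB⟩,
        Finset.insert_union _ _ _, ?_⟩
      rw [Finset.sum_insert hx.1]
      linarith
    · refine ⟨A, insert x B, Finset.disjoint_insert_right.2 ⟨hx.1, hAB⟩,
        Finset.union_insert _ _ _, ?_⟩
      simp_rw [Finset.sum_insert hx.2]
      rw [Finset.sum_add_distrib, Finset.sum_congr rfl fun u _ => hsymm u x]
      linarith

open scoped Classical in
theorem exists_bipartite_min_degree {V : Type*} [Fintype V] (G : SimpleGraph V) {c : ℝ}
    (hc : 2 * c * Fintype.card V < G.edgeSet.ncard) (hc0 : 0 ≤ c) :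
    ∃ A B : Finset V, Disjoint A B ∧ A.Nonempty ∧ B.Nonempty ∧ #A ≤ #B ∧
      ∀ b ∈ B, c ≤ #{a ∈ A | G.Adj a b} := by
  let a : V → V → ℝ := fun u v => if G.Adj u v then 1 else 0
  have hsymm : ∀ u v, a u v = a v u := fun u v => by simp only [a, G.adj_comm]
  have hdiag : ∀ v, a v v = 0 := fun v => by simp [a]
  obtain ⟨A₀, B₀, hAB₀, hun, hcut⟩ := exists_sum_le_four_mul_cut a hsymm hdiag univ
  have hedges : ∑ u, ∑ v, a u v = 2 * G.edgeSet.ncard := by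
    have h1 : ∀ u, ∑ v, a u v = G.degree u := fun u => by
      simp only [a, Finset.sum_boole]
      rw [← G.card_neighborFinset_eq_degree, G.neighborFinset_eq_filter]
    simp_rw [h1]
    rw [← Nat.cast_sum, G.sum_degrees_eq_twice_card_edges, Set.ncard_eq_toFinset_card']
    simp [SimpleGraph.edgeFinset]
  let val : Finset V × Finset V → ℝ :=
    fun x => ∑ u ∈ x.1, ∑ v ∈ x.2, a u v - c * (#x.1 + #x.2)
  obtain ⟨⟨A, B⟩, hmem, hmax⟩ := Finset.exists_max_image
    {x : Finset V × Finset V | Disjoint x.1 x.2} val ⟨(A₀, B₀), by simpa using hAB₀⟩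
  have hAB : Disjoint A B := by simpa using hmem
  have hmax' : ∀ A' B' : Finset V, Disjoint A' B' → val (A', B') ≤ val (A, B) :=
    fun A' B' h => hmax (A', B') (by simpa using h)
  have hpos : 0 < val (A, B) := by
    refine lt_of_lt_of_le ?_ (hmax' A₀ B₀ hAB₀)
    have : (#A₀ : ℝ) + #B₀ = Fintype.card V := by
      rw [← Finset.card_univ, ← hun, Finset.card_union_of_disjoint hAB₀]; push_cast; rfl
    simp only [val]
    rw [this]
    linarith
  have hdegB : ∀ b ∈ B, c ≤ #{a ∈ A | G.Adj a b} := by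
    intro b hb
    have := hmax' A (B.erase b) (Finset.disjoint_of_subset_right (Finset.erase_subset _ _) hAB)
    simp only [val] at this
    rw [Finset.sum_comm, Finset.sum_comm (s := A) (t := B), ← Finset.add_sum_erase B _ hb,
      ← Finset.card_erase_add_one hb] at this
    push_cast at this
    simp only [a, Finset.sum_boole] at this
    linarith
  have hdegA : ∀ x ∈ A, c ≤ #{b ∈ B | G.Adj x b} := by
    intro x hx
    have := hmax' (A.erase x) B (Finset.disjoint_of_subset_left (Finset.erase_subset _ _) hAB)
    simp only [val] at this
    rw [← Finset.add_sum_erase A _ hx, ← Finset.card_erase_add_one hx] at this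
    push_cast at this
    simp only [a, Finset.sum_boole] at this
    linarith
  have hAne : A.Nonempty := by
    rw [Finset.nonempty_iff_ne_empty]
    rintro rfl
    simp only [val, Finset.sum_empty, Finset.card_empty] at hpos
    have : 0 ≤ c * ((0 : ℕ) + (#B : ℝ)) := by positivity
    linarith
  have hBne : B.Nonempty := by
    rw [Finset.nonempty_iff_ne_empty]
    rintro rfl
    simp only [val, Finset.sum_empty, Finset.card_empty, Finset.sum_const_zero] at hpos
    have : 0 ≤ c * ((#A : ℝ) + (0 : ℕ)) := by positivity
    linarith
  rcases le_total (#A) (#B) with h | h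
  · exact ⟨A, B, hAB, hAne, hBne, h, hdegB⟩
  · refine ⟨B, A, hAB.symm, hBne, hAne, h, fun x hx => ?_⟩
    simpa only [G.adj_comm] using hdegA x hx

theorem exists_disjoint_family {V : Type*} [DecidableEq V] (P : Finset V → Prop) {r K N : ℕ}
    (hNK : N * r ≤ K) (h : ∀ W : Finset V, #W ≤ K → ∃ S, P S ∧ #S ≤ r ∧ Disjoint S W) :
    ∃ S : Fin N → Finset V, (∀ i, P (S i)) ∧ (∀ i, #(S i) ≤ r) ∧
      ∀ i j, i ≠ j → Disjoint (S i) (S j) := by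
  induction N with
  | zero => exact ⟨Fin.elim0, fun i => i.elim0, fun i => i.elim0, fun i => i.elim0⟩
  | succ N ih =>
    obtain ⟨S, hP, hr, hS⟩ := ih (by nlinarith)
    obtain ⟨S', hP', hr', hS'⟩ := h (univ.biUnion S) (by
      calc #(univ.biUnion S) ≤ ∑ i, #(S i) := Finset.card_biUnion_le
        _ ≤ ∑ _i : Fin N, r := Finset.sum_le_sum fun i _ => hr i
        _ = N * r := by simp
        _ ≤ K := by nlinarith)
    have hdisj : ∀ i, Disjoint S' (S i) := fun i =>
      Finset.disjoint_of_subset_right (Finset.subset_biUnion_of_mem S (Finset.mem_univ i)) hS'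
    refine ⟨Fin.cons S' S, Fin.cases (by simpa) (by simpa), Fin.cases (by simpa) (by simpa), ?_⟩
    refine Fin.cases (Fin.cases (by simp) fun j _ => ?_)
      fun i => Fin.cases (fun _ => ?_) fun j hij => ?_
    · simpa using hdisj j
    · simpa using (hdisj i).symm
    · simpa using hS i j (by simpa using hij)

open scoped Classical in
theorem WeaklyBiCompleteSeq.of_few_vertices {V : Type*} [Fintype V] {G : SimpleGraph V}
    {A B : Finset V} (hAB : Disjoint A B) {c : ℝ} (hc : 0 < c)
    (hdeg : ∀ b ∈ B, c ≤ #{a ∈ A | G.Adj a b}) {N r t : ℕ} (hN : 0 < N) (hr : 0 < r)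
    (ht : 0 < t) (hNB : r * N ≤ #B) (hNc : 2 * (N * r : ℝ) ≤ c) {ρ : ℝ} (hρ : 0 ≤ ρ)
    (hρle : ρ ≤ 1 - (1 - c / (2 * #A)) ^ (r * r)) (hlt : (t : ℝ) ^ 2 / N + t / N < ρ ^ t)
    (hV : 2 * t * r ≤ Fintype.card V) : WeaklyBiCompleteSeq G r t := by
  obtain ⟨B', hB'B, hB'⟩ := Finset.exists_subset_card_eq hNB
  have hB'pos : 0 < #B' := by rw [hB']; positivity
  obtain ⟨b₀, hb₀⟩ := Finset.card_pos.1 hB'pos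
  have hcA : c ≤ #A := (hdeg b₀ (hB'B hb₀)).trans (by
    exact_mod_cast Finset.card_le_card (Finset.filter_subset _ _))
  have hApos : (0 : ℝ) < #A := hc.trans_le hcA
  set δ := c / (2 * #A) with hδ
  have hδ0 : 0 < δ := by positivity
  have hδ1 : δ < 1 := by rw [hδ, div_lt_one (by positivity)]; linarith
  have hδA : δ * #A = c / 2 := by rw [hδ]; field_simp
  obtain ⟨S, hSP, hSr, hSS⟩ := exists_disjoint_family (V := V) (r := r) (N := N) (K := N * r)
    (fun S => S ⊆ A ∧ (#{b ∈ B' | ∀ a ∈ S, ¬ G.Adj a b} : ℝ) ≤ (1 - δ) ^ r * #B') le_rfl (by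
      intro W hW
      have hW' : 2 * (#W : ℝ) ≤ c := by
        refine le_trans ?_ hNc
        exact_mod_cast Nat.mul_le_mul_left 2 hW
      have hdeg' : ∀ b ∈ B', c / 2 ≤ #{a ∈ A \ W | G.Adj a b} := by
        intro b hb
        have h1 : #{a ∈ A | G.Adj a b} ≤ #{a ∈ A \ W | G.Adj a b} + #W := by
          refine (Finset.card_le_card (t := {a ∈ A \ W | G.Adj a b} ∪ W) ?_).trans
            (Finset.card_union_le _ _)
          intro a
          simp only [Finset.mem_filter, Finset.mem_union, Finset.mem_sdiff]
          tauto
        have h2 : (#{a ∈ A | G.Adj a b} : ℝ) ≤ #{a ∈ A \ W | G.Adj a b} + #W := by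
          exact_mod_cast h1
        linarith [hdeg b (hB'B hb)]
      have hne : (A \ W).Nonempty := by
        rw [← Finset.card_pos]
        have h1 : (#{a ∈ A \ W | G.Adj a b₀} : ℝ) ≤ #(A \ W) := by
          exact_mod_cast Finset.card_le_card (Finset.filter_subset _ _)
        have h2 := hdeg' b₀ hb₀
        have : (0 : ℝ) < #(A \ W) := by linarith
        exact_mod_cast this
      obtain ⟨S, hS, hSr, hcov⟩ := exists_small_cover G.Adj (A \ W) B' hδ1.le hne (by
        intro b hb
        refine le_trans ?_ (hdeg' b hb)
        rw [← hδA]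
        have : #(A \ W) ≤ #A := Finset.card_le_card Finset.sdiff_subset
        gcongr) r
      exact ⟨S, ⟨hS.trans Finset.sdiff_subset, by convert hcov⟩, hSr,
        Finset.disjoint_of_subset_left hS Finset.sdiff_disjoint⟩)
  have hu : 0 < (1 - δ) ^ r := pow_pos (by linarith) r
  obtain ⟨T, hTB, hTr, hTT, hcount⟩ := exists_disjoint_transversals B' hN hB'
    (fun i => {b ∈ B' | ∀ a ∈ S i, ¬ G.Adj a b}) hu (fun i => by
      rw [Finset.inter_eq_left.2 (Finset.filter_subset _ _)]
      exact (hSP i).2)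
  obtain ⟨f, g, hfg⟩ := exists_bicomplete_of_dense hN hN ht
    (fun i j => ¬ T j ⊆ {b ∈ B' | ∀ a ∈ S i, ¬ G.Adj a b}) hρ (by
      have h1 := Finset.card_filter_add_card_filter_not (s := (univ : Finset (Fin N × Fin N)))
        (fun x => T x.2 ⊆ {b ∈ B' | ∀ a ∈ S x.1, ¬ G.Adj a b})
      have h2 : (#{x : Fin N × Fin N | T x.2 ⊆ {b ∈ B' | ∀ a ∈ S x.1, ¬ G.Adj a b}} : ℝ) +
          #{x : Fin N × Fin N | ¬ T x.2 ⊆ {b ∈ B' | ∀ a ∈ S x.1, ¬ G.Adj a b}} = N * N := by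
        rw [Finset.card_univ, Fintype.card_prod, Fintype.card_fin] at h1
        exact_mod_cast h1
      rw [← pow_mul, Fintype.card_fin] at hcount
      have h3 : ρ * (N * N) ≤ (1 - (1 - δ) ^ (r * r)) * (N * N) := by gcongr
      have h4 : ρ * (N * N) ≤
          #{x : Fin N × Fin N | ¬ T x.2 ⊆ {b ∈ B' | ∀ a ∈ S x.1, ¬ G.Adj a b}} := by linarith
      convert h4) hlt
  refine WeaklyBiCompleteSeq.of_card_le hV hAB (fun i => S (f i)) (fun j => T (g j))
    (fun i => (hSP _).1) (fun j => (hTB _).trans hB'B) (fun i => hSr _) (fun j => (hTr _).le)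
    (fun i j hij => hSS _ _ (f.injective.ne hij)) (fun i j hij => hTT _ _ (g.injective.ne hij))
    fun i j => ?_
  obtain ⟨v, hv, hv'⟩ := Finset.not_subset.1 (hfg i j)
  simp only [Finset.mem_filter, not_and, not_forall, not_not] at hv'
  obtain ⟨a, ha, hav⟩ := hv' (hTB _ hv)
  exact ⟨a, ha, v, hv, hav⟩

open scoped Classical in
theorem WeaklyBiCompleteSeq.of_disjoint_parts {V : Type*} [Fintype V] {G : SimpleGraph V}
    {A B : Finset V} (hAB : Disjoint A B) {c μ φ δ u : ℝ} {r s t m : ℕ}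
    (hdeg : ∀ b ∈ B, c ≤ #{a ∈ A | G.Adj a b}) (hs : 0 < s) (hsr : s ≤ r) (ht : 0 < t)
    (hm : 0 < m) (hA : #A ≤ m * (2 * t)) (hsB : s * t ≤ #B) (hμ : 0 < μ)
    (hμc : μ * (2 * t) ≤ c) (hφ : Real.exp (-((1 - Real.log 2) / 2 * μ)) ≤ φ)
    (hφ1 : 2 * φ < 1) (hδ0 : 0 ≤ δ) (hδ1 : δ ≤ 1) (hδm : δ * m ≤ μ / 2) (hu : 0 < u)
    (hcov : (1 - δ) ^ r * (1 - 2 * φ) + 2 * φ ≤ u) (hut : u ^ s * (t * t) < 1)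
    (hV : 2 * t * r ≤ Fintype.card V) : WeaklyBiCompleteSeq G r t := by
  obtain ⟨B', hB'B, hB'⟩ := Finset.exists_subset_card_eq hsB
  have hB'pos : 0 < #B' := by rw [hB']; positivity
  obtain ⟨P, hPA, hPm, hPP, hPbad⟩ := exists_disjoint_parts_card_le G.Adj A B'
    (N := 2 * t) hm (by omega) hA (μ := μ) (fun b hb => by
      push_cast; exact hμc.trans (hdeg b (hB'B hb)))
  let bad : Fin (2 * t) → Finset V := fun i => {b ∈ B' | (#{a ∈ P i | G.Adj a b} : ℝ) < μ / 2}
  have hbad : ∑ i, (#(bad i) : ℝ) ≤ φ * (2 * t * #B') := by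
    refine hPbad.trans ?_
    push_cast
    gcongr
  let I : Finset (Fin (2 * t)) := {i | (#(bad i) : ℝ) ≤ 2 * φ * #B'}
  have hI : t ≤ #I := by
    by_contra hcon
    have h1 : #I + #{i | ¬ (#(bad i) : ℝ) ≤ 2 * φ * #B'} = 2 * t := by
      have := Finset.card_filter_add_card_filter_not (s := (univ : Finset (Fin (2 * t))))
        (fun i => (#(bad i) : ℝ) ≤ 2 * φ * #B')
      simpa using this
    have h2 : t + 1 ≤ #{i | ¬ (#(bad i) : ℝ) ≤ 2 * φ * #B'} := by omega
    have hφ0 : 0 < φ := (Real.exp_pos _).trans_le hφ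
    have hB0 : (0 : ℝ) < #B' := by exact_mod_cast hB'pos
    have h3 : #{i | ¬ (#(bad i) : ℝ) ≤ 2 * φ * #B'} • (2 * φ * #B') ≤
        ∑ i with ¬ (#(bad i) : ℝ) ≤ 2 * φ * #B', (#(bad i) : ℝ) :=
      Finset.card_nsmul_le_sum _ _ _ fun i hi => (not_le.1 (Finset.mem_filter.1 hi).2).le
    have h4 : ∑ i with ¬ (#(bad i) : ℝ) ≤ 2 * φ * #B', (#(bad i) : ℝ) ≤ ∑ i, (#(bad i) : ℝ) :=
      Finset.sum_le_sum_of_subset_of_nonneg (Finset.filter_subset _ _) fun _ _ _ => by positivity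
    have h5 : ((t : ℝ) + 1) * (2 * φ * #B') ≤
        #{i | ¬ (#(bad i) : ℝ) ≤ 2 * φ * #B'} • (2 * φ * #B') := by
      rw [nsmul_eq_mul]
      gcongr
      exact_mod_cast h2
    have h6 : 0 < 2 * φ * #B' := by positivity
    linarith
  have hcover : ∀ i ∈ I, ∃ S ⊆ P i, #S ≤ r ∧
      (#{b ∈ B' | ∀ a ∈ S, ¬ G.Adj a b} : ℝ) ≤ u * #B' := by
    intro i hi
    have hi' : (#(bad i) : ℝ) ≤ 2 * φ * #B' := (Finset.mem_filter.1 hi).2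
    have hB0 : (0 : ℝ) < #B' := by exact_mod_cast hB'pos
    have hbB : bad i ⊆ B' := Finset.filter_subset _ _
    have hdeg' : ∀ b ∈ B' \ bad i, μ / 2 ≤ #{a ∈ P i | G.Adj a b} := by
      intro b hb
      rw [Finset.mem_sdiff, Finset.mem_filter, not_and, not_lt] at hb
      exact hb.2 hb.1
    have hsub : (#(B' \ bad i) : ℝ) = #B' - #(bad i) := by
      rw [Finset.card_sdiff_of_subset hbB, Nat.cast_sub (Finset.card_le_card hbB)]
    have hne : (P i).Nonempty := by
      have h1 : (0 : ℝ) < #(B' \ bad i) := by rw [hsub]; nlinarith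
      obtain ⟨b, hb⟩ := Finset.card_pos.1 (by exact_mod_cast h1 : 0 < #(B' \ bad i))
      have h2 := hdeg' b hb
      have h3 : (#{a ∈ P i | G.Adj a b} : ℝ) ≤ #(P i) := by
        exact_mod_cast Finset.card_le_card (Finset.filter_subset _ _)
      have h4 : (0 : ℝ) < #(P i) := by linarith
      exact Finset.card_pos.1 (by exact_mod_cast h4)
    obtain ⟨S, hSP, hSr, hS⟩ := exists_small_cover G.Adj (P i) (B' \ bad i) hδ1 hne (by
      intro b hb
      refine le_trans ?_ ((hδm).trans (hdeg' b hb))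
      gcongr
      exact hPm i) r
    refine ⟨S, hSP, hSr, ?_⟩
    have h1 : #{b ∈ B' | ∀ a ∈ S, ¬ G.Adj a b} ≤
        #(bad i) + #{b ∈ B' \ bad i | ∀ a ∈ S, ¬ G.Adj a b} := by
      refine (Finset.card_le_card
        (t := bad i ∪ {b ∈ B' \ bad i | ∀ a ∈ S, ¬ G.Adj a b}) ?_).trans
        (Finset.card_union_le _ _)
      intro b
      simp only [Finset.mem_filter, Finset.mem_union, Finset.mem_sdiff]
      tauto
    have h2 : (#{b ∈ B' | ∀ a ∈ S, ¬ G.Adj a b} : ℝ) ≤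
        #(bad i) + #{b ∈ B' \ bad i | ∀ a ∈ S, ¬ G.Adj a b} := by exact_mod_cast h1
    have h3 : (1 - δ) ^ r ≤ 1 := pow_le_one₀ (by linarith) (by linarith)
    have h4 : (#{b ∈ B' \ bad i | ∀ a ∈ S, ¬ G.Adj a b} : ℝ) ≤
        (1 - δ) ^ r * (#B' - #(bad i)) := by
      rw [← hsub]
      convert hS
    calc (#{b ∈ B' | ∀ a ∈ S, ¬ G.Adj a b} : ℝ)
        ≤ (1 - (1 - δ) ^ r) * #(bad i) + (1 - δ) ^ r * #B' := by linarith
      _ ≤ (1 - (1 - δ) ^ r) * (2 * φ * #B') + (1 - δ) ^ r * #B' := by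
          gcongr
      _ = ((1 - δ) ^ r * (1 - 2 * φ) + 2 * φ) * #B' := by ring
      _ ≤ u * #B' := by gcongr
  obtain ⟨f⟩ : Nonempty (Fin t ↪ I) := Function.Embedding.nonempty_of_card_le (by simpa using hI)
  choose S hSP hSr hScov using fun i : Fin t => hcover (f i) (f i).2
  obtain ⟨T, hTB, hTs, hTT, hcount⟩ := exists_disjoint_transversals B' ht hB'
    (fun i => {b ∈ B' | ∀ a ∈ S i, ¬ G.Adj a b}) hu (fun i => by
      rw [Finset.inter_eq_left.2 (Finset.filter_subset _ _)]
      exact hScov i)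
  rw [Fintype.card_fin] at hcount
  have hzero := hcount.trans_lt hut
  have hzero' : #{x : Fin t × Fin t | T x.2 ⊆ {b ∈ B' | ∀ a ∈ S x.1, ¬ G.Adj a b}} = 0 := by
    have : #{x : Fin t × Fin t | T x.2 ⊆ {b ∈ B' | ∀ a ∈ S x.1, ¬ G.Adj a b}} < 1 := by
      exact_mod_cast hzero
    omega
  refine WeaklyBiCompleteSeq.of_card_le hV hAB S T (fun i => (hSP i).trans (hPA _))
    (fun j => (hTB j).trans hB'B) hSr (fun j => (hTs j).le.trans hsr)
    (fun i j hij => ?_) hTT fun i j => ?_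
  · refine Finset.disjoint_of_subset_left (hSP i) (Finset.disjoint_of_subset_right (hSP j) ?_)
    exact hPP _ _ fun h => hij (f.injective (Subtype.ext h))
  · have hij := Finset.filter_eq_empty_iff.1 (Finset.card_eq_zero.1 hzero')
      (Finset.mem_univ (i, j))
    obtain ⟨v, hv, hv'⟩ := Finset.not_subset.1 hij
    simp only [Finset.mem_filter, not_and, not_forall, not_not] at hv'
    obtain ⟨a, ha, hav⟩ := hv' (hTB _ hv)
    exact ⟨a, ha, v, hv, hav⟩

open scoped Classical in
theorem exists_bipartite_of_edge_density {n : ℕ} (hn : 25 < n) (G : SimpleGraph (Fin n)) {p : ℝ}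
    (hp : 0 < p) (hG : (G.edgeSet.ncard : ℝ) = p * (n.choose 2 : ℝ)) :
    ∃ A B : Finset (Fin n), Disjoint A B ∧ (6 / 25 * p * n : ℝ) ≤ #A ∧ #A ≤ #B ∧ 2 * #A ≤ n ∧
      ∀ b ∈ B, (6 / 25 * p * n : ℝ) ≤ #{a ∈ A | G.Adj a b} := by
  have hn' : (26 : ℝ) ≤ n := by exact_mod_cast hn
  obtain ⟨A, B, hAB, -, ⟨b₀, hb₀⟩, hle, hdeg⟩ := exists_bipartite_min_degree G
    (c := 6 / 25 * p * n) (by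
      rw [hG, Nat.cast_choose_two, Fintype.card_fin]
      have : 0 < p * n * (n - 25) := by
        have : (0 : ℝ) < n - 25 := by linarith
        positivity
      nlinarith) (by positivity)
  refine ⟨A, B, hAB, ?_, hle, ?_, hdeg⟩
  · refine (hdeg b₀ hb₀).trans ?_
    exact_mod_cast Finset.card_le_card (Finset.filter_subset _ _)
  · have h1 := Finset.card_le_univ (A ∪ B)
    rw [Finset.card_union_of_disjoint hAB, Fintype.card_fin] at h1
    omega

theorem one_sub_pow_le_exp {δ : ℝ} (hδ : δ ≤ 1) (k : ℕ) : (1 - δ) ^ k ≤ Real.exp (-(δ * k)) := by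
  calc (1 - δ) ^ k ≤ Real.exp (-δ) ^ k := by
        have := Real.add_one_le_exp (-δ)
        exact pow_le_pow_left₀ (by linarith) (by linarith) k
    _ = _ := by rw [← Real.exp_nat_mul]; congr 1; ring

theorem WeaklyBiCompleteSeq.of_edge_density {n : ℕ} (hn : 25 < n) {G : SimpleGraph (Fin n)} {p : ℝ}
    (hp : 0 < p) (hp1 : p ≤ 1) (hG : (G.edgeSet.ncard : ℝ) = p * (n.choose 2 : ℝ)) {N r t : ℕ}
    (hN : 0 < N) (hr : 0 < r) (ht : 0 < t) (hNr : 2 * (N * r : ℝ) ≤ 6 / 25 * p * n) {ρ : ℝ}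
    (hρ : 0 ≤ ρ) (hρle : ρ ≤ 1 - Real.exp (-(6 / 25 * (p * r ^ 2))))
    (hlt : (t : ℝ) ^ 2 / N + t / N < ρ ^ t) : WeaklyBiCompleteSeq G r t := by
  classical
  obtain ⟨A, B, hAB, hcA, hAleB, hAn, hdeg⟩ := exists_bipartite_of_edge_density hn G hp hG
  have hn0 : (0 : ℝ) < n := by exact_mod_cast (by omega : 0 < n)
  have hN0 : (0 : ℝ) < N := by exact_mod_cast hN
  have hr0 : (0 : ℝ) < r := by exact_mod_cast hr
  have hc : 0 < 6 / 25 * p * n := by positivity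
  have hA0 : (0 : ℝ) < #A := hc.trans_le hcA
  have hAn' : 2 * (#A : ℝ) ≤ n := by exact_mod_cast hAn
  have hAB' : (#A : ℝ) ≤ #B := by exact_mod_cast hAleB
  have htN : t ≤ N := by
    have h0 := Real.exp_pos (-(6 / 25 * (p * (r : ℝ) ^ 2)))
    have h1 : ρ ^ t ≤ 1 := pow_le_one₀ hρ (by linarith)
    have h2 : (t : ℝ) / N ≤ 1 := by
      have : 0 ≤ (t : ℝ) ^ 2 / N := by positivity
      linarith
    rw [div_le_one hN0] at h2
    exact_mod_cast h2
  refine WeaklyBiCompleteSeq.of_few_vertices hAB hc hdeg hN hr ht ?_ hNr hρ ?_ hlt ?_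
  · have h1 : (r * N : ℝ) ≤ #B := by nlinarith
    exact_mod_cast h1
  · have hδ1 : 6 / 25 * p * n / (2 * #A) ≤ 1 := by
      rw [div_le_one (by positivity)]; linarith
    have hδ : 6 / 25 * p ≤ 6 / 25 * p * n / (2 * #A) := by
      rw [le_div_iff₀ (by positivity)]
      gcongr
    have h1 := one_sub_pow_le_exp hδ1 (r * r)
    have h2 : Real.exp (-(6 / 25 * p * n / (2 * #A) * (r * r : ℕ))) ≤
        Real.exp (-(6 / 25 * (p * r ^ 2))) := by
      rw [Real.exp_le_exp, neg_le_neg_iff]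
      calc 6 / 25 * (p * (r : ℝ) ^ 2) = 6 / 25 * p * (r * r : ℕ) := by push_cast; ring
        _ ≤ _ := by gcongr
    linarith
  · rw [Fintype.card_fin]
    have h1 : (2 * t * r : ℝ) ≤ n := by
      have htN' : (t : ℝ) ≤ N := by exact_mod_cast htN
      calc (2 * t * r : ℝ) ≤ 2 * (N * r) := by rw [mul_assoc]; gcongr
        _ ≤ 6 / 25 * p * n := hNr
        _ ≤ 1 * n := by gcongr; linarith
        _ = n := one_mul _
    exact_mod_cast h1

theorem four_mul_exp_neg_half_le_one {x : ℝ} (hx : 3 ≤ x) : 4 * Real.exp (-(x / 2)) ≤ 1 := by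
  have h1 : 4 ≤ Real.exp (x / 2) := by
    have h2 : Real.exp 1 * Real.exp (1 / 2) ≤ Real.exp (x / 2) := by
      rw [← Real.exp_add, Real.exp_le_exp]; linarith
    have h3 := Real.exp_one_gt_d9
    have h4 := Real.add_one_le_exp (1 / 2 : ℝ)
    nlinarith
  rw [Real.exp_neg, ← div_eq_mul_inv, div_le_one (Real.exp_pos _)]
  exact h1

theorem cover_inequality {q w x : ℝ} (hq0 : 0 < q) (hq1 : 4 * q ≤ 1) (hqw : q ≤ w) (hw1 : w ≤ 1)
    (hx : x ≤ w ^ 2) : x * (1 - 2 * q ^ 2) + 2 * q ^ 2 ≤ w := by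
  have h2 : x * (1 - 2 * q ^ 2) ≤ w ^ 2 * (1 - 2 * q ^ 2) := by
    gcongr
    nlinarith
  have h3 : 0 ≤ (1 - w) * (w - 2 * q ^ 2 * (1 + w)) := by
    apply mul_nonneg (by linarith)
    nlinarith
  linarith

set_option maxHeartbeats 1600000 in
theorem WeaklyBiCompleteSeq.of_large_sets {n : ℕ} (hn : 25 < n) {G : SimpleGraph (Fin n)} {p : ℝ}
    (hp : 0 < p) (hp1 : p ≤ 1) (hG : (G.edgeSet.ncard : ℝ) = p * (n.choose 2 : ℝ)) {r t : ℕ}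
    (ht : 0 < t) {L : ℝ} (hL : 3 ≤ L) (hlog : Real.log n ≤ 7 / 10 * L ^ 2)
    (hr : 16 * L ^ 2 ≤ p * r ^ 2) (htp : 64 * L * t ≤ p * n) (htr : 2 * t * r ≤ n) :
    WeaklyBiCompleteSeq G r t := by
  classical
  obtain ⟨A, B, hAB, hcA, hAleB, hAn, hdeg⟩ := exists_bipartite_of_edge_density hn G hp hG
  have hn0 : (0 : ℝ) < n := by exact_mod_cast (by omega : 0 < n)
  have ht0 : (0 : ℝ) < t := by exact_mod_cast ht
  have hAn' : 2 * (#A : ℝ) ≤ n := by exact_mod_cast hAn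
  have hAB' : (#A : ℝ) ≤ #B := by exact_mod_cast hAleB
  set c := 6 / 25 * p * n with hc
  have hc0 : 0 < c := by positivity
  have hA0 : (0 : ℝ) < #A := hc0.trans_le hcA
  set μ := c / (2 * t) with hμ
  have hμL : 192 / 25 * L ≤ μ := by
    rw [hμ, le_div_iff₀ (by positivity)]
    linarith
  have hμ0 : 0 < μ := by linarith
  have hμA : μ ≤ #A / (2 * t) := by rw [hμ]; gcongr
  set m := ⌈(#A : ℝ) / (2 * t)⌉₊ with hm
  have hm1 : (#A : ℝ) / (2 * t) ≤ m := Nat.le_ceil _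
  have hm2 : (m : ℝ) < #A / (2 * t) + 1 := Nat.ceil_lt_add_one (by positivity)
  have hm0 : (0 : ℝ) < m := by linarith
  have hm3 : (m : ℝ) ≤ 21 / 20 * (#A / (2 * t)) := by linarith
  set δ := μ / (2 * m) with hδ
  have hδm : δ * m = μ / 2 := by rw [hδ]; field_simp
  have hδ0 : 0 < δ := by positivity
  have hδ1 : δ ≤ 1 := by rw [hδ, div_le_one (by positivity)]; linarith
  have hδc : 10 / 21 * c ≤ δ * #A := by
    have h1 : δ * m ≤ δ * (21 / 20 * (#A / (2 * t))) := by gcongr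
    rw [hδm, hμ] at h1
    have h2 : c / (2 * t) / 2 = 21 / 20 * (10 / 21 * c) / (2 * t) := by ring
    have h3 : δ * (21 / 20 * (#A / (2 * t))) = 21 / 20 * (δ * #A) / (2 * t) := by ring
    rw [h2, h3, div_le_div_iff_of_pos_right (by positivity)] at h1
    linarith
  have hδp : 8 / 35 * p ≤ δ := by
    have h1 : 10 / 21 * c ≤ δ * (n / 2) := hδc.trans (by gcongr; linarith)
    have h2 : 8 / 35 * p * n ≤ δ * n := by rw [hc] at h1; linarith
    exact le_of_mul_le_mul_right h2 hn0
  have hr4 : 4 * L ≤ r := by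
    have h1 : p * (r : ℝ) ^ 2 ≤ r ^ 2 := mul_le_of_le_one_left (by positivity) hp1
    exact abs_le_of_sq_le_sq' (by linarith) (by positivity) |>.2
  set b := ⌊(#B : ℝ) / t⌋₊ with hb
  have hBt : (#B : ℝ) / t ≥ 2 * μ := by
    rw [hμ, ge_iff_le, le_div_iff₀ ht0]
    calc 2 * (c / (2 * t)) * t = c := by field_simp
      _ ≤ #B := hcA.trans hAB'
  have hb1 : (b : ℝ) ≤ #B / t := Nat.floor_le (by positivity)
  have hb2 : (#B : ℝ) / t < b + 1 := Nat.lt_floor_add_one _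
  have hb3 : 9 / 10 * (#B / t : ℝ) ≤ b := by linarith
  have hbpos : (0 : ℝ) < b := by linarith
  have hφL : Real.exp (-((1 - Real.log 2) / 2 * μ)) ≤ Real.exp (-L) := by
    rw [Real.exp_le_exp, neg_le_neg_iff]
    have h1 := Real.log_two_lt_d9
    calc L ≤ 3 / 20 * (192 / 25 * L) := by linarith
      _ ≤ (1 - Real.log 2) / 2 * μ := mul_le_mul (by linarith) hμL (by linarith) (by linarith)
  set q := Real.exp (-(L / 2)) with hq
  have hq2 : Real.exp (-L) = q ^ 2 := by rw [hq, ← Real.exp_nat_mul]; congr 1; push_cast; ring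
  have hq0 : 0 < q := Real.exp_pos _
  have hq1 : 4 * q ≤ 1 := four_mul_exp_neg_half_le_one hL
  set z := min (δ * r) L with hz
  have hz0 : 0 ≤ z := le_min (by positivity) (by linarith)
  have hL2 : 0 ≤ L ^ 2 := sq_nonneg L
  have hμL2 : 384 / 25 * L ≤ 2 * μ := by linarith
  have hδB : 10 / 21 * c ≤ δ * #B := hδc.trans (by gcongr)
  have hbL : 3 * L ≤ b := by linarith
  have hzs : 14 / 5 * L ^ 2 ≤ z * (min r b : ℕ) := by
    have hzL : 0 ≤ L := by linarith
    rw [hz, Nat.cast_min, min_mul_of_nonneg _ _ (by positivity)]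
    refine le_min ?_ ?_
    · rw [mul_min_of_nonneg _ _ (by positivity)]
      refine le_min ?_ ?_
      · calc 14 / 5 * L ^ 2 ≤ 8 / 35 * (16 * L ^ 2) := by linarith
          _ ≤ 8 / 35 * (p * r ^ 2) := by gcongr
          _ = 8 / 35 * p * (r * r) := by ring
          _ ≤ δ * (r * r) := by gcongr
          _ = _ := by ring
      · calc 14 / 5 * L ^ 2 ≤ 9 / 10 * (10 / 21 * (384 / 25 * L)) * (4 * L) := by linarith
          _ ≤ 9 / 10 * (10 / 21 * (2 * μ)) * r := by gcongr
          _ = 9 / 10 * (10 / 21 * c) / t * r := by rw [hμ]; field_simp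
          _ ≤ 9 / 10 * (δ * #B) / t * r := by gcongr 9 / 10 * ?_ / t * r
          _ = δ * r * (9 / 10 * (#B / t)) := by ring
          _ ≤ _ := by gcongr
    · rw [mul_min_of_nonneg _ _ hzL]
      refine le_min ?_ ?_
      · calc 14 / 5 * L ^ 2 ≤ L * (4 * L) := by linarith
          _ ≤ L * r := by gcongr
      · calc 14 / 5 * L ^ 2 ≤ L * (3 * L) := by linarith
          _ ≤ L * b := by gcongr
  refine WeaklyBiCompleteSeq.of_disjoint_parts (c := c) (μ := μ) (φ := q ^ 2) (δ := δ)
    (u := Real.exp (-(z / 2))) (s := min r b) (m := m) hAB hdeg ?_ (min_le_left _ _) ht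
    (by exact_mod_cast hm0) ?_ ?_ hμ0 ?_ (hφL.trans hq2.le) ?_ hδ0.le hδ1 hδm.le
    (Real.exp_pos _) ?_ ?_ (by rwa [Fintype.card_fin])
  · have : (0 : ℝ) < r := by linarith
    exact lt_min (by exact_mod_cast this) (by exact_mod_cast hbpos)
  · rw [div_le_iff₀ (by positivity)] at hm1
    exact_mod_cast hm1
  · rw [le_div_iff₀ ht0] at hb1
    have h1 : b * t ≤ #B := by exact_mod_cast hb1
    exact (Nat.mul_le_mul_right t (min_le_right _ _)).trans h1
  · rw [hμ]; exact (div_mul_cancel₀ _ (by positivity)).le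
  · have h1 : q * q ≤ 1 / 4 * (1 / 4) := by gcongr <;> linarith
    linarith
  · set w := Real.exp (-(z / 2)) with hw
    have hw1 : w ≤ 1 := by rw [hw, Real.exp_le_one_iff]; linarith
    have hqw : q ≤ w := by
      rw [hq, hw, Real.exp_le_exp]
      have := min_le_right (δ * r) L
      linarith
    have h1 : (1 - δ) ^ r ≤ w ^ 2 := by
      refine (one_sub_pow_le_exp hδ1 r).trans ?_
      rw [hw, ← Real.exp_nat_mul, Real.exp_le_exp]
      have := min_le_left (δ * r) L
      push_cast
      linarith
    exact cover_inequality hq0 hq1 hqw hw1 h1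
  · have htn : (t : ℝ) < n := by
      calc (t : ℝ) = 1 * t := (one_mul _).symm
        _ < 64 * L * t := by gcongr; linarith
        _ ≤ p * n := htp
        _ ≤ n := mul_le_of_le_one_left hn0.le hp1
    have hlogt : Real.log t < Real.log n := Real.log_lt_log ht0 htn
    have h1 : (t : ℝ) * t = Real.exp (Real.log t + Real.log t) := by
      rw [Real.exp_add, Real.exp_log ht0]
    rw [← Real.exp_nat_mul, h1, ← Real.exp_add, Real.exp_lt_one_iff]
    linarith

theorem rpow_neg_le_pow {x ρ a : ℝ} {t : ℕ} (hx : 0 < x) (hρ : 0 < ρ)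
    (h : -(a * Real.log x) ≤ t * Real.log ρ) : x ^ (-a) ≤ ρ ^ t := by
  rw [Real.rpow_def_of_pos hx, ← Real.rpow_natCast, Real.rpow_def_of_pos hρ, Real.exp_le_exp]
  linarith

theorem sq_div_add_div_lt {x y a b t N : ℝ} (hx : 0 < x) (ht : 1 ≤ t) (hN : x ^ a ≤ N)
    (hy : x ^ (-b) ≤ y) (h : 2 * t ^ 2 < x ^ (a - b)) : t ^ 2 / N + t / N < y := by
  have hxa : 0 < x ^ a := Real.rpow_pos_of_pos hx a
  have hN0 : 0 < N := hxa.trans_le hN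
  have h1 : t ^ 2 + t ≤ 2 * t ^ 2 := by nlinarith
  rw [← add_div, div_lt_iff₀ hN0]
  calc t ^ 2 + t < x ^ (a - b) := h1.trans_lt h
    _ = x ^ (-b) * x ^ a := by rw [← Real.rpow_add hx]; congr 1; ring
    _ ≤ y * N := by
      gcongr
      exact (Real.rpow_nonneg hx.le _).trans hy

theorem two_mul_le_of_rpow_neg_le {x p a b N r l : ℝ} (hx : 0 < x) (hp : x ^ (-b) ≤ p) (hl : 0 ≤ l)
    (hab : a + 3 / 2 * b = 4 / 5) (hr : 0 ≤ r) (hrp : r ≤ l * p ^ (-(1 / 2) : ℝ))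
    (hN : N ≤ 2 * x ^ a) (hlx : 17 * l ≤ x ^ (1 / 5 : ℝ)) : 2 * (N * r) ≤ 6 / 25 * p * x := by
  have hp0 : 0 < p := (Real.rpow_pos_of_pos hx _).trans_le hp
  have hxa : 0 < x ^ a := Real.rpow_pos_of_pos hx a
  have hp2 : 0 < p ^ (-(1 / 2) : ℝ) := Real.rpow_pos_of_pos hp0 _
  have hpb : x ^ (-(3 / 2 * b)) ≤ p ^ (3 / 2 : ℝ) := by
    calc x ^ (-(3 / 2 * b)) = (x ^ (-b)) ^ (3 / 2 : ℝ) := by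
          rw [← Real.rpow_mul hx.le]; congr 1; ring
      _ ≤ _ := by gcongr
  calc 2 * (N * r) ≤ 2 * (2 * x ^ a * (l * p ^ (-(1 / 2) : ℝ))) := by gcongr
    _ ≤ 6 / 25 * (x ^ a * (17 * l) * p ^ (-(1 / 2) : ℝ)) := by
      have : 0 ≤ x ^ a * l * p ^ (-(1 / 2) : ℝ) := by positivity
      linarith
    _ ≤ 6 / 25 * (x ^ a * x ^ (1 / 5 : ℝ) * p ^ (-(1 / 2) : ℝ)) := by gcongr
    _ = 6 / 25 * (x ^ (-(3 / 2 * b)) * x * p ^ (-(1 / 2) : ℝ)) := by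
      rw [← Real.rpow_add hx, ← Real.rpow_add_one hx.ne',
        show a + 1 / 5 = -(3 / 2 * b) + 1 by linarith]
    _ ≤ 6 / 25 * (p ^ (3 / 2 : ℝ) * x * p ^ (-(1 / 2) : ℝ)) := by gcongr
    _ = 6 / 25 * (p ^ (3 / 2 : ℝ) * p ^ (-(1 / 2) : ℝ)) * x := by ring
    _ = _ := by rw [← Real.rpow_add hp0]; norm_num

theorem ceil_le_two_mul {x : ℝ} (hx : 1 ≤ x) : (⌈x⌉₊ : ℝ) ≤ 2 * x := by
  have := Nat.ceil_lt_add_one (zero_le_one.trans hx)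
  linarith

theorem log_le_mul_logb_two {x : ℝ} (hx : 1 ≤ x) : Real.log x ≤ 7 / 10 * Real.logb 2 x := by
  have h2 := Real.log_two_lt_d9
  rw [Real.logb, ← mul_div_assoc, le_div_iff₀ (Real.log_pos one_lt_two)]
  nlinarith [Real.log_nonneg hx]

theorem logb_two_le_mul_log {x : ℝ} (hx : 1 ≤ x) : Real.logb 2 x ≤ 29 / 20 * Real.log x := by
  have h1 := Real.log_two_gt_d9
  rw [Real.logb, div_le_iff₀ (Real.log_pos one_lt_two)]
  nlinarith [Real.log_nonneg hx]

theorem mul_sq_rpow_neg_half {p : ℝ} (hp : 0 < p) : p * (p ^ (-(1 / 2) : ℝ)) ^ 2 = 1 := by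
  rw [← Real.rpow_mul_natCast hp.le]
  norm_num
  rw [Real.rpow_neg_one, mul_inv_cancel₀ hp.ne']

theorem eventually_mul_logb_pow_le (k : ℕ) (C : ℝ) {ε : ℝ} (hε : 0 < ε) :
    ∀ᶠ n : ℕ in Filter.atTop, C * Real.logb 2 n ^ k ≤ (n : ℝ) ^ ε := by
  have h := ((isLittleO_log_rpow_rpow_atTop (k : ℝ) hε).const_mul_left
    (C / Real.log 2 ^ k)).comp_tendsto tendsto_natCast_atTop_atTop
  filter_upwards [h.bound one_pos] with n hn
  have h1 := (le_abs_self _).trans hn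
  simp only [Function.comp, one_mul, Real.rpow_natCast, Real.norm_eq_abs] at h1
  rw [abs_of_nonneg (by positivity)] at h1
  rw [Real.logb, div_pow]
  calc _ = _ := by ring
    _ ≤ _ := h1

section LargeOrder

variable {n : ℕ} {G : SimpleGraph (Fin n)} {p : ℝ} {r t : ℕ}

theorem WeaklyBiCompleteSeq.of_le_two_mul_rpow (hn : 512 ≤ n) (hl : 9 ≤ Real.logb 2 n)
    (hl1 : 17 * Real.logb 2 n ≤ (n : ℝ) ^ (1 / 5 : ℝ))
    (hl2 : Real.logb 2 n ^ 2 ≤ (n : ℝ) ^ (1 / 50 : ℝ)) (hp : 0 < p) (hp1 : p ≤ 1)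
    (hG : (G.edgeSet.ncard : ℝ) = p * (n.choose 2 : ℝ)) (hr : 0 < r) (ht : 0 < t)
    (hpn : (n : ℝ) ^ (-(1 / 3) : ℝ) ≤ p) (hrp : (r : ℝ) ≤ 2 * p ^ (-(1 / 2) : ℝ))
    (htn : (t : ℝ) ≤ Real.logb 2 n / (4 * Real.logb 2 (32 / (p * (r : ℝ) ^ 2)))) :
    WeaklyBiCompleteSeq G r t := by
  have hn1 : (1 : ℝ) ≤ n := by exact_mod_cast (by omega : 1 ≤ n)
  have hn0 : (0 : ℝ) < n := by linarith
  have hr0 : (0 : ℝ) < r := by exact_mod_cast hr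
  have ht1 : (1 : ℝ) ≤ t := by exact_mod_cast ht
  have hp2 : 0 < p ^ (-(1 / 2) : ℝ) := Real.rpow_pos_of_pos hp _
  have hna : 1 ≤ (n : ℝ) ^ (3 / 10 : ℝ) := Real.one_le_rpow hn1 (by norm_num)
  obtain ⟨y, hy⟩ : ∃ y, y = p * (r : ℝ) ^ 2 := ⟨_, rfl⟩
  have hy0 : 0 < y := by rw [hy]; positivity
  have hy4 : y ≤ 4 := by
    calc y ≤ p * (2 * p ^ (-(1 / 2) : ℝ)) ^ 2 := by rw [hy]; gcongr
      _ = 4 * (p * (p ^ (-(1 / 2) : ℝ)) ^ 2) := by ring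
      _ = 4 := by rw [mul_sq_rpow_neg_half hp, mul_one]
  rw [← hy] at htn
  have hb3 : 3 ≤ Real.logb 2 (32 / y) := by
    rw [Real.le_logb_iff_rpow_le one_lt_two (by positivity), le_div_iff₀ hy0]
    norm_num
    linarith
  rw [le_div_iff₀ (by linarith)] at htn
  have htl : 12 * (t : ℝ) ≤ Real.logb 2 n := by nlinarith
  refine WeaklyBiCompleteSeq.of_edge_density (N := ⌈(n : ℝ) ^ (3 / 10 : ℝ)⌉₊) (ρ := y / 32)
    (by omega) hp hp1 hG (Nat.ceil_pos.2 (by linarith)) hr ht ?_ (by positivity) ?_ ?_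
  · refine two_mul_le_of_rpow_neg_le (a := 3 / 10) (b := 1 / 3) hn0 hpn (by linarith)
      (by norm_num) hr0.le (hrp.trans ?_) (ceil_le_two_mul hna) hl1
    gcongr
    linarith
  · rw [← hy]
    have h1 := Real.add_one_le_exp (6 / 25 * y)
    have h2 : Real.exp (-(6 / 25 * y)) ≤ (6 / 25 * y + 1)⁻¹ := by
      rw [Real.exp_neg]
      gcongr
    have h3 : (6 / 25 * y + 1)⁻¹ ≤ 1 - y / 32 := by
      rw [inv_le_iff_one_le_mul₀ (by positivity)]
      nlinarith
    linarith
  · refine sq_div_add_div_lt (a := 3 / 10) (b := 1 / 4) hn0 ht1 (Nat.le_ceil _)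
      (rpow_neg_le_pow hn0 (by positivity) ?_) ?_
    · have h1 : Real.log (y / 32) = -Real.log (32 / y) := by rw [← Real.log_inv, inv_div]
      have h2 : Real.logb 2 (32 / y) * Real.log 2 = Real.log (32 / y) :=
        div_mul_cancel₀ _ (Real.log_pos one_lt_two).ne'
      have h3 : Real.logb 2 n * Real.log 2 = Real.log n :=
        div_mul_cancel₀ _ (Real.log_pos one_lt_two).ne'
      rw [h1, ← h2, ← h3]
      have := mul_le_mul_of_nonneg_right htn (Real.log_pos one_lt_two).le
      linarith
    · have h1 : (n : ℝ) ^ (1 / 50 : ℝ) ≤ (n : ℝ) ^ (3 / 10 - 1 / 4 : ℝ) :=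
        Real.rpow_le_rpow_of_exponent_le hn1 (by norm_num)
      nlinarith

theorem WeaklyBiCompleteSeq.of_four_mul_rpow_le (hn : 512 ≤ n) (hl : 9 ≤ Real.logb 2 n)
    (hl1 : 17 * Real.logb 2 n ≤ (n : ℝ) ^ (1 / 5 : ℝ))
    (hl2 : Real.logb 2 n ^ 2 ≤ (n : ℝ) ^ (1 / 50 : ℝ)) (hp : 0 < p) (hp1 : p ≤ 1)
    (hG : (G.edgeSet.ncard : ℝ) = p * (n.choose 2 : ℝ)) (hr : 0 < r) (ht : 0 < t)
    (hpn : (n : ℝ) ^ (-(1 / 5) : ℝ) ≤ p) (hrp : 4 * p ^ (-(1 / 2) : ℝ) ≤ (r : ℝ))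
    (hrl : (r : ℝ) ≤ Real.sqrt (p⁻¹ * Real.logb 2 n))
    (htn : (t : ℝ) ≤ (1 / 16) * Real.exp (p * (r : ℝ) ^ 2 / 8) * Real.logb 2 n) :
    WeaklyBiCompleteSeq G r t := by
  have hn1 : (1 : ℝ) ≤ n := by exact_mod_cast (by omega : 1 ≤ n)
  have hn0 : (0 : ℝ) < n := by linarith
  have hr0 : (0 : ℝ) < r := by exact_mod_cast hr
  have ht1 : (1 : ℝ) ≤ t := by exact_mod_cast ht
  have hp2 : 0 < p ^ (-(1 / 2) : ℝ) := Real.rpow_pos_of_pos hp _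
  have hna : 1 ≤ (n : ℝ) ^ (1 / 2 : ℝ) := Real.one_le_rpow hn1 (by norm_num)
  have hlog := logb_two_le_mul_log hn1
  obtain ⟨y, hy⟩ : ∃ y, y = p * (r : ℝ) ^ 2 := ⟨_, rfl⟩
  have hy16 : 16 ≤ y := by
    calc (16 : ℝ) = 16 * (p * (p ^ (-(1 / 2) : ℝ)) ^ 2) := by
          rw [mul_sq_rpow_neg_half hp, mul_one]
      _ = p * (4 * p ^ (-(1 / 2) : ℝ)) ^ 2 := by ring
      _ ≤ y := by rw [hy]; gcongr
  have hyl : y ≤ Real.logb 2 n := by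
    have h1 : (r : ℝ) ^ 2 ≤ p⁻¹ * Real.logb 2 n :=
      (Real.le_sqrt hr0.le (by positivity)).1 hrl
    calc y ≤ p * (p⁻¹ * Real.logb 2 n) := by rw [hy]; gcongr
      _ = _ := mul_inv_cancel_left₀ hp.ne' _
  rw [← hy] at htn
  obtain ⟨ε, hε⟩ : ∃ ε, ε = Real.exp (-(y / 8)) := ⟨_, rfl⟩
  have hε0 : 0 < ε := hε ▸ Real.exp_pos _
  have hεy : Real.exp (y / 8) * ε = 1 := by rw [hε, ← Real.exp_add]; simp
  have hε7 : 7 * ε ≤ 1 := by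
    have h1 : Real.exp 1 * Real.exp 1 ≤ Real.exp (y / 8) := by
      rw [← Real.exp_add, Real.exp_le_exp]; linarith
    have h2 := Real.exp_one_gt_d9
    have h3 : 7 ≤ Real.exp (y / 8) := by nlinarith
    nlinarith
  refine WeaklyBiCompleteSeq.of_edge_density (N := ⌈(n : ℝ) ^ (1 / 2 : ℝ)⌉₊) (ρ := 1 - ε)
    (by omega) hp hp1 hG (Nat.ceil_pos.2 (by linarith)) hr ht ?_ (by linarith) ?_ ?_
  · refine two_mul_le_of_rpow_neg_le (a := 1 / 2) (b := 1 / 5) hn0 hpn (by linarith)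
      (by norm_num) hr0.le ?_ (ceil_le_two_mul hna) hl1
    refine abs_le_of_sq_le_sq (a := (r : ℝ)) ?_ (by positivity) |> (le_abs_self _).trans
    refine le_of_mul_le_mul_left ?_ hp
    calc p * (r : ℝ) ^ 2 ≤ Real.logb 2 n := hy ▸ hyl
      _ ≤ Real.logb 2 n ^ 2 := by nlinarith
      _ = Real.logb 2 n ^ 2 * (p * (p ^ (-(1 / 2) : ℝ)) ^ 2) := by
        rw [mul_sq_rpow_neg_half hp, mul_one]
      _ = _ := by ring
  · rw [← hy, hε, sub_le_sub_iff_left, Real.exp_le_exp]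
    linarith
  · refine sq_div_add_div_lt (a := 1 / 2) (b := 11 / 100) hn0 ht1 (Nat.le_ceil _)
      (rpow_neg_le_pow hn0 (by linarith) ?_) ?_
    · have h1 := Real.one_sub_inv_le_log_of_pos (show 0 < 1 - ε by linarith)
      have h2 : (1 - ε)⁻¹ ≤ 1 + 7 / 6 * ε := by
        rw [inv_le_iff_one_le_mul₀ (by linarith)]
        nlinarith
      have h3 : (t : ℝ) * ε ≤ 1 / 16 * Real.logb 2 n := by
        calc (t : ℝ) * ε ≤ 1 / 16 * Real.exp (y / 8) * Real.logb 2 n * ε := by gcongr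
          _ = 1 / 16 * Real.logb 2 n * (Real.exp (y / 8) * ε) := by ring
          _ = _ := by rw [hεy, mul_one]
      have h4 : (t : ℝ) * (-(7 / 6 * ε)) ≤ t * Real.log (1 - ε) := by gcongr; linarith
      linarith
    · have h1 : Real.exp (y / 8) ≤ (n : ℝ) ^ (9 / 50 + 1 / 250 : ℝ) := by
        rw [Real.rpow_def_of_pos hn0, Real.exp_le_exp]
        linarith
      have h2 : (t : ℝ) ≤ (1 / 16) * (n : ℝ) ^ (9 / 50 + 1 / 250 : ℝ) * Real.logb 2 n :=
        htn.trans (by gcongr)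
      calc 2 * (t : ℝ) ^ 2
          ≤ 2 * ((1 / 16) * (n : ℝ) ^ (9 / 50 + 1 / 250 : ℝ) * Real.logb 2 n) ^ 2 := by gcongr
        _ = 1 / 128 * ((n : ℝ) ^ (9 / 50 + 1 / 250 : ℝ) * (n : ℝ) ^ (9 / 50 + 1 / 250 : ℝ) *
            Real.logb 2 n ^ 2) := by ring
        _ ≤ 1 / 128 * ((n : ℝ) ^ (9 / 50 + 1 / 250 : ℝ) * (n : ℝ) ^ (9 / 50 + 1 / 250 : ℝ) *
            (n : ℝ) ^ (1 / 50 : ℝ)) := by gcongr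
        _ = 1 / 128 * (n : ℝ) ^ (97 / 250 : ℝ) := by
          rw [← Real.rpow_add hn0, ← Real.rpow_add hn0]; norm_num
        _ ≤ 1 / 128 * (n : ℝ) ^ (1 / 2 - 11 / 100 : ℝ) := by
          gcongr ?_ * ?_
          exact Real.rpow_le_rpow_of_exponent_le hn1 (by norm_num)
        _ < _ := by
          have := Real.rpow_pos_of_pos hn0 (1 / 2 - 11 / 100 : ℝ)
          linarith

theorem WeaklyBiCompleteSeq.of_four_mul_sqrt_le (hn : 512 ≤ n) (hl : 9 ≤ Real.logb 2 n)
    (hp : 0 < p) (hp1 : p ≤ 1) (hG : (G.edgeSet.ncard : ℝ) = p * (n.choose 2 : ℝ))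
    (hr : 0 < r) (ht : 0 < t) (hrp : 4 * Real.sqrt (p⁻¹ * Real.logb 2 n) ≤ (r : ℝ))
    (htn : (t : ℝ) ≤ min (p * (n : ℝ) / (64 * Real.sqrt (Real.logb 2 n)))
      ((n : ℝ) / (2 * (r : ℝ)))) : WeaklyBiCompleteSeq G r t := by
  have hn1 : (1 : ℝ) ≤ n := by exact_mod_cast (by omega : 1 ≤ n)
  have hr0 : (0 : ℝ) < r := by exact_mod_cast hr
  have hL : 3 ≤ Real.sqrt (Real.logb 2 n) := Real.le_sqrt_of_sq_le (by linarith)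
  have hL2 : Real.sqrt (Real.logb 2 n) ^ 2 = Real.logb 2 n := Real.sq_sqrt (by linarith)
  rw [le_min_iff, le_div_iff₀ (by positivity), le_div_iff₀ (by positivity)] at htn
  refine WeaklyBiCompleteSeq.of_large_sets (by omega) hp hp1 hG ht hL ?_ ?_ ?_ ?_
  · rw [hL2]; exact log_le_mul_logb_two hn1
  · calc 16 * Real.sqrt (Real.logb 2 n) ^ 2 = p * (16 * (p⁻¹ * Real.logb 2 n)) := by
          rw [hL2]; field_simp
      _ = p * (4 * Real.sqrt (p⁻¹ * Real.logb 2 n)) ^ 2 := by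
          rw [mul_pow, Real.sq_sqrt (by positivity)]; norm_num
      _ ≤ p * (r : ℝ) ^ 2 := by gcongr
  · linarith [htn.1]
  · have : (2 * t * r : ℝ) ≤ n := by linarith [htn.2]
    exact_mod_cast this

end LargeOrder

end

/-- **Weakly bi-complete sequences in dense graphs.** For all sufficiently large `n`:
let `G` be a graph on `n` vertices with exactly `p·C(n,2)` edges, `0 < p ≤ 1`, and let
`r, t` be positive integers. If (a) `p ≥ n^{−1/3}`, `r ≤ 2p^{−1/2}` and
`t ≤ log n / (4 log(32/(p r²)))`, or (b) `p ≥ n^{−1/5}`,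
`4p^{−1/2} ≤ r ≤ √(p^{−1} log n)` and `t ≤ (1/16)·e^{p r²/8}·log n`, or (c)
`r ≥ 4√(p^{−1} log n)` and `t ≤ min(p n/(64√(log n)), n/(2r))`, then `G` contains a
weakly bi-complete `r`-sequence of order `t`, and hence also a weakly complete
`2r`-sequence of order `t`. (Logarithms are base 2.) -/
theorem stmt14 :
    ∃ n₀ : ℕ, ∀ n : ℕ, n₀ ≤ n → ∀ (G : SimpleGraph (Fin n)) (p : ℝ) (r t : ℕ),
      0 < p → p ≤ 1 → (G.edgeSet.ncard : ℝ) = p * (n.choose 2 : ℝ) →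
      0 < r → 0 < t →
      (((n : ℝ) ^ (-(1 / 3) : ℝ) ≤ p ∧ (r : ℝ) ≤ 2 * p ^ (-(1 / 2) : ℝ) ∧
          (t : ℝ) ≤ Real.logb 2 n / (4 * Real.logb 2 (32 / (p * (r : ℝ) ^ 2)))) ∨
        ((n : ℝ) ^ (-(1 / 5) : ℝ) ≤ p ∧ 4 * p ^ (-(1 / 2) : ℝ) ≤ (r : ℝ) ∧
          (r : ℝ) ≤ Real.sqrt (p⁻¹ * Real.logb 2 n) ∧
          (t : ℝ) ≤ (1 / 16) * Real.exp (p * (r : ℝ) ^ 2 / 8) * Real.logb 2 n) ∨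
        (4 * Real.sqrt (p⁻¹ * Real.logb 2 n) ≤ (r : ℝ) ∧
          (t : ℝ) ≤ min (p * (n : ℝ) / (64 * Real.sqrt (Real.logb 2 n)))
            ((n : ℝ) / (2 * (r : ℝ))))) →
      WeaklyBiCompleteSeq G r t ∧ WeaklyCompleteSeq G (2 * r) t := by
  obtain ⟨n₀, hn₀⟩ := Filter.eventually_atTop.1
    ((eventually_mul_logb_pow_le 1 17 (show (0 : ℝ) < 1 / 5 by norm_num)).and
      (eventually_mul_logb_pow_le 2 1 (show (0 : ℝ) < 1 / 50 by norm_num)))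
  refine ⟨max n₀ 512, fun n hn G p r t hp hp1 hG hr ht h => ?_⟩
  obtain ⟨hl1, hl2⟩ := hn₀ n ((le_max_left _ _).trans hn)
  have hn512 : 512 ≤ n := (le_max_right _ _).trans hn
  rw [pow_one] at hl1
  rw [one_mul] at hl2
  have hl : 9 ≤ Real.logb 2 n := by
    have h1 : (512 : ℝ) ≤ n := by exact_mod_cast hn512
    rw [Real.le_logb_iff_rpow_le one_lt_two (by linarith)]
    norm_num
    exact_mod_cast h1
  have key : WeaklyBiCompleteSeq G r t := by
    rcases h with ⟨h1, h2, h3⟩ | ⟨h1, h2, h3, h4⟩ | ⟨h1, h2⟩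
    · exact .of_le_two_mul_rpow hn512 hl hl1 hl2 hp hp1 hG hr ht h1 h2 h3
    · exact .of_four_mul_rpow_le hn512 hl hl1 hl2 hp hp1 hG hr ht h1 h2 h3 h4
    · exact .of_four_mul_sqrt_le hn512 hl hp hp1 hG hr ht h1 h2
  exact ⟨key, key.weaklyCompleteSeq⟩
end

section
/- For every positive integer r there is an integer n₀ such that for all n ≥ n₀ and every graph G on n vertices, either G or its complement contains a weakly complete r-sequence of order at least (1/16)·e^{2^{−6} r²}·log n. -/
section

open Finset

open Classical in
/-- The Erdős–Szekeres bound, inside a finite set of vertices. -/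
theorem exists_isNClique_or_isNClique_compl {V : Type*} (H : SimpleGraph V) (s t : ℕ)
    (C : Finset V) (hC : (s + t).choose s ≤ #C) :
    (∃ K ⊆ C, H.IsNClique s K) ∨ ∃ K ⊆ C, Hᶜ.IsNClique t K := by
  induction s generalizing t C with
  | zero => exact Or.inl ⟨∅, empty_subset _, by simp⟩
  | succ s ihs =>
    induction t generalizing C with
    | zero => exact Or.inr ⟨∅, empty_subset _, by simp⟩
    | succ t iht =>
      have hpos : 0 < #C := lt_of_lt_of_le (Nat.choose_pos (by omega)) hC
      obtain ⟨v, hv⟩ := card_pos.1 hpos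
      have hsum : #{w ∈ C.erase v | H.Adj v w} + #{w ∈ C.erase v | ¬ H.Adj v w} = #C - 1 := by
        rw [card_filter_add_card_filter_not, card_erase_of_mem hv]
      have hpascal : (s + 1 + (t + 1)).choose (s + 1)
          = (s + (t + 1)).choose s + (s + 1 + t).choose (s + 1) := by
        rw [show s + 1 + (t + 1) = (s + 1 + t) + 1 by ring, Nat.choose_succ_succ,
          show s + (t + 1) = s + 1 + t by ring]
      by_cases hR : (s + (t + 1)).choose s ≤ #{w ∈ C.erase v | H.Adj v w}
      · obtain ⟨K, hK, hc⟩ | ⟨K, hK, hc⟩ := ihs _ _ hR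
        · refine Or.inl ⟨insert v K, insert_subset hv fun w hw => ?_, hc.insert fun w hw => ?_⟩
          · exact mem_of_mem_erase (mem_filter.1 (hK hw)).1
          · exact (mem_filter.1 (hK hw)).2
        · exact Or.inr ⟨K, fun w hw => mem_of_mem_erase (mem_filter.1 (hK hw)).1, hc⟩
      · obtain ⟨K, hK, hc⟩ | ⟨K, hK, hc⟩ := iht {w ∈ C.erase v | ¬ H.Adj v w} (by omega)
        · exact Or.inl ⟨K, fun w hw => mem_of_mem_erase (mem_filter.1 (hK hw)).1, hc⟩
        · refine Or.inr ⟨insert v K, insert_subset hv fun w hw => ?_, hc.insert fun w hw => ?_⟩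
          · exact mem_of_mem_erase (mem_filter.1 (hK hw)).1
          · have := mem_filter.1 (hK hw)
            exact (SimpleGraph.compl_adj _ _ _).2 ⟨(ne_of_mem_erase this.1).symm, this.2⟩

/-- The number of subsets of size at most `k`, bounded by Chernoff's method. -/
theorem card_powerset_filter_card_le {V : Type*} (W : Finset V) (k : ℕ) {x : ℝ} (hx : 0 < x)
    (hx1 : x ≤ 1) : (#{P ∈ W.powerset | #P ≤ k} : ℝ) ≤ (1 + x) ^ #W / x ^ k := by
  rw [le_div_iff₀ (by positivity), add_comm, ← Finset.sum_pow_mul_eq_add_pow, ← nsmul_eq_mul,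
    ← sum_const]
  calc ∑ P ∈ W.powerset with #P ≤ k, x ^ k
      ≤ ∑ P ∈ W.powerset with #P ≤ k, x ^ #P * 1 ^ (#W - #P) := by
        refine sum_le_sum fun P hP => ?_
        rw [one_pow, mul_one]
        exact pow_le_pow_of_le_one hx.le hx1 (mem_filter.1 hP).2
    _ ≤ _ := sum_le_sum_of_subset_of_nonneg (filter_subset _ _) fun _ _ _ => by positivity

theorem choose_le_one_add_pow_div (n k : ℕ) {x : ℝ} (hx : 0 < x) :
    (n.choose k : ℝ) ≤ (1 + x) ^ n / x ^ k := by
  rw [le_div_iff₀ (by positivity), add_comm, add_pow]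
  by_cases hk : k ≤ n
  · have := single_le_sum (s := range (n + 1))
      (f := fun m => x ^ m * 1 ^ (n - m) * (n.choose m : ℝ)) (fun _ _ => by positivity)
      (mem_range.2 (Nat.lt_succ_of_le hk))
    simpa [mul_comm] using this
  · rw [Nat.choose_eq_zero_of_lt (by omega)]
    simp only [Nat.cast_zero, zero_mul]
    exact sum_nonneg fun _ _ => by positivity

open Classical in
/-- A sparse graph with no clique and no independent set of size `t` has few vertices: an
Erdős–Szemerédi type bound. -/
theorem card_le_of_cliqueFree_of_degree_le {V : Type*} [Fintype V] (H : SimpleGraph V) {t k : ℕ}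
    {δ x : ℝ} (hδ : 0 < δ) (ht : 0 < t) (hx : 0 < x) (hx1 : x ≤ 1)
    (hdeg : ∀ v, (#{w | H.Adj v w} : ℝ) ≤ δ * Fintype.card V) (hk : 2 * δ * t ≤ k)
    (h₁ : H.CliqueFree t) (h₂ : Hᶜ.CliqueFree t) :
    (Fintype.card V : ℝ) ≤
      2 * (t + (1 + x) ^ t / x ^ k * ((1 + x) ^ (t + (k + 1)) / x ^ (k + 1))) := by
  obtain ⟨W, hW⟩ := Hᶜ.exists_isNClique_cliqueNum
  have hWt : #W < t := by
    by_contra! hle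
    exact h₂.mono hle W (by rw [hW.card_eq]; exact hW)
  set Q : Finset V := {v | v ∉ W ∧ #{w ∈ W | H.Adj v w} ≤ k} with hQ
  set B : Finset V := {v | v ∉ W ∧ k < #{w ∈ W | H.Adj v w}} with hB
  have hcover : Fintype.card V ≤ #W + #Q + #B := by
    rw [← card_univ]
    refine (card_le_card (t := W ∪ Q ∪ B) fun v _ => ?_).trans
      ((card_union_le _ _).trans (Nat.add_le_add_right (card_union_le _ _) _))
    by_cases hv : v ∈ W
    · simp [hv]
    · by_cases hv' : #{w ∈ W | H.Adj v w} ≤ k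
      · simp [hQ, hv, hv']
      · simp [hB, hv, not_le.1 hv']
  have hBcard : (#B : ℝ) ≤ Fintype.card V / 2 := by
    have hdc : ∑ v ∈ B, #{w ∈ W | H.Adj v w} = ∑ w ∈ W, #{v ∈ B | H.Adj v w} :=
      sum_card_bipartiteAbove_eq_sum_card_bipartiteBelow (fun v w => H.Adj v w)
    have h1 : (#B : ℝ) * (2 * δ * t) ≤ ∑ v ∈ B, (#{w ∈ W | H.Adj v w} : ℝ) := by
      rw [← nsmul_eq_mul, ← sum_const]
      refine sum_le_sum fun v hv => hk.trans ?_
      exact_mod_cast (mem_filter.1 hv).2.2.le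
    have h2 : ∑ w ∈ W, (#{v ∈ B | H.Adj v w} : ℝ) ≤ t * (δ * Fintype.card V) := by
      calc ∑ w ∈ W, (#{v ∈ B | H.Adj v w} : ℝ) ≤ ∑ w ∈ W, δ * Fintype.card V := by
            refine sum_le_sum fun w _ => le_trans ?_ (hdeg w)
            refine Nat.cast_le.2 (card_le_card fun v hv => ?_)
            simpa using (mem_filter.1 hv).2.symm
        _ = #W * (δ * Fintype.card V) := by rw [sum_const, nsmul_eq_mul]
        _ ≤ _ := by gcongr
    have h3 : (#B : ℝ) * (2 * δ * t) ≤ t * (δ * Fintype.card V) := by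
      refine h1.trans (le_trans (le_of_eq ?_) h2)
      exact_mod_cast hdc
    have ht' : (0 : ℝ) < t := by exact_mod_cast ht
    have : 0 < δ * t := by positivity
    rw [le_div_iff₀ two_pos]
    refine le_of_mul_le_mul_right ?_ this
    linarith
  have hQcard : #Q ≤ #{P ∈ W.powerset | #P ≤ k} * (t + (k + 1)).choose t := by
    by_contra! hlt
    obtain ⟨P, hP, hPc⟩ := exists_lt_card_fiber_of_mul_lt_card_of_maps_to
      (f := fun v => {w ∈ W | H.Adj v w}) (fun v hv => by
        rw [mem_filter, mem_powerset]
        exact ⟨filter_subset _ _, (mem_filter.1 hv).2.2⟩) hlt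
    rw [mem_filter, mem_powerset] at hP
    obtain ⟨K, -, hc⟩ | ⟨K, hK, hc⟩ := exists_isNClique_or_isNClique_compl H t (k + 1) _ hPc.le
    · exact h₁ K hc
    · have hKW : ∀ v ∈ K, v ∉ W ∧ {w ∈ W | H.Adj v w} = P := fun v hv => by
        have := mem_filter.1 (hK hv)
        exact ⟨(mem_filter.1 this.1).2.1, this.2⟩
      have hdisj : Disjoint (W \ P) K := by
        rw [disjoint_right]
        exact fun v hv hv' => (hKW v hv).1 (mem_sdiff.1 hv').1
      have hadj : ∀ w ∈ W \ P, ∀ v ∈ K, Hᶜ.Adj w v := fun w hw v hv => by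
        rw [mem_sdiff] at hw
        refine (SimpleGraph.compl_adj _ _ _).2 ⟨fun h => (hKW v hv).1 (h ▸ hw.1), fun h => hw.2 ?_⟩
        rw [← (hKW v hv).2, mem_filter]
        exact ⟨hw.1, h.symm⟩
      have hclique : Hᶜ.IsClique ((W \ P ∪ K : Finset V) : Set V) := by
        intro u hu v hv huv
        rw [mem_coe, mem_union] at hu hv
        rcases hu with hu | hu <;> rcases hv with hv | hv
        · exact hW.isClique (mem_sdiff.1 hu).1 (mem_sdiff.1 hv).1 huv
        · exact hadj u hu v hv
        · exact (hadj v hv u hu).symm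
        · exact hc.isClique hu hv huv
      have hle := hclique.card_le_cliqueNum
      rw [card_union_of_disjoint hdisj, card_sdiff_of_subset hP.1, hc.card_eq, ← hW.card_eq] at hle
      have := card_le_card hP.1
      omega
  have hQreal : (#Q : ℝ) ≤ (1 + x) ^ t / x ^ k * ((1 + x) ^ (t + (k + 1)) / x ^ (k + 1)) := by
    calc (#Q : ℝ) ≤ (#{P ∈ W.powerset | #P ≤ k} : ℝ) * ((t + (k + 1)).choose t : ℝ) := by
          exact_mod_cast hQcard
      _ ≤ _ := by
        gcongr
        · refine (card_powerset_filter_card_le W k hx hx1).trans ?_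
          gcongr
          linarith
        · rw [Nat.choose_symm_add]
          exact choose_le_one_add_pow_div _ _ hx
  have hc : (Fintype.card V : ℝ) ≤ #W + #Q + #B := by exact_mod_cast hcover
  have hWt' : (#W : ℝ) ≤ t := by exact_mod_cast hWt.le
  linarith

open Classical in
/-- Greedy choice of a set with few common neighbours. -/
theorem exists_subset_card_common_le {α β : Type*} (R : α → β → Prop) (U : Finset α)
    (B : Finset β) {q c : ℝ} (hq : 0 ≤ q) (hq1 : q ≤ 1) (h : ℕ)
    (H : ∀ U' ⊆ U, #U < #U' + h → ∀ B' ⊆ B,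
      ∃ x ∈ U', (#{b ∈ B' | R x b} : ℝ) ≤ max (q * #B') c) :
    ∃ X ⊆ U, #X = h ∧ (#{b ∈ B | ∀ x ∈ X, R x b} : ℝ) ≤ max (q ^ h * #B) c := by
  induction h with
  | zero => exact ⟨∅, empty_subset _, rfl, by simp⟩
  | succ h ih =>
    obtain ⟨X, hXU, hX, hXB⟩ := ih fun U' hU' hlt => H U' hU' (by omega)
    obtain ⟨x, hx, hxB⟩ := H (U \ X) sdiff_subset
      (by rw [card_sdiff_of_subset hXU, hX]; have := card_le_card hXU; omega)
      {b ∈ B | ∀ x ∈ X, R x b} (filter_subset _ _)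
    rw [mem_sdiff] at hx
    refine ⟨insert x X, insert_subset hx.1 hXU, by rw [card_insert_of_notMem hx.2, hX], ?_⟩
    have heq : {b ∈ B | ∀ y ∈ insert x X, R y b} = {b ∈ {b ∈ B | ∀ y ∈ X, R y b} | R x b} := by
      ext b
      simp only [mem_filter, mem_insert, forall_eq_or_imp]
      tauto
    rw [heq]
    refine hxB.trans (max_le ?_ (le_max_right _ _))
    rcases le_max_iff.1 hXB with hle | hle
    · refine le_max_of_le_left ?_
      rw [pow_succ', mul_assoc]
      gcongr
    · refine le_max_of_le_right (le_trans ?_ hle)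
      exact mul_le_of_le_one_left (by positivity) hq1

/-- Greedy choice of pairwise disjoint sets with a prescribed property. -/
theorem exists_disjoint_family_s15 {α : Type*} (A : Finset α) (P : Finset α → Prop) {h m M : ℕ}
    (hM : M * h + m ≤ #A) (H : ∀ U ⊆ A, m + h ≤ #U → ∃ X ⊆ U, #X = h ∧ P X) :
    ∃ X : ℕ → Finset α, (∀ i < M, X i ⊆ A ∧ #(X i) = h ∧ P (X i)) ∧
      ∀ i < M, ∀ j < M, i ≠ j → Disjoint (X i) (X j) := by
  classical
  induction M with
  | zero => exact ⟨fun _ => ∅, by simp, by simp⟩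
  | succ M ih =>
    rw [Nat.succ_mul] at hM
    obtain ⟨X, hX, hdisj⟩ := ih (by omega)
    have hcard : #((range M).biUnion X) ≤ M * h := by
      simpa using card_biUnion_le_card_mul (range M) X h fun i hi => (hX i (mem_range.1 hi)).2.1.le
    obtain ⟨Y, hYU, hYcard, hPY⟩ := H (A \ (range M).biUnion X) sdiff_subset (by
      have := le_card_sdiff ((range M).biUnion X) A
      omega)
    have hXY : ∀ i < M, Disjoint (X i) Y := fun i hi => by
      refine (disjoint_sdiff.mono_left ?_).mono_right hYU
      exact subset_biUnion_of_mem X (mem_range.2 hi)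
    refine ⟨Function.update X M Y, fun i hi => ?_, fun i hi j hj hij => ?_⟩
    · rcases Nat.lt_succ_iff_lt_or_eq.1 hi with hi | rfl
      · rw [Function.update_of_ne hi.ne]
        exact hX i hi
      · rw [Function.update_self]
        exact ⟨hYU.trans sdiff_subset, hYcard, hPY⟩
    · rcases Nat.lt_succ_iff_lt_or_eq.1 hi with hi | rfl <;>
        rcases Nat.lt_succ_iff_lt_or_eq.1 hj with hj | rfl
      · rw [Function.update_of_ne hi.ne, Function.update_of_ne hj.ne]
        exact hdisj i hi j hj hij
      · rw [Function.update_of_ne hi.ne, Function.update_self]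
        exact hXY i hi
      · rw [Function.update_of_ne hj.ne, Function.update_self]
        exact (hXY j hj).symm
      · exact absurd rfl hij

open Classical in
theorem exists_card_filter_le_of_sum_le {α β : Type*} (R : α → β → Prop) {U : Finset α}
    (hU : U.Nonempty) (B : Finset β) {q : ℝ}
    (hsum : ∑ x ∈ U, (#{b ∈ B | R x b} : ℝ) ≤ q * #U * #B) :
    ∃ x ∈ U, (#{b ∈ B | R x b} : ℝ) ≤ q * #B := by
  refine exists_le_of_sum_le hU (hsum.trans (le_of_eq ?_))
  rw [sum_const, nsmul_eq_mul]
  ring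

open Classical in
theorem exists_subset_card_common_le_of_card_le {α β : Type*} (R : α → β → Prop) (K : Finset β)
    {B U : Finset α} {p : ℝ} {s : ℕ} (hp : 0 ≤ p) (hp1 : 2 * p ≤ 1)
    (hdeg : ∀ k ∈ K, (#{y ∈ B | R y k} : ℝ) ≤ p * #B) (hU : U ⊆ B) (hUcard : (#B + 1) / 2 + s ≤ #U) :
    ∃ Y ⊆ U, #Y = s ∧ (#{k ∈ K | ∀ y ∈ Y, R y k} : ℝ) ≤ (2 * p) ^ s * #K := by
  obtain ⟨Y, hYU, hYcard, hY⟩ := exists_subset_card_common_le R U K (c := 0) (q := 2 * p)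
    (by positivity) hp1 s (by
      intro U' hU' hlt L hL
      have hpos : 0 < #U' := by omega
      have hBU : (#B : ℝ) ≤ 2 * #U' := by
        have : #B ≤ 2 * #U' := by omega
        exact_mod_cast this
      obtain ⟨y, hy, hle⟩ := exists_card_filter_le_of_sum_le R (card_pos.1 hpos) L (q := 2 * p) (by
        have hdc : ∑ y ∈ U', #{k ∈ L | R y k} = ∑ k ∈ L, #{y ∈ U' | R y k} :=
          sum_card_bipartiteAbove_eq_sum_card_bipartiteBelow R
        calc ∑ y ∈ U', (#{k ∈ L | R y k} : ℝ) = ∑ k ∈ L, (#{y ∈ U' | R y k} : ℝ) := by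
              exact_mod_cast hdc
          _ ≤ ∑ k ∈ L, p * (2 * #U') := by
              refine sum_le_sum fun k hk => ?_
              refine le_trans ?_ ((hdeg k (hL hk)).trans (by gcongr))
              exact_mod_cast card_le_card (filter_subset_filter _ (hU'.trans hU))
          _ = 2 * p * #U' * #L := by
              rw [sum_const, nsmul_eq_mul]
              ring)
      exact ⟨y, hy, le_max_of_le_left hle⟩)
  exact ⟨Y, hYU, hYcard, hY.trans (max_le le_rfl (by positivity))⟩

open Classical in
/-- If `G` is sparse between all large subsets of `A` and `B`, there are many disjoint `r`-sets,
each completely joined to few of the others. -/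
theorem exists_blocks_of_sparse_pair {V : Type*} (G : SimpleGraph V) {A B : Finset V}
    (hAB : Disjoint A B) {r h M : ℕ} (hr : 0 < r) (hh : h ≤ r) {q ε : ℝ} (hq : 0 ≤ q)
    (hq1 : q ≤ 1) (hqh : 2 * q ^ h ≤ 1) (hε : ε ≤ 1 / 2) (hεq : ε ≤ q ^ h)
    (hsparse : ∀ A' ⊆ A, ε * #A ≤ #A' → ∀ B' ⊆ B, ε * #B ≤ #B' →
      ∑ x ∈ A', (#{y ∈ B' | G.Adj x y} : ℝ) ≤ q * #A' * #B')
    (hA : 2 * ((M + 1) * r) ≤ #A) (hB : 2 * ((M + 1) * r) ≤ #B) :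
    ∃ T : Fin M → Finset V, (∀ i, #(T i) = r) ∧ (∀ i j, i ≠ j → Disjoint (T i) (T j)) ∧
      ∀ l, (#{k | ∀ u ∈ T k, ∀ v ∈ T l, G.Adj u v} : ℝ) ≤ (2 * q ^ h) ^ (r - h) * M := by
  rw [add_mul, one_mul] at hA hB
  obtain ⟨X, hX, hXdisj⟩ := exists_disjoint_family_s15 A
    (fun X => (#{y ∈ B | ∀ x ∈ X, G.Adj x y} : ℝ) ≤ q ^ h * #B) (h := h) (m := (#A + 1) / 2)
    (M := M) (by have := Nat.mul_le_mul_left M hh; omega) (by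
      intro U hU hUcard
      obtain ⟨X, hXU, hXcard, hX⟩ := exists_subset_card_common_le G.Adj U B (c := ε * #B) hq hq1 h
        (by
          intro U' hU' hlt B' hB'
          have hpos : 0 < #U' := by omega
          by_cases hBε : ε * #B ≤ #B'
          · have hAU : ε * #A ≤ #U' := by
              have : (#A : ℝ) ≤ 2 * #U' := by
                have : #A ≤ 2 * #U' := by omega
                exact_mod_cast this
              have h0 : (0 : ℝ) ≤ #A := by positivity
              nlinarith
            obtain ⟨x, hx, hle⟩ := exists_card_filter_le_of_sum_le G.Adj (card_pos.1 hpos) B'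
              (hsparse U' (hU'.trans hU) hAU B' hB' hBε)
            exact ⟨x, hx, le_max_of_le_left hle⟩
          · obtain ⟨x, hx⟩ := card_pos.1 hpos
            refine ⟨x, hx, le_max_of_le_right (le_trans ?_ (not_le.1 hBε).le)⟩
            exact_mod_cast card_filter_le _ _)
      refine ⟨X, hXU, hXcard, hX.trans (max_le le_rfl ?_)⟩
      gcongr)
  obtain ⟨R, hR⟩ : ∃ R : V → ℕ → Prop, ∀ y k, R y k ↔ ∀ x ∈ X k, G.Adj x y :=
    ⟨_, fun _ _ => Iff.rfl⟩
  obtain ⟨Y, hY, hYdisj⟩ := exists_disjoint_family_s15 B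
    (fun Y => (#{k ∈ range M | ∀ y ∈ Y, R y k} : ℝ) ≤ (2 * q ^ h) ^ (r - h) * M)
    (h := r - h) (m := (#B + 1) / 2) (M := M)
    (by have := Nat.mul_le_mul_left M (Nat.sub_le r h); omega) (by
      intro U hU hUcard
      obtain ⟨Y, hYU, hYcard, hY⟩ := exists_subset_card_common_le_of_card_le R (range M)
        (p := q ^ h) (by positivity) hqh (fun k hk => by
          simp only [hR]
          exact (hX k (mem_range.1 hk)).2.2) hU hUcard
      rw [card_range] at hY
      exact ⟨Y, hYU, hYcard, hY⟩)
  have hXY : ∀ i < M, ∀ j < M, Disjoint (X i) (Y j) := fun i hi j hj =>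
    (hAB.mono_left (hX i hi).1).mono_right (hY j hj).1
  refine ⟨fun i => X i ∪ Y i, fun i => ?_, fun i j hij => ?_, fun l => ?_⟩
  · rw [card_union_of_disjoint (hXY i i.2 i i.2), (hX i i.2).2.1, (hY i i.2).2.1]
    omega
  · have hij' : (i : ℕ) ≠ j := fun h => hij (Fin.ext h)
    rw [disjoint_union_left, disjoint_union_right, disjoint_union_right]
    exact ⟨⟨hXdisj i i.2 j j.2 hij', hXY i i.2 j j.2⟩, (hXY j j.2 i i.2).symm,
      hYdisj i i.2 j j.2 hij'⟩
  · refine le_trans ?_ (hY l l.2).2.2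
    refine Nat.cast_le.2 (card_le_card_of_injOn (fun k : Fin M => (k : ℕ)) (fun k hk => ?_)
      fun a _ b _ hab => Fin.ext hab)
    rw [mem_coe, mem_filter] at hk ⊢
    exact ⟨mem_range.2 k.2, fun y hy => (hR y k).2 fun x hx =>
      hk.2 x (mem_union_left _ hx) y (mem_union_right _ hy)⟩

open Classical in
/-- A consequence of Szemerédi's regularity lemma: between some two disjoint large sets, `G` or its
complement has density not much above `1 / 2` on all large subsets. -/
theorem exists_sparse_pair {ε : ℝ} (hε : 0 < ε) (hε1 : ε ≤ 1 / 8) :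
    ∃ b : ℕ, 0 < b ∧ ∀ n : ℕ, 2 ≤ n → ∀ G : SimpleGraph (Fin n),
      ∃ G' : SimpleGraph (Fin n), (G' = G ∨ G' = Gᶜ) ∧ ∃ A B : Finset (Fin n), Disjoint A B ∧
        n / b ≤ #A ∧ n / b ≤ #B ∧ ∀ A' ⊆ A, ε * #A ≤ #A' → ∀ B' ⊆ B, ε * #B ≤ #B' →
          ∑ x ∈ A', (#{y ∈ B' | G'.Adj x y} : ℝ) ≤ 5 / 8 * #A' * #B' := by
  refine ⟨SzemerediRegularity.bound ε 2, SzemerediRegularity.bound_pos _ _, fun n hn G => ?_⟩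
  obtain ⟨P, hPeq, hP2, hPb, hPu⟩ := szemeredi_regularity G hε (l := 2) (by simpa using hn)
  obtain ⟨A, hA, B, hB, hne, hunif⟩ : ∃ A ∈ P.parts, ∃ B ∈ P.parts, A ≠ B ∧ G.IsUniform ε A B := by
    by_contra! hcon
    have hall : P.nonUniforms G ε = P.parts.offDiag := by
      ext ⟨u, v⟩
      rw [Finpartition.mk_mem_nonUniforms, mem_offDiag]
      exact ⟨fun h => ⟨h.1, h.2.1, h.2.2.1⟩, fun h => ⟨h.1, h.2.1, h.2.2, hcon u h.1 v h.2.1 h.2.2⟩⟩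
    rw [Finpartition.IsUniform, hall, offDiag_card, ← Nat.mul_sub_one] at hPu
    have hpos : 0 < #P.parts * (#P.parts - 1) := Nat.mul_pos (by omega) (by omega)
    have : (0 : ℝ) < (#P.parts * (#P.parts - 1) : ℕ) := by exact_mod_cast hpos
    nlinarith
  have hsize : ∀ C ∈ P.parts, n / SzemerediRegularity.bound ε 2 ≤ #C := fun C hC => by
    have := hPeq.average_le_card_part hC
    rw [card_univ, Fintype.card_fin] at this
    exact (Nat.div_le_div_left hPb (by omega)).trans this
  have hdisj : Disjoint A B := P.disjoint hA hB hne
  have hcardpos : ∀ C ∈ P.parts, (0 : ℝ) < #C := fun C hC => by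
    exact_mod_cast card_pos.2 (P.nonempty_of_mem_parts hC)
  have hkey : ∀ (G' : SimpleGraph (Fin n)) (A' B' : Finset (Fin n)), 0 < (#A' : ℝ) →
      0 < (#B' : ℝ) → (G'.edgeDensity A' B' : ℝ) ≤ 5 / 8 →
      ∑ x ∈ A', (#{y ∈ B' | G'.Adj x y} : ℝ) ≤ 5 / 8 * #A' * #B' := by
    intro G' A' B' hA' hB' hd
    have hsum : #(G'.interedges A' B') = ∑ x ∈ A', #{y ∈ B' | G'.Adj x y} := by
      rw [SimpleGraph.interedges_def, card_filter, sum_product]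
      simp only [card_filter]
    rw [← SimpleGraph.card_interedges_div_card] at hd
    push_cast at hd
    rw [div_le_iff₀ (by positivity), hsum] at hd
    push_cast at hd
    linarith
  by_cases hd : (G.edgeDensity A B : ℝ) ≤ 1 / 2
  · refine ⟨G, Or.inl rfl, A, B, hdisj, hsize A hA, hsize B hB, fun A' hA' hAc B' hB' hBc => ?_⟩
    refine hkey G A' B' (lt_of_lt_of_le (mul_pos hε (hcardpos A hA)) hAc)
      (lt_of_lt_of_le (mul_pos hε (hcardpos B hB)) hBc) ?_
    have := abs_lt.1 (hunif hA' hB' (by linarith) (by linarith))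
    linarith [this.2]
  · refine ⟨Gᶜ, Or.inr rfl, A, B, hdisj, hsize A hA, hsize B hB, fun A' hA' hAc B' hB' hBc => ?_⟩
    have hA'pos := lt_of_lt_of_le (mul_pos hε (hcardpos A hA)) hAc
    have hB'pos := lt_of_lt_of_le (mul_pos hε (hcardpos B hB)) hBc
    refine hkey Gᶜ A' B' hA'pos hB'pos ?_
    have := abs_lt.1 (hunif hA' hB' (by linarith) (by linarith))
    rw [not_le] at hd
    have hcompl := G.edgeDensity_add_edgeDensity_compl (s := A') (t := B')
      (card_pos.1 (by exact_mod_cast hA'pos)) (card_pos.1 (by exact_mod_cast hB'pos))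
      ((hdisj.mono_left hA').mono_right hB')
    have hcompl' : (G.edgeDensity A' B' : ℝ) + (Gᶜ.edgeDensity A' B' : ℝ) = 1 := by
      exact_mod_cast hcompl
    convert (show (Gᶜ.edgeDensity A' B' : ℝ) ≤ 5 / 8 by linarith [this.1])

/-- The graph on a family of vertex sets joining two sets when `G` is complete between them. -/
def blockGraph {V ι : Type*} (G : SimpleGraph V) (T : ι → Finset V) : SimpleGraph ι where
  Adj k l := k ≠ l ∧ ∀ u ∈ T k, ∀ v ∈ T l, G.Adj u v
  symm := ⟨fun _ _ h => ⟨h.1.symm, fun u hu v hv => (h.2 v hv u hu).symm⟩⟩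

theorem weaklyCompleteSeq_of_not_cliqueFree {V ι : Type*} {G : SimpleGraph V} {T : ι → Finset V}
    {H : SimpleGraph ι} {r t : ℕ} (hT : ∀ i, #(T i) = r)
    (hdisj : ∀ i j, i ≠ j → Disjoint (T i) (T j))
    (hH : ∀ k l, H.Adj k l → ∃ u ∈ T k, ∃ v ∈ T l, G.Adj u v) (ht : ¬ H.CliqueFree t) :
    WeaklyCompleteSeq G r t := by
  let f := SimpleGraph.topEmbeddingOfNotCliqueFree ht
  refine ⟨fun i => T (f i), fun i => hT _, fun i j hij => hdisj _ _ (f.injective.ne hij),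
    fun i j hij => hH _ _ (f.map_rel_iff.2 ?_)⟩
  exact hij.ne

theorem cliqueFree_blockGraph {V ι : Type*} {G : SimpleGraph V} {T : ι → Finset V} {r t : ℕ}
    (hr : 0 < r) (hT : ∀ i, #(T i) = r) (hdisj : ∀ i j, i ≠ j → Disjoint (T i) (T j))
    (hG : ¬ WeaklyCompleteSeq G r t) (hGc : ¬ WeaklyCompleteSeq Gᶜ r t) :
    (blockGraph G T).CliqueFree t ∧ (blockGraph G T)ᶜ.CliqueFree t := by
  constructor
  · by_contra hcon
    refine hG (weaklyCompleteSeq_of_not_cliqueFree hT hdisj (fun k l hkl => ?_) hcon)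
    obtain ⟨u, hu⟩ := card_pos.1 (by rw [hT k]; exact hr)
    obtain ⟨v, hv⟩ := card_pos.1 (by rw [hT l]; exact hr)
    exact ⟨u, hu, v, hv, hkl.2 u hu v hv⟩
  · by_contra hcon
    refine hGc (weaklyCompleteSeq_of_not_cliqueFree hT hdisj (fun k l hkl => ?_) hcon)
    rw [SimpleGraph.compl_adj] at hkl
    by_contra! hall
    refine hkl.2 ⟨hkl.1, fun u hu v hv => ?_⟩
    have := hall u hu v hv
    rw [SimpleGraph.compl_adj, not_and, not_not] at this
    exact this ((hdisj k l hkl.1).forall_ne_finset hu hv)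

theorem exists_forall_exp_add_logb_lt {C K c : ℝ} (hK : 0 ≤ K) (hc : 0 < c) :
    ∃ n₀ : ℕ, ∀ n : ℕ, n₀ ≤ n →
      C * Real.exp (3 / 8 * Real.logb 2 n) + K * Real.logb 2 n < c * n := by
  obtain ⟨m, hm⟩ := exists_nat_gt (8 * ((C + 8 * K) / c))
  refine ⟨2 ^ m, fun n hn => ?_⟩
  have hn0 : (0 : ℝ) < n := by
    exact_mod_cast lt_of_lt_of_le (Nat.two_pow_pos m) hn
  set L := Real.logb 2 n with hL
  have hmL : (m : ℝ) ≤ L := by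
    rw [hL, Real.le_logb_iff_rpow_le one_lt_two hn0, Real.rpow_natCast]
    exact_mod_cast hn
  have hL0 : 0 ≤ L := le_trans (Nat.cast_nonneg m) hmL
  set E := Real.exp (L / 8) with hE
  have hLE : L / 8 + 1 ≤ E := Real.add_one_le_exp _
  have hE3 : Real.exp (3 / 8 * L) = E ^ 3 := by
    rw [hE, ← Real.exp_nat_mul]
    congr 1
    push_cast
    ring
  have hE4 : E ^ 4 ≤ n := by
    have h2 : (n : ℝ) = Real.exp (Real.log 2 * L) := by
      rw [← Real.rpow_def_of_pos two_pos, hL, Real.rpow_logb two_pos (by norm_num) hn0]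
    rw [h2, hE, ← Real.exp_nat_mul]
    refine Real.exp_le_exp.2 ?_
    push_cast
    nlinarith [Real.log_two_gt_d9]
  have hbig : C + 8 * K < c * E := by
    rw [mul_comm c, ← div_lt_iff₀ hc]
    linarith
  have hE1 : 1 ≤ E := by linarith
  have hEE : E ≤ E ^ 3 := le_self_pow₀ hE1 (by norm_num)
  calc C * Real.exp (3 / 8 * L) + K * L ≤ C * E ^ 3 + K * (8 * E ^ 3) := by
        rw [hE3]
        gcongr
        linarith
    _ = (C + 8 * K) * E ^ 3 := by ring
    _ < c * E * E ^ 3 := by gcongr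
    _ = c * E ^ 4 := by ring
    _ ≤ c * n := by gcongr

/-- The case of small `r`: Ramsey's theorem for arbitrary disjoint `r`-sets. -/
theorem exists_forall_weaklyCompleteSeq_of_le {r : ℕ} (hr : 0 < r) {K : ℝ} (hK0 : 0 ≤ K)
    (hK : K ≤ 1 / 4) :
    ∃ n₀ : ℕ, ∀ n : ℕ, n₀ ≤ n → ∀ G : SimpleGraph (Fin n),
      WeaklyCompleteSeq G r ⌈K * Real.logb 2 n⌉₊ ∨ WeaklyCompleteSeq Gᶜ r ⌈K * Real.logb 2 n⌉₊ := by
  have hr' : (0 : ℝ) < r := by exact_mod_cast hr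
  obtain ⟨n₀, hn₀⟩ := exists_forall_exp_add_logb_lt (C := 5) (K := 0) (c := 1 / r)
    le_rfl (by positivity)
  refine ⟨max n₀ 1, fun n hn G => ?_⟩
  have hn1 : 1 ≤ n := (le_max_right _ _).trans hn
  have hlt := hn₀ n ((le_max_left _ _).trans hn)
  set L := Real.logb 2 n with hL
  have hL0 : 0 ≤ L := Real.logb_nonneg one_lt_two (by exact_mod_cast hn1)
  set t := ⌈K * L⌉₊ with ht
  by_contra! hcon
  obtain ⟨X, hX, hXdisj⟩ := exists_disjoint_family_s15 (univ : Finset (Fin n)) (fun _ => True) (h := r)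
    (m := 0) (M := n / r) (by simpa using Nat.div_mul_le_self n r) fun U _ hU => by
      obtain ⟨Y, hYU, hY⟩ := exists_subset_card_eq (s := U) (n := r) (by omega)
      exact ⟨Y, hYU, hY, trivial⟩
  obtain ⟨h₁, h₂⟩ := cliqueFree_blockGraph (T := fun i : Fin (n / r) => X i) hr
    (fun i => (hX i i.2).2.1) (fun i j hij => hXdisj i i.2 j j.2 fun h => hij (Fin.ext h))
    hcon.1 hcon.2
  have hsmall : n / r < 4 ^ t := by
    by_contra! hle
    obtain ⟨S, -, hS⟩ | ⟨S, -, hS⟩ := exists_isNClique_or_isNClique_compl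
      (blockGraph G fun i : Fin (n / r) => X i) t t univ (by
        rw [card_univ, Fintype.card_fin, ← two_mul]
        exact (Nat.choose_le_two_pow _ _).trans (by rwa [pow_mul]))
    · exact h₁ S hS
    · exact h₂ S hS
  have hM : (n : ℝ) / r ≤ 4 ^ t := by
    rw [div_le_iff₀ hr']
    have : n ≤ 4 ^ t * r := by
      have := Nat.lt_mul_of_div_lt hsmall hr
      linarith
    exact_mod_cast this
  have h4 : (4 : ℝ) ^ t ≤ 4 * Real.exp (3 / 8 * L) := by
    have h4exp : (4 : ℝ) = Real.exp (2 * Real.log 2) := by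
      rw [two_mul, Real.exp_add, Real.exp_log two_pos]
      norm_num
    have htle : (t : ℝ) ≤ L / 4 + 1 := by
      have := (Nat.ceil_lt_add_one (mul_nonneg hK0 hL0)).le
      rw [← ht] at this
      nlinarith
    calc (4 : ℝ) ^ t = Real.exp (t * (2 * Real.log 2)) := by
          rw [Real.exp_nat_mul, ← h4exp]
      _ ≤ Real.exp (2 * Real.log 2 + 3 / 8 * L) := by
          refine Real.exp_le_exp.2 ?_
          have h2 := Real.log_two_lt_d9
          have h2' := Real.log_two_gt_d9
          calc t * (2 * Real.log 2) ≤ (L / 4 + 1) * (2 * Real.log 2) := by gcongr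
            _ ≤ _ := by nlinarith
      _ = _ := by rw [Real.exp_add, ← h4exp]
  have hexp := Real.exp_pos (3 / 8 * L)
  have : 1 / (r : ℝ) * n = n / r := by ring
  linarith

open Classical in
/-- Every large graph or its complement has linearly many disjoint `r`-sets, each completely joined
to only a small proportion of the others. -/
theorem exists_forall_exists_blocks {r h : ℕ} (hr : 0 < r) (hh : h ≤ r)
    (hh2 : 2 * (5 / 8 : ℝ) ^ h ≤ 1) :
    ∃ c : ℝ, 0 < c ∧ ∃ n₀ : ℕ, ∀ n : ℕ, n₀ ≤ n → ∀ G : SimpleGraph (Fin n),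
      ∃ G' : SimpleGraph (Fin n), (G' = G ∨ G' = Gᶜ) ∧ ∃ (M : ℕ) (T : Fin M → Finset (Fin n)),
        c * n ≤ M ∧ (∀ i, #(T i) = r) ∧ (∀ i j, i ≠ j → Disjoint (T i) (T j)) ∧
        ∀ l, (#{k | ∀ u ∈ T k, ∀ v ∈ T l, G'.Adj u v} : ℝ) ≤
          (2 * (5 / 8 : ℝ) ^ h) ^ (r - h) * M := by
  have hεpos : (0 : ℝ) < min (1 / 8) ((5 / 8 : ℝ) ^ h) := by positivity
  obtain ⟨b, hb, hpair⟩ := exists_sparse_pair hεpos (min_le_left _ _)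
  set D := b * (2 * r) with hD
  have hDpos : 0 < D := by positivity
  refine ⟨1 / (2 * D), by positivity, 4 * D, fun n hn G => ?_⟩
  obtain ⟨G', hG', A, B, hAB, hA, hB, hsparse⟩ := hpair n (by omega) G
  have hN1 : 4 ≤ n / D := (Nat.le_div_iff_mul_le hDpos).2 hn
  have hNle : 2 * ((n / D - 1 + 1) * r) ≤ n / b := by
    rw [Nat.sub_add_cancel (by omega), hD, ← Nat.div_div_eq_div_mul]
    calc 2 * (n / b / (2 * r) * r) = n / b / (2 * r) * (2 * r) := by ring
      _ ≤ n / b := Nat.div_mul_le_self _ _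
  obtain ⟨T, hT, hdisj, hdeg⟩ := exists_blocks_of_sparse_pair G' hAB (M := n / D - 1) hr hh
    (q := 5 / 8) (by norm_num) (by norm_num) hh2 ((min_le_left _ _).trans (by norm_num))
    (min_le_right _ _) hsparse (hNle.trans hA) (hNle.trans hB)
  refine ⟨G', hG', n / D - 1, T, ?_, hT, hdisj, fun l => by convert hdeg l⟩
  rw [one_div, inv_mul_le_iff₀ (by positivity)]
  have hlt : n < D * (n / D + 1) := Nat.lt_mul_div_succ n hDpos
  have : n ≤ 2 * D * (n / D - 1) := by
    obtain ⟨N, hN⟩ : ∃ N, n / D = N + 1 := ⟨n / D - 1, by omega⟩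
    rw [hN] at hlt hN1 ⊢
    rw [Nat.add_sub_cancel]
    nlinarith
  exact_mod_cast this

theorem one_add_pow_div_mul_le_exp {y δ L : ℝ} {t k : ℕ} (hy : 0 ≤ y) (hL : 0 ≤ L)
    (hδ : δ ≤ Real.exp (-(2 * y))) (ht : (t : ℝ) ≤ 1 / 16 * Real.exp y * L + 1)
    (hk : (k : ℝ) ≤ 2 * δ * t + 1) :
    (1 + Real.exp (-y)) ^ t / Real.exp (-y) ^ k *
        ((1 + Real.exp (-y)) ^ (t + (k + 1)) / Real.exp (-y) ^ (k + 1)) ≤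
      Real.exp (6 + 7 * y) * Real.exp (3 / 8 * L) := by
  set x := Real.exp (-y) with hx
  have hx0 : 0 < x := Real.exp_pos _
  have hx1 : x ≤ 1 := Real.exp_le_one_iff.2 (by linarith)
  have hxexp : x * Real.exp y = 1 := by rw [hx, ← Real.exp_add]; simp
  have hxy : x * y ≤ 1 / 2 := by
    have h1 : 2 * y ≤ Real.exp y := by
      have := Real.quadratic_le_exp_of_nonneg hy
      nlinarith [sq_nonneg (y - 1)]
    nlinarith
  have hδ' : δ ≤ x * x := by
    rwa [hx, ← Real.exp_add, show -y + -y = -(2 * y) by ring]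
  have hxt : x * t ≤ L / 16 + 1 := by
    calc x * t ≤ x * (1 / 16 * Real.exp y * L + 1) := by gcongr
      _ = x * Real.exp y * L / 16 + x := by ring
      _ ≤ _ := by rw [hxexp]; linarith
  have hk' : (k : ℝ) ≤ x * L / 8 + 3 := by
    have h1 : δ * t ≤ x * (L / 16 + 1) := by
      calc δ * t ≤ x * x * t := by gcongr
        _ = x * (x * t) := by ring
        _ ≤ _ := by gcongr
    linarith
  have hxk : x * k ≤ L / 8 + 3 := by
    have h1 : x * k ≤ k := mul_le_of_le_one_left (by positivity) hx1
    have h2 : x * L ≤ L := mul_le_of_le_one_left hL hx1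
    linarith
  have hyk : y * (2 * k + 1) ≤ L / 8 + 7 * y := by
    calc y * (2 * k + 1) ≤ y * (2 * (x * L / 8 + 3) + 1) := by gcongr
      _ = x * y * (L / 4) + 7 * y := by ring
      _ ≤ 1 / 2 * (L / 4) + 7 * y := by gcongr
      _ = _ := by ring
  have h1x : 1 + x ≤ Real.exp x := by linarith [Real.add_one_le_exp x]
  have hxpow : x ^ (2 * k + 1) * Real.exp (y * (2 * k + 1)) = 1 := by
    rw [hx, ← Real.exp_nat_mul, ← Real.exp_add]
    simp
    ring
  calc (1 + x) ^ t / x ^ k * ((1 + x) ^ (t + (k + 1)) / x ^ (k + 1))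
      = (1 + x) ^ (2 * t + k + 1) / x ^ (2 * k + 1) := by
        rw [div_mul_div_comm, ← pow_add, ← pow_add]
        congr 2 <;> ring
    _ = (1 + x) ^ (2 * t + k + 1) * Real.exp (y * (2 * k + 1)) := by
        rw [div_eq_iff (by positivity), mul_assoc, mul_comm (Real.exp _), hxpow, mul_one]
    _ ≤ Real.exp x ^ (2 * t + k + 1) * Real.exp (y * (2 * k + 1)) := by gcongr
    _ = Real.exp (2 * (x * t) + x * k + x + y * (2 * k + 1)) := by
        rw [← Real.exp_nat_mul, ← Real.exp_add]
        congr 1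
        push_cast
        ring
    _ ≤ Real.exp (6 + 7 * y + 3 / 8 * L) := Real.exp_le_exp.2 (by linarith)
    _ = _ := Real.exp_add _ _

theorem two_mul_pow_pow_le_exp {r : ℕ} (hr : 9 ≤ r) :
    (2 * (5 / 8 : ℝ) ^ (r / 2)) ^ (r - r / 2) ≤ Real.exp (-(2 * ((r : ℝ) ^ 2 / 64))) := by
  obtain ⟨h, hh⟩ : ∃ h, h = r / 2 := ⟨_, rfl⟩
  obtain ⟨s, hs⟩ : ∃ s, s = r - r / 2 := ⟨_, rfl⟩
  rw [← hs, ← hh]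
  have hrhs : (r : ℝ) = h + s := by
    have : r = h + s := by omega
    exact_mod_cast this
  have hhs : (h : ℝ) ≤ s ∧ (s : ℝ) ≤ h + 1 := by
    constructor
    · exact_mod_cast (by omega : h ≤ s)
    · exact_mod_cast (by omega : s ≤ h + 1)
  have hh4 : (4 : ℝ) ≤ h := by exact_mod_cast (by omega : 4 ≤ h)
  have hbase : 2 * (5 / 8 : ℝ) ^ h ≤ (5 / 6) ^ h := by
    have h1 : (2 : ℝ) ≤ (4 / 3) ^ h :=
      le_trans (by norm_num) (pow_le_pow_right₀ (by norm_num) (by omega : 3 ≤ h))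
    calc 2 * (5 / 8 : ℝ) ^ h ≤ (4 / 3) ^ h * (5 / 8) ^ h := by gcongr
      _ = _ := by rw [← mul_pow]; norm_num
  have h56 : (5 / 6 : ℝ) ≤ Real.exp (-(1 / 6)) := by
    linarith [Real.add_one_le_exp (-(1 / 6) : ℝ)]
  calc (2 * (5 / 8 : ℝ) ^ h) ^ s ≤ ((5 / 6) ^ h) ^ s := by gcongr
    _ ≤ (Real.exp (-(1 / 6)) ^ h) ^ s := by gcongr
    _ = Real.exp (-(h * s / 6)) := by
        rw [← Real.exp_nat_mul, ← Real.exp_nat_mul]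
        congr 1
        ring
    _ ≤ _ := by
        refine Real.exp_le_exp.2 ?_
        rw [hrhs]
        nlinarith

theorem exists_forall_weaklyCompleteSeq_of_ge {r : ℕ} (hr : 9 ≤ r) :
    ∃ n₀ : ℕ, ∀ n : ℕ, n₀ ≤ n → ∀ G : SimpleGraph (Fin n),
      WeaklyCompleteSeq G r ⌈1 / 16 * Real.exp ((r : ℝ) ^ 2 / 64) * Real.logb 2 n⌉₊ ∨
        WeaklyCompleteSeq Gᶜ r ⌈1 / 16 * Real.exp ((r : ℝ) ^ 2 / 64) * Real.logb 2 n⌉₊ := by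
  classical
  have hh2 : 2 * (5 / 8 : ℝ) ^ (r / 2) ≤ 1 := by
    have := pow_le_pow_of_le_one (by norm_num : (0 : ℝ) ≤ 5 / 8) (by norm_num)
      (by omega : 4 ≤ r / 2)
    linarith [show (5 / 8 : ℝ) ^ 4 ≤ 1 / 2 by norm_num]
  obtain ⟨c, hc, n₁, hblocks⟩ := exists_forall_exists_blocks (by omega) (Nat.div_le_self r 2) hh2
  have hδexp := two_mul_pow_pow_le_exp hr
  obtain ⟨δ, hδ⟩ : ∃ δ, δ = (2 * (5 / 8 : ℝ) ^ (r / 2)) ^ (r - r / 2) := ⟨_, rfl⟩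
  have hδpos : 0 < δ := by rw [hδ]; positivity
  rw [← hδ] at hblocks hδexp
  set y : ℝ := (r : ℝ) ^ 2 / 64 with hy
  have hy0 : 0 ≤ y := by positivity
  obtain ⟨n₂, hn₂⟩ := exists_forall_exp_add_logb_lt (C := 2 + 2 * Real.exp (6 + 7 * y))
    (K := 2 * (1 / 16 * Real.exp y)) (by positivity) hc
  refine ⟨max n₁ (max n₂ 2), fun n hn G => ?_⟩
  rw [max_le_iff, max_le_iff] at hn
  obtain ⟨hn1, hn2, hn3⟩ := hn
  have hlt := hn₂ n hn2
  set L := Real.logb 2 n with hL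
  have hL0 : 0 < L := Real.logb_pos one_lt_two (by exact_mod_cast hn3)
  set t := ⌈1 / 16 * Real.exp y * L⌉₊ with ht
  have htpos : 0 < t := Nat.ceil_pos.2 (by positivity)
  have htle : (t : ℝ) ≤ 1 / 16 * Real.exp y * L + 1 := (Nat.ceil_lt_add_one (by positivity)).le
  by_contra! hcon
  obtain ⟨G', hG', M, T, hM, hT, hdisj, hdeg⟩ := hblocks n hn1 G
  have hcon' : ¬ WeaklyCompleteSeq G' r t ∧ ¬ WeaklyCompleteSeq G'ᶜ r t := by
    rcases hG' with rfl | rfl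
    · exact hcon
    · rw [compl_compl]
      exact hcon.symm
  obtain ⟨h₁, h₂⟩ := cliqueFree_blockGraph (by omega) hT hdisj hcon'.1 hcon'.2
  have hkey := card_le_of_cliqueFree_of_degree_le (blockGraph G' T) (k := ⌈2 * δ * t⌉₊) hδpos htpos
    (Real.exp_pos (-y)) (Real.exp_le_one_iff.2 (by linarith)) (fun v => by
      rw [Fintype.card_fin]
      refine le_trans (Nat.cast_le.2 (card_le_card fun w hw => ?_)) (hdeg v)
      simp only [mem_filter, mem_univ, true_and] at hw ⊢
      exact hw.symm.2) (Nat.le_ceil _) h₁ h₂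
  rw [Fintype.card_fin] at hkey
  have hbound := one_add_pow_div_mul_le_exp hy0 hL0.le hδexp htle
    (Nat.ceil_lt_add_one (by positivity : 0 ≤ 2 * δ * t)).le
  have hexp1 : 1 ≤ Real.exp (3 / 8 * L) := Real.one_le_exp (by positivity)
  nlinarith

end

/-- **Lower bound for `g(r, n)`.** For every positive integer `r` and all sufficiently
large `n`, every graph `G` on `n` vertices is such that `G` or its complement contains a
weakly complete `r`-sequence of order at least `(1/16)·e^{2^{−6} r²}·log n` (`log` is
base 2, `e` is the base of the natural logarithm). -/
theorem stmt15 (r : ℕ) (hr : 0 < r) :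
    ∃ n₀ : ℕ, ∀ n : ℕ, n₀ ≤ n → ∀ G : SimpleGraph (Fin n),
      ∃ t : ℕ, (1 / 16 : ℝ) * Real.exp ((2 : ℝ) ^ (-(6 : ℝ)) * (r : ℝ) ^ 2) *
          Real.logb 2 n ≤ (t : ℝ) ∧
        (WeaklyCompleteSeq G r t ∨ WeaklyCompleteSeq Gᶜ r t) := by
  have hexp : (2 : ℝ) ^ (-(6 : ℝ)) * (r : ℝ) ^ 2 = (r : ℝ) ^ 2 / 64 := by
    rw [Real.rpow_neg two_pos.le, show (6 : ℝ) = ((6 : ℕ) : ℝ) by norm_num, Real.rpow_natCast]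
    ring
  rw [hexp]
  suffices hmain : ∃ n₀ : ℕ, ∀ n : ℕ, n₀ ≤ n → ∀ G : SimpleGraph (Fin n),
      WeaklyCompleteSeq G r ⌈1 / 16 * Real.exp ((r : ℝ) ^ 2 / 64) * Real.logb 2 n⌉₊ ∨
        WeaklyCompleteSeq Gᶜ r ⌈1 / 16 * Real.exp ((r : ℝ) ^ 2 / 64) * Real.logb 2 n⌉₊ by
    obtain ⟨n₀, h⟩ := hmain
    exact ⟨n₀, fun n hn G => ⟨_, Nat.le_ceil _, h n hn G⟩⟩
  rcases le_or_gt r 8 with hr8 | hr9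
  · refine exists_forall_weaklyCompleteSeq_of_le hr (by positivity) ?_
    have hle : (r : ℝ) ^ 2 / 64 ≤ 1 := by
      have : (r : ℝ) ≤ 8 := by exact_mod_cast hr8
      have : (0 : ℝ) ≤ r := by positivity
      nlinarith
    have := (Real.exp_le_exp.2 hle).trans Real.exp_one_lt_d9.le
    linarith
  · exact exists_forall_weaklyCompleteSeq_of_ge hr9
end

section
/- There is an integer n₀ such that the following holds for all n ≥ n₀. Let G be a graph on n vertices with exactly p·C(n,2) edges, where p ≥ n^{−1/8}, and let r and t be positive integers with 24·p^{−1/2} ≤ r ≤ (1/2)·√(p^{−1} log n) and t ≤ (1/32)·e^{p r²/256}·log n. Then G contains a K_t-minor in which each of the t connected sets corresponding to the vertices of the minor has size at most 8r. -/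
open Classical in
/-- Greedy covering: if each `j ∈ J` is missed by at most a proportion `b` of the elements of `X`,
then some `r` elements of `X` together miss at most a proportion `b ^ r` of `J`. -/
lemma exists_subset_card_missed_le {α β : Type*} (X : Finset α) (J : Finset β)
    (rel : α → β → Prop) (b : ℝ) (hb : 0 ≤ b) (hX : X.Nonempty)
    (h : ∀ j ∈ J, ((X.filter fun x => ¬ rel x j).card : ℝ) ≤ b * X.card) (r : ℕ) :
    ∃ R ⊆ X, R.card ≤ r ∧
      ((J.filter fun j => ∀ x ∈ R, ¬ rel x j).card : ℝ) ≤ b ^ r * J.card := by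
  induction r with
  | zero => exact ⟨∅, by simp, by simp, by simp⟩
  | succ r ih =>
    obtain ⟨R, hRX, hRc, hR⟩ := ih
    set K := J.filter fun j => ∀ x ∈ R, ¬ rel x j with hK
    have hsum : ∑ x ∈ X, ((K.filter fun j => ¬ rel x j).card : ℝ) ≤ ∑ _x ∈ X, b * K.card := by
      have h1 : ∑ x ∈ X, (K.filter fun j => ¬ rel x j).card
          = ∑ j ∈ K, (X.filter fun x => ¬ rel x j).card :=
        Finset.sum_card_bipartiteAbove_eq_sum_card_bipartiteBelow (fun x j => ¬ rel x j)
      have h2 : ∑ j ∈ K, ((X.filter fun x => ¬ rel x j).card : ℝ) ≤ ∑ _j ∈ K, b * X.card :=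
        Finset.sum_le_sum fun j hj => h j (Finset.mem_of_mem_filter j hj)
      have h3 := congrArg (Nat.cast (R := ℝ)) h1
      push_cast at h3
      rw [h3]
      refine h2.trans (le_of_eq ?_)
      simp only [Finset.sum_const, nsmul_eq_mul]
      ring
    obtain ⟨x, hx, hxK⟩ := Finset.exists_le_of_sum_le hX hsum
    refine ⟨insert x R, Finset.insert_subset hx hRX, (Finset.card_insert_le _ _).trans (by omega), ?_⟩
    have he : (J.filter fun j => ∀ y ∈ insert x R, ¬ rel y j) = K.filter fun j => ¬ rel x j := by
      ext j
      simp only [hK, Finset.mem_filter, Finset.forall_mem_insert]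
      tauto
    rw [he]
    calc _ ≤ b * K.card := hxK
      _ ≤ b * (b ^ r * J.card) := by gcongr
      _ = _ := by ring

/-- Sequential selection of pairwise disjoint sets of bounded size. -/
lemma exists_pairwise_disjoint_of_avoiding {ι V : Type*} [Fintype ι] (P : ι → Finset V → Prop)
    (N M : ℕ) (hM : Fintype.card ι * N ≤ M)
    (h : ∀ W : Finset V, W.card ≤ M → ∀ i, ∃ B, P i B ∧ B.card ≤ N ∧ Disjoint B W) :
    ∃ B : ι → Finset V, (∀ i, P i (B i) ∧ (B i).card ≤ N) ∧
      ∀ i j, i ≠ j → Disjoint (B i) (B j) := by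
  classical
  suffices H : ∀ I : Finset ι, ∃ B : ι → Finset V, (∀ i ∈ I, P i (B i) ∧ (B i).card ≤ N) ∧
      ∀ i ∈ I, ∀ j ∈ I, i ≠ j → Disjoint (B i) (B j) by
    obtain ⟨B, h1, h2⟩ := H Finset.univ
    exact ⟨B, fun i => h1 i (Finset.mem_univ i),
      fun i j => h2 i (Finset.mem_univ i) j (Finset.mem_univ j)⟩
  intro I
  induction I using Finset.induction_on with
  | empty => exact ⟨fun _ => ∅, by simp, by simp⟩
  | insert i I hi ih =>
    obtain ⟨B, h1, h2⟩ := ih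
    have hc : (I.biUnion B).card ≤ M := by
      refine (Finset.card_biUnion_le_card_mul _ _ N fun j hj => (h1 j hj).2).trans ?_
      exact (Nat.mul_le_mul_right _ (Finset.card_le_univ I)).trans hM
    obtain ⟨C, hP, hCN, hCW⟩ := h _ hc i
    have hne : ∀ j ∈ I, j ≠ i := fun j hj e => hi (e ▸ hj)
    have hd : ∀ j ∈ I, Disjoint C (B j) := fun j hj =>
      hCW.mono_right (Finset.subset_biUnion_of_mem B hj)
    refine ⟨Function.update B i C, ?_, ?_⟩
    · intro j hj
      rcases Finset.mem_insert.1 hj with rfl | hj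
      · simpa using ⟨hP, hCN⟩
      · simpa [hne j hj] using h1 j hj
    · intro j hj k hk hjk
      rcases Finset.mem_insert.1 hj with rfl | hj' <;> rcases Finset.mem_insert.1 hk with rfl | hk'
      · exact absurd rfl hjk
      · simpa [hne k hk'] using hd k hk'
      · simpa [hne j hj'] using (hd j hj').symm
      · simpa [hne k hk', hne j hj'] using h2 j hj' k hk' hjk

open Classical in
lemma sum_sum_filter_forall_rel {ι V : Type*} [Fintype ι] [Fintype V] (rel : ι → V → Prop)
    (f : ι → ℝ) (q : ℕ) :
    ∑ T : Fin q → V, ∑ x with ∀ j, rel x (T j), f x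
      = ∑ x, f x * ((Finset.univ.filter (rel x)).card : ℝ) ^ q := by
  simp_rw [Finset.sum_filter]
  rw [Finset.sum_comm]
  refine Finset.sum_congr rfl fun x _ => ?_
  rw [← Finset.sum_filter, Finset.sum_const, nsmul_eq_mul, mul_comm]
  congr 1
  have : (Finset.univ.filter fun T : Fin q → V => ∀ j, rel x (T j))
      = Fintype.piFinset fun _ => Finset.univ.filter (rel x) := by
    ext T; simp
  rw [this]
  simp

lemma mean_mul_sum_pow_le {ι : Type*} [Fintype ι] (d : ι → ℝ) (D : ℝ) (hd : ∀ x, 0 ≤ d x)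
    (hD : 0 ≤ D) (hs : ∑ x, d x = Fintype.card ι * D) (q : ℕ) :
    D * ∑ x, d x ^ q ≤ ∑ x, d x ^ (q + 1) := by
  have h1 : 0 ≤ ∑ x, (d x - D) * (d x ^ q - D ^ q) := by
    refine Finset.sum_nonneg fun x _ => ?_
    rcases le_total (d x) D with h | h
    · exact mul_nonneg_of_nonpos_of_nonpos (sub_nonpos.2 h)
        (sub_nonpos.2 (pow_le_pow_left₀ (hd x) h q))
    · exact mul_nonneg (sub_nonneg.2 h) (sub_nonneg.2 (pow_le_pow_left₀ hD h q))
  have h2 : ∑ x, (d x - D) * (d x ^ q - D ^ q)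
      = ∑ x, d x ^ (q + 1) - D * ∑ x, d x ^ q - D ^ q * (∑ x, d x - Fintype.card ι * D) := by
    have h3 : (Fintype.card ι : ℝ) * D = ∑ _x : ι, D := by simp
    rw [h3, ← Finset.sum_sub_distrib, Finset.mul_sum, Finset.mul_sum, ← Finset.sum_sub_distrib,
      ← Finset.sum_sub_distrib]
    exact Finset.sum_congr rfl fun x _ => by ring
  rw [hs, sub_self, mul_zero, sub_zero] at h2
  linarith

lemma card_mul_mean_pow_le {ι : Type*} [Fintype ι] (d : ι → ℝ) (D : ℝ) (hd : ∀ x, 0 ≤ d x)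
    (hD : 0 ≤ D) (hs : ∑ x, d x = Fintype.card ι * D) (q : ℕ) :
    Fintype.card ι * D ^ q ≤ ∑ x, d x ^ q := by
  induction q with
  | zero => simp
  | succ q ih =>
    calc _ = D * (Fintype.card ι * D ^ q) := by ring
      _ ≤ D * ∑ x, d x ^ q := by gcongr
      _ ≤ _ := mean_mul_sum_pow_le d D hd hD hs q

open Classical in
/-- Dependent random choice: there is a large set `U` of above-average density to the whole graph
in which any `k` vertices have at least `m` common neighbours. -/
lemma exists_dependent_random_choice {V : Type*} [Fintype V] (G : SimpleGraph V) (k q m : ℕ)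
    (L D : ℝ) (hL : 0 < L) (hD : 0 ≤ D)
    (hs : ∑ x, ((Finset.univ.filter (G.Adj x)).card : ℝ) = Fintype.card V * D)
    (hnum : 2 * (Fintype.card V : ℝ) ^ q * L + 2 * (Fintype.card V : ℝ) ^ (k + 1) * (m : ℝ) ^ q
      ≤ D ^ (q + 1)) (hV : 0 < Fintype.card V) :
    ∃ U : Finset V, L ≤ U.card ∧
      D / 2 * U.card ≤ ∑ x ∈ U, ((Finset.univ.filter (G.Adj x)).card : ℝ) ∧
      ∀ a : Fin k → V, (∀ i, a i ∈ U) → m ≤ (Finset.univ.filter fun v => ∀ i, G.Adj (a i) v).card := by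
  set n : ℝ := ((Fintype.card V : ℕ) : ℝ) with hn
  have hn0 : 0 < n := by rw [hn]; exact_mod_cast hV
  set d : V → ℝ := fun x => ((Finset.univ.filter (G.Adj x)).card : ℝ) with hd
  have hd0 : ∀ x, 0 ≤ d x := fun x => Nat.cast_nonneg _
  have hdn : ∀ x, d x ≤ n := fun x => by
    simp only [hd, hn]; exact_mod_cast Finset.card_le_univ _
  set bad : (Fin k → V) → ℝ := fun a =>
    if (Finset.univ.filter fun v => ∀ i, G.Adj (a i) v).card < m then 1 else 0 with hbad
  have hbad0 : ∀ a, 0 ≤ bad a := fun a => by simp only [hbad]; split_ifs <;> norm_num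
  let U : (Fin q → V) → Finset V := fun T => Finset.univ.filter fun x => ∀ j, G.Adj x (T j)
  let S : (Fin q → V) → Finset (Fin k → V) := fun T =>
    Finset.univ.filter fun a => ∀ j, ∀ i, G.Adj (a i) (T j)
  have e1 : ∑ T, ∑ x ∈ U T, d x = ∑ x, d x ^ (q + 1) := by
    rw [show (∑ T, ∑ x ∈ U T, d x) = _ from sum_sum_filter_forall_rel G.Adj d q]
    exact Finset.sum_congr rfl fun x _ => by simp only [hd]; ring
  have e2 : ∑ T, ((U T).card : ℝ) = ∑ x, d x ^ q := by
    have := sum_sum_filter_forall_rel G.Adj (fun _ => 1) q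
    simpa [U, hd] using this
  have e3 : ∑ T, ∑ a ∈ S T, bad a ≤ n ^ k * (m : ℝ) ^ q := by
    have e : ∑ T, ∑ a ∈ S T, bad a = ∑ a, bad a *
        ((Finset.univ.filter fun v => ∀ i, G.Adj (a i) v).card : ℝ) ^ q := by
      convert sum_sum_filter_forall_rel (fun (a : Fin k → V) v => ∀ i, G.Adj (a i) v) bad q
    rw [e]
    have : ∀ a ∈ (Finset.univ : Finset (Fin k → V)), bad a *
        ((Finset.univ.filter fun v => ∀ i, G.Adj (a i) v).card : ℝ) ^ q ≤ (m : ℝ) ^ q := by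
      intro a _
      simp only [hbad]
      split_ifs with h
      · rw [one_mul]
        gcongr
      · rw [zero_mul]; positivity
    refine (Finset.sum_le_sum this).trans (le_of_eq ?_)
    simp [hn]
  have hpos : ∑ _T : Fin q → V, L * n
      ≤ ∑ T, (∑ x ∈ U T, d x - D / 2 * (U T).card - n ^ 2 * ∑ a ∈ S T, bad a) := by
    rw [Finset.sum_sub_distrib, Finset.sum_sub_distrib, ← Finset.mul_sum Finset.univ _ (D / 2),
      ← Finset.mul_sum Finset.univ _ (n ^ 2), e1, e2]
    have h1 := mean_mul_sum_pow_le d D hd0 hD hs q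
    have h2 := card_mul_mean_pow_le d D hd0 hD hs (q + 1)
    have h3 : n ^ 2 * ∑ T, ∑ a ∈ S T, bad a ≤ n ^ 2 * (n ^ k * (m : ℝ) ^ q) := by gcongr
    have h4 := mul_le_mul_of_nonneg_left hnum hn0.le
    have h5 : ∑ _T : Fin q → V, L * n = n ^ q * (L * n) := by simp [hn]
    rw [h5]
    have h6 : n * (2 * n ^ q * L + 2 * n ^ (k + 1) * (m : ℝ) ^ q)
      = 2 * (n ^ q * (L * n)) + 2 * (n ^ 2 * (n ^ k * (m : ℝ) ^ q)) := by ring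
    rw [h6] at h4
    linarith
  have hne : (Finset.univ : Finset (Fin q → V)).Nonempty := by
    have : Nonempty V := Fintype.card_pos_iff.1 hV
    exact Finset.univ_nonempty
  obtain ⟨T, -, hT⟩ := Finset.exists_le_of_sum_le hne hpos
  have hB0 : 0 ≤ ∑ a ∈ S T, bad a := Finset.sum_nonneg fun a _ => hbad0 a
  have hU0 : (0 : ℝ) ≤ D / 2 * (U T).card := by positivity
  have hB0' : 0 ≤ n ^ 2 * ∑ a ∈ S T, bad a := by positivity
  have hUn : ((U T).card : ℝ) ≤ n := by
    rw [hn]; exact_mod_cast Finset.card_le_univ _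
  have hLn : 0 < L * n := by positivity
  have hle : ∑ x ∈ U T, d x ≤ (U T).card * n := by
    simpa using Finset.sum_le_sum fun x (_ : x ∈ U T) => hdn x
  refine ⟨U T, ?_, by linarith, ?_⟩
  · have : L * n ≤ (U T).card * n := by linarith
    exact le_of_mul_le_mul_right this hn0
  · intro a ha
    by_contra hlt
    have ha' : a ∈ S T := by
      simp only [S, U, Finset.mem_filter, Finset.mem_univ, true_and] at ha ⊢
      exact fun j i => ha i j
    have h1 : 1 ≤ ∑ a ∈ S T, bad a := by
      refine le_trans (le_of_eq ?_) (Finset.single_le_sum (fun a _ => hbad0 a) ha')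
      simp only [hbad]
      rw [if_pos (not_le.1 hlt)]
    have : ((U T).card : ℝ) * n ≤ n * n := by gcongr
    nlinarith [sq_nonneg n]

lemma exists_common_neighbours_hitting {ι V : Type*} (G : SimpleGraph V) (U W : Finset V) (s : ℕ)
    (hcn : ∀ S ⊆ U, S.card ≤ s + 1 → S.Nonempty → ∃ v ∉ W, ∀ x ∈ S, G.Adj x v)
    (z : V) (hz : z ∈ U) (f : ι → V) (hf : ∀ i, f i ∈ U) (r : ℕ) :
    ∀ J : Finset ι, J.card ≤ r * s → ∃ C : Finset V, C.card ≤ r ∧ Disjoint C W ∧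
      (∀ c ∈ C, G.Adj z c) ∧ ∀ j ∈ J, ∃ c ∈ C, G.Adj (f j) c := by
  classical
  induction r with
  | zero =>
    intro J hJ
    have : J = ∅ := by simpa using hJ
    exact ⟨∅, by simp, by simp, by simp, by simp [this]⟩
  | succ r ih =>
    intro J hJ
    obtain ⟨K, hKJ, hK⟩ := Finset.exists_subset_card_eq (min_le_right s J.card)
    have hc : (J \ K).card ≤ r * s := by
      rw [Finset.card_sdiff_of_subset hKJ, hK]
      have : (r + 1) * s = r * s + s := by ring
      omega
    obtain ⟨C, hCr, hCW, hCz, hCJ⟩ := ih _ hc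
    obtain ⟨v, hvW, hv⟩ := hcn (insert z (K.image f))
      (Finset.insert_subset hz (by
        intro x hx
        obtain ⟨i, -, rfl⟩ := Finset.mem_image.1 hx
        exact hf i))
      ((Finset.card_insert_le _ _).trans (by
        have := Finset.card_image_le (s := K) (f := f)
        have := min_le_left s J.card
        omega))
      (Finset.insert_nonempty _ _)
    refine ⟨insert v C, (Finset.card_insert_le _ _).trans (by omega), ?_, ?_, ?_⟩
    · exact Finset.disjoint_insert_left.2 ⟨hvW, hCW⟩
    · intro c hc
      rcases Finset.mem_insert.1 hc with rfl | hc
      · exact hv _ (Finset.mem_insert_self _ _)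
      · exact hCz c hc
    · intro j hj
      by_cases hjK : j ∈ K
      · exact ⟨v, Finset.mem_insert_self _ _,
          hv _ (Finset.mem_insert_of_mem (Finset.mem_image_of_mem f hjK))⟩
      · obtain ⟨c, hc, hcj⟩ := hCJ j (Finset.mem_sdiff.2 ⟨hj, hjK⟩)
        exact ⟨c, Finset.mem_insert_of_mem hc, hcj⟩

lemma connected_induce_of_reachable_center {V : Type*} (G : SimpleGraph V) (B : Set V) (z : V)
    (hz : z ∈ B) (h : ∀ x (hx : x ∈ B), (G.induce B).Reachable ⟨x, hx⟩ ⟨z, hz⟩) :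
    (G.induce B).Connected :=
  SimpleGraph.connected_iff_exists_forall_reachable _ |>.2 ⟨⟨z, hz⟩, fun ⟨x, hx⟩ => (h x hx).symm⟩

open Classical in
/-- One branch set: `A` is extended, outside `W`, to a connected set joined to all sets `A' j`. -/
lemma exists_connected_extension {ι V : Type*} [Fintype ι] (G : SimpleGraph V)
    (U W Y A : Finset V) (A' : ι → Finset V) (r s : ℕ) (b : ℝ) (hb : 0 ≤ b) (hs : 1 ≤ s)
    (hcn : ∀ S ⊆ U, S.card ≤ s + 1 → S.Nonempty → ∃ v ∉ W, ∀ x ∈ S, G.Adj x v)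
    (hYU : ∀ y ∈ Y, ∃ u ∈ U, u ∉ W ∧ G.Adj y u) (hYW : (Y \ W).Nonempty)
    (hA : A ⊆ U) (hA0 : A.Nonempty) (hAr : A.card ≤ r + 1)
    (hA' : ∀ j, A' j ⊆ U) (hA'0 : ∀ j, (A' j).Nonempty)
    (hmiss : ∀ j, (((Y \ W).filter fun y => ¬ ∃ a ∈ A' j, G.Adj y a).card : ℝ)
      ≤ b * (Y \ W).card)
    (hrs : b ^ r * Fintype.card ι ≤ r * s) :
    ∃ E : Finset V, ((G.induce ((A ∪ E : Finset V) : Set V)).Connected ∧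
      ∀ j, ∃ x ∈ E, ∃ a ∈ A' j, G.Adj x a) ∧ E.card ≤ 5 * r + 1 ∧ Disjoint E W := by
  obtain ⟨R, hRY, hRr, hR⟩ := exists_subset_card_missed_le (Y \ W) (Finset.univ : Finset ι)
    (fun y j => ∃ a ∈ A' j, G.Adj y a) b hb hYW (fun j _ => by convert hmiss j) r
  obtain ⟨z, hz⟩ := hA0
  choose f hf using hA'0
  set J := Finset.univ.filter fun j => ∀ x ∈ R, ¬ ∃ a ∈ A' j, G.Adj x a with hJ
  have hJc : J.card ≤ r * s := by
    have : (J.card : ℝ) ≤ r * s := by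
      rw [Finset.card_univ] at hR
      refine le_trans (le_of_eq ?_) (hR.trans hrs)
      rw [hJ]
      congr!
    exact_mod_cast this
  obtain ⟨C, hCr, hCW, hCz, hCJ⟩ := exists_common_neighbours_hitting G U W s hcn z (hA hz) f
    (fun j => hA' j (hf j)) r J hJc
  have hpair : ∀ x, ∃ v, x ∈ U → v ∉ W ∧ G.Adj x v ∧ G.Adj v z := by
    intro x
    by_cases hx : x ∈ U
    · obtain ⟨v, hv, h⟩ := hcn {x, z} (by
        intro y hy
        rcases Finset.mem_insert.1 hy with rfl | hy
        · exact hx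
        · rw [Finset.mem_singleton.1 hy]; exact hA hz)
        ((Finset.card_insert_le _ _).trans (by simpa using hs)) ⟨x, by simp⟩
      exact ⟨v, fun _ => ⟨hv, h x (by simp), (h z (by simp)).symm⟩⟩
    · exact ⟨x, fun h => absurd h hx⟩
  choose w hw using hpair
  have hu' : ∀ y, ∃ u, y ∈ Y → u ∈ U ∧ u ∉ W ∧ G.Adj y u := by
    intro y
    by_cases hy : y ∈ Y
    · obtain ⟨u, h⟩ := hYU y hy
      exact ⟨u, fun _ => h⟩
    · exact ⟨y, fun h => absurd h hy⟩
  choose u hu using hu'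
  have hRY' : ∀ y ∈ R, y ∈ Y := fun y hy => (Finset.mem_sdiff.1 (hRY hy)).1
  set E := R ∪ R.image u ∪ (R.image u).image w ∪ A.image w ∪ C with hE
  have hmemE : ∀ x, x ∈ E ↔ x ∈ R ∨ (∃ y ∈ R, u y = x) ∨ (∃ y ∈ R, w (u y) = x) ∨
      (∃ a ∈ A, w a = x) ∨ x ∈ C := by
    intro x
    simp [hE]
  have hzB : z ∈ ((A ∪ E : Finset V) : Set V) := by simp [hz]
  refine ⟨E, ⟨?_, ?_⟩, ?_, ?_⟩
  · refine connected_induce_of_reachable_center G _ z hzB ?_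
    have step : ∀ x y (hx : x ∈ ((A ∪ E : Finset V) : Set V))
        (hy : y ∈ ((A ∪ E : Finset V) : Set V)), G.Adj x y →
        (G.induce ((A ∪ E : Finset V) : Set V)).Reachable ⟨x, hx⟩ ⟨y, hy⟩ := by
      intro x y hx hy h
      exact SimpleGraph.Adj.reachable (by simpa using h)
    have hBE : ∀ x, x ∈ E → x ∈ ((A ∪ E : Finset V) : Set V) := by
      intro x hx; simp [hx]
    have hmu : ∀ y ∈ R, u y ∈ ((A ∪ E : Finset V) : Set V) := fun y hy =>
      hBE _ ((hmemE _).2 (Or.inr (Or.inl ⟨y, hy, rfl⟩)))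
    have hmw : ∀ y ∈ R, w (u y) ∈ ((A ∪ E : Finset V) : Set V) := fun y hy =>
      hBE _ ((hmemE _).2 (Or.inr (Or.inr (Or.inl ⟨y, hy, rfl⟩))))
    have hmA : ∀ a ∈ A, w a ∈ ((A ∪ E : Finset V) : Set V) := fun a ha =>
      hBE _ ((hmemE _).2 (Or.inr (Or.inr (Or.inr (Or.inl ⟨a, ha, rfl⟩)))))
    have rw' : ∀ y (hy : y ∈ R), (G.induce ((A ∪ E : Finset V) : Set V)).Reachable
        ⟨w (u y), hmw y hy⟩ ⟨z, hzB⟩ := fun y hy =>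
      step _ _ _ _ (hw _ (hu y (hRY' y hy)).1).2.2
    have ru : ∀ y (hy : y ∈ R), (G.induce ((A ∪ E : Finset V) : Set V)).Reachable
        ⟨u y, hmu y hy⟩ ⟨z, hzB⟩ := fun y hy =>
      (step _ _ _ _ (hw _ (hu y (hRY' y hy)).1).2.1).trans (rw' y hy)
    have rA : ∀ a (ha : a ∈ A), (G.induce ((A ∪ E : Finset V) : Set V)).Reachable
        ⟨w a, hmA a ha⟩ ⟨z, hzB⟩ := fun a ha => step _ _ _ _ (hw _ (hA ha)).2.2
    intro x hx
    have hx' : x ∈ A ∨ x ∈ E := by simpa using hx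
    rcases hx' with hx' | hx'
    · exact (step _ _ _ (hmA x hx') (hw _ (hA hx')).2.1).trans (rA x hx')
    · rcases (hmemE x).1 hx' with h | ⟨y, hy, rfl⟩ | ⟨y, hy, rfl⟩ | ⟨a, ha, rfl⟩ | h
      · exact (step _ _ _ (hmu x h) (hu x (hRY' x h)).2.2).trans (ru x h)
      · exact ru y hy
      · exact rw' y hy
      · exact rA a ha
      · exact step _ _ _ _ (hCz x h).symm
  · intro j
    by_cases hj : j ∈ J
    · obtain ⟨c, hc, hcj⟩ := hCJ j hj
      exact ⟨c, (hmemE c).2 (by tauto), f j, hf j, hcj.symm⟩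
    · simp only [hJ, Finset.mem_filter, Finset.mem_univ, true_and, not_forall, not_not] at hj
      obtain ⟨x, hx, h⟩ := hj
      exact ⟨x, (hmemE x).2 (by tauto), h⟩
  · have c1 : (R.image u).card ≤ R.card := Finset.card_image_le
    have c2 : ((R.image u).image w).card ≤ (R.image u).card := Finset.card_image_le
    have c3 : (A.image w).card ≤ A.card := Finset.card_image_le
    have c4 := Finset.card_union_le (R ∪ R.image u ∪ (R.image u).image w ∪ A.image w) C
    have c5 := Finset.card_union_le (R ∪ R.image u ∪ (R.image u).image w) (A.image w)
    have c6 := Finset.card_union_le (R ∪ R.image u) ((R.image u).image w)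
    have c7 := Finset.card_union_le R (R.image u)
    rw [hE]
    omega
  · rw [Finset.disjoint_left]
    intro x hx
    rcases (hmemE x).1 hx with h | ⟨y, hy, rfl⟩ | ⟨y, hy, rfl⟩ | ⟨a, ha, rfl⟩ | h
    · exact (Finset.mem_sdiff.1 (hRY h)).2
    · exact (hu y (hRY' y hy)).2.1
    · exact (hw _ (hu y (hRY' y hy)).1).1
    · exact (hw _ (hA ha)).1
    · exact Finset.disjoint_left.1 hCW h

open Classical in
lemma exists_clique_minor_of_rich_pair {V : Type*} (G : SimpleGraph V)
    (U Y : Finset V) (r s t M : ℕ) (c : ℝ) (hc0 : 0 < c) (hc1 : c < 1) (hr : 1 ≤ r) (hs : 1 ≤ s)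
    (hM : t * (8 * r) ≤ M)
    (hcn : ∀ S ⊆ U, S.card ≤ s + 1 → S.Nonempty → ∀ W : Finset V, W.card ≤ M →
      ∃ v ∉ W, ∀ x ∈ S, G.Adj x v)
    (hY : ∀ y ∈ Y, 2 * c * U.card ≤ ((U.filter (G.Adj y)).card : ℝ))
    (hU0 : U.Nonempty) (hY0 : Y.Nonempty) (hUM : (M : ℝ) ≤ c * U.card) (hYM : (M : ℝ) ≤ c * Y.card)
    (ht : ((1 - c) ^ (r - 1)) ^ r * t ≤ r * s) :
    ∃ B : Fin t → Finset V,
      (∀ i, (B i).card ≤ 8 * r) ∧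
      (∀ i j, i ≠ j → Disjoint (B i) (B j)) ∧
      (∀ i, (G.induce ((B i : Set V))).Connected) ∧
      (∀ i j, i ≠ j → ∃ u ∈ B i, ∃ v ∈ B j, G.Adj u v) := by
  have hUpos : (0 : ℝ) < U.card := by exact_mod_cast hU0.card_pos
  have hYpos : (0 : ℝ) < Y.card := by exact_mod_cast hY0.card_pos
  have hfree : ∀ W : Finset V, W.card ≤ M → ∀ y ∈ Y,
      c * U.card ≤ (((U \ W).filter (G.Adj y)).card : ℝ) := by
    intro W hW y hy
    have h1 : (U.filter (G.Adj y)).card ≤ ((U \ W).filter (G.Adj y)).card + W.card := by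
      refine (Finset.card_le_card ?_).trans (Finset.card_union_le _ _)
      intro x hx
      simp only [Finset.mem_filter, Finset.mem_union, Finset.mem_sdiff] at hx ⊢
      tauto
    have h2 : ((U.filter (G.Adj y)).card : ℝ) ≤ ((U \ W).filter (G.Adj y)).card + W.card := by
      exact_mod_cast h1
    have h3 : (W.card : ℝ) ≤ M := by exact_mod_cast hW
    have := hY y hy
    linarith
  have hsdiff : ∀ X W : Finset V, (X.card : ℝ) ≤ (X \ W).card + W.card := by
    intro X W
    have := Finset.le_card_sdiff W X
    have : X.card ≤ (X \ W).card + W.card := by omega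
    exact_mod_cast this
  have hsne : ∀ X W : Finset V, (0 : ℝ) < X.card → (M : ℝ) ≤ c * X.card → W.card ≤ M →
      (X \ W).Nonempty := by
    intro X W hX hXM hW
    have h3 : (W.card : ℝ) ≤ M := by exact_mod_cast hW
    have : (0 : ℝ) < (X \ W).card := by
      have := hsdiff X W
      nlinarith
    exact Finset.card_pos.1 (by exact_mod_cast this)
  obtain ⟨A, hA, hAd⟩ := exists_pairwise_disjoint_of_avoiding (ι := Fin t)
    (fun _ A => A ⊆ U ∧ A.Nonempty ∧
      ((Y.filter fun y => ¬ ∃ a ∈ A, G.Adj y a).card : ℝ) ≤ (1 - c) ^ r * Y.card)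
    (r + 1) M (by
      rw [Fintype.card_fin]
      exact (Nat.mul_le_mul_left t (by omega : r + 1 ≤ 8 * r)).trans hM) (by
    intro W hW _
    obtain ⟨R, hRX, hRr, hR⟩ := exists_subset_card_missed_le (U \ W) Y (fun x y => G.Adj y x)
      (1 - c) (by linarith) (hsne U W hUpos hUM hW) (by
        intro y hy
        have h1 := Finset.card_filter_add_card_filter_not (s := U \ W) (p := G.Adj y)
        have h2 : (((U \ W).filter (G.Adj y)).card : ℝ)
          + ((U \ W).filter fun x => ¬ G.Adj y x).card = (U \ W).card := by exact_mod_cast h1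
        have h3 := hfree W hW y hy
        have h4 : ((U \ W).card : ℝ) ≤ U.card := by
          exact_mod_cast Finset.card_le_card Finset.sdiff_subset
        nlinarith) r
    obtain ⟨z, hz⟩ := hsne U W hUpos hUM hW
    have hsub : insert z R ⊆ U \ W := Finset.insert_subset hz hRX
    refine ⟨insert z R, ⟨hsub.trans Finset.sdiff_subset, Finset.insert_nonempty _ _, ?_⟩,
      (Finset.card_insert_le _ _).trans (by omega), ?_⟩
    · refine le_trans ?_ hR
      have : (Y.filter fun y => ¬ ∃ a ∈ insert z R, G.Adj y a)
          ⊆ Y.filter fun y => ∀ x ∈ R, ¬ G.Adj y x := by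
        intro y hy
        simp only [Finset.mem_filter] at hy ⊢
        exact ⟨hy.1, fun x hx h => hy.2 ⟨x, Finset.mem_insert_of_mem hx, h⟩⟩
      exact_mod_cast Finset.card_le_card this
    · exact Finset.sdiff_disjoint.mono_left hsub)
  set Z := Finset.univ.biUnion A with hZ
  have hZc : Z.card ≤ t * (r + 1) := by
    have := Finset.card_biUnion_le_card_mul Finset.univ A (r + 1) fun i _ => (hA i).2
    simpa using this
  obtain ⟨E, hE, hEd⟩ := exists_pairwise_disjoint_of_avoiding (ι := Fin t)
    (fun i E => ((G.induce ((A i ∪ E : Finset V) : Set V)).Connected ∧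
      ∀ j, ∃ x ∈ E, ∃ a ∈ A j, G.Adj x a) ∧ Disjoint E Z)
    (5 * r + 1) (t * (5 * r + 1)) (by simp) (by
    intro W' hW' i
    set W := W' ∪ Z with hWdef
    have hW : W.card ≤ M := by
      have h1 := Finset.card_union_le W' Z
      have h2 : t * (5 * r + 1) + t * (r + 1) ≤ t * (8 * r) := by
        rw [← Nat.mul_add]
        exact Nat.mul_le_mul_left t (by omega)
      rw [hWdef]
      omega
    obtain ⟨E, hE1, hE2, hE3⟩ := exists_connected_extension G U W Y (A i) A r s
      ((1 - c) ^ (r - 1)) (pow_nonneg (by linarith) _) hs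
      (fun S h1 h2 h3 => hcn S h1 h2 h3 W hW)
      (by
        intro y hy
        have h1 := hfree W hW y hy
        have h2 : (0 : ℝ) < ((U \ W).filter (G.Adj y)).card := by
          have : 0 < c * U.card := by positivity
          linarith
        rw [Nat.cast_pos, Finset.card_pos] at h2
        obtain ⟨u, hu⟩ := h2
        simp only [Finset.mem_filter, Finset.mem_sdiff] at hu
        exact ⟨u, hu.1.1, hu.1.2, hu.2⟩)
      (hsne Y W hYpos hYM hW) (hA i).1.1 (hA i).1.2.1 (hA i).2
      (fun j => (hA j).1.1) (fun j => (hA j).1.2.1)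
      (by
        intro j
        have h1 := (hA j).1.2.2
        have h2 : (((Y \ W).filter fun y => ¬ ∃ a ∈ A j, G.Adj y a).card : ℝ)
            ≤ (Y.filter fun y => ¬ ∃ a ∈ A j, G.Adj y a).card := by
          exact_mod_cast Finset.card_le_card (Finset.filter_subset_filter _ Finset.sdiff_subset)
        refine h2.trans (h1.trans ?_)
        have h3 : (1 - c) ^ r = (1 - c) ^ (r - 1) * (1 - c) := by
          rw [← pow_succ]; congr 1; omega
        rw [h3, mul_assoc]
        refine mul_le_mul_of_nonneg_left ?_ (pow_nonneg (by linarith) _)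
        have := hsdiff Y W
        have h4 : (W.card : ℝ) ≤ M := by exact_mod_cast hW
        linarith)
      (by simpa using ht)
    exact ⟨E, ⟨hE1, hE3.mono_right Finset.subset_union_right⟩, hE2,
      hE3.mono_right Finset.subset_union_left⟩)
  have hAZ : ∀ i, A i ⊆ Z := fun i => Finset.subset_biUnion_of_mem A (Finset.mem_univ i)
  refine ⟨fun i => A i ∪ E i, ?_, ?_, fun i => (hE i).1.1.1, ?_⟩
  · intro i
    refine (Finset.card_union_le _ _).trans ?_
    have := (hA i).2
    have := (hE i).2
    omega
  · intro i j hij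
    rw [Finset.disjoint_union_left, Finset.disjoint_union_right, Finset.disjoint_union_right]
    exact ⟨⟨hAd i j hij, ((hE j).1.2.mono_right (hAZ i)).symm⟩,
      (hE i).1.2.mono_right (hAZ j), hEd i j hij⟩
  · intro i j _
    obtain ⟨x, hx, a, ha, h⟩ := (hE i).1.1.2 j
    exact ⟨x, Finset.mem_union_right _ hx, a, Finset.mem_union_left _ ha, h⟩

open Classical in
lemma sum_card_adj_eq_twice_ncard_edgeSet {V : Type*} [Fintype V] (G : SimpleGraph V) :
    ∑ x, (Finset.univ.filter (G.Adj x)).card = 2 * G.edgeSet.ncard := by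
  have h := G.sum_degrees_eq_twice_card_edges
  rw [Set.ncard_eq_toFinset_card']
  convert h using 2 with x
  swap
  · rw [SimpleGraph.edgeFinset]
  rw [← G.card_neighborFinset_eq_degree, G.neighborFinset_eq_filter]

open Classical in
lemma exists_clique_minor_of_density {V : Type*} [Fintype V] (G : SimpleGraph V)
    (p L : ℝ) (r s t q m : ℕ) (hp0 : 0 < p) (hp1 : p ≤ 1) (hr : 1 ≤ r) (hs : 1 ≤ s)
    (hn : 2 ≤ Fintype.card V)
    (hE : (G.edgeSet.ncard : ℝ) = p * ((Fintype.card V).choose 2 : ℝ))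
    (hm : t * (8 * r) < m) (hL : 0 < L)
    (hnum : 2 * (Fintype.card V : ℝ) ^ q * L + 2 * (Fintype.card V : ℝ) ^ (s + 2) * (m : ℝ) ^ q
      ≤ (p * ((Fintype.card V : ℝ) - 1)) ^ (q + 1))
    (hLM : ((t * (8 * r) : ℕ) : ℝ) ≤ p / 16 * L)
    (hnM : ((t * (8 * r) : ℕ) : ℝ) ≤ p / 16 * (p / 8 * Fintype.card V))
    (ht : ((1 - p / 16) ^ (r - 1)) ^ r * t ≤ (r * s : ℝ)) :
    ∃ B : Fin t → Finset V,
      (∀ i, (B i).card ≤ 8 * r) ∧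
      (∀ i j, i ≠ j → Disjoint (B i) (B j)) ∧
      (∀ i, (G.induce ((B i : Set V))).Connected) ∧
      (∀ i j, i ≠ j → ∃ u ∈ B i, ∃ v ∈ B j, G.Adj u v) := by
  have hn2 : (2 : ℝ) ≤ Fintype.card V := by exact_mod_cast hn
  have hdeg : ∑ x, ((Finset.univ.filter (G.Adj x)).card : ℝ)
      = Fintype.card V * (p * ((Fintype.card V : ℝ) - 1)) := by
    have h := congrArg (Nat.cast (R := ℝ)) (sum_card_adj_eq_twice_ncard_edgeSet G)
    push_cast at h
    rw [h, hE, Nat.cast_choose_two]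
    ring
  obtain ⟨U, hUL, hUD, hUm⟩ := exists_dependent_random_choice G (s + 1) q m L _ hL
    (mul_nonneg hp0.le (by linarith)) hdeg hnum (by omega)
  set n : ℝ := ((Fintype.card V : ℕ) : ℝ) with hnn
  have hU0 : (0 : ℝ) < U.card := hL.trans_le hUL
  set Y := Finset.univ.filter fun y => p / 8 * U.card ≤ ((U.filter (G.Adj y)).card : ℝ) with hY
  have hcount : ∑ x ∈ U, ((Finset.univ.filter (G.Adj x)).card : ℝ)
      = ∑ y, ((U.filter (G.Adj y)).card : ℝ) := by
    have h := Finset.sum_card_bipartiteAbove_eq_sum_card_bipartiteBelow (s := U)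
      (t := (Finset.univ : Finset V)) G.Adj
    have h' := congrArg (Nat.cast (R := ℝ)) h
    push_cast at h'
    simp only [Finset.bipartiteAbove, Finset.bipartiteBelow] at h'
    rw [h']
    simp_rw [G.adj_comm]
  have hYn : p / 8 * n ≤ Y.card := by
    have h1 : ∀ y ∈ (Finset.univ : Finset V), ((U.filter (G.Adj y)).card : ℝ)
        ≤ (if p / 8 * U.card ≤ ((U.filter (G.Adj y)).card : ℝ) then (U.card : ℝ) else 0)
          + p / 8 * U.card := by
      intro y _
      split_ifs with h
      · have : ((U.filter (G.Adj y)).card : ℝ) ≤ U.card := by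
          exact_mod_cast Finset.card_le_card (Finset.filter_subset _ _)
        have : 0 < p / 8 * U.card := by positivity
        linarith
      · linarith
    have h2 := Finset.sum_le_sum h1
    rw [← hcount, Finset.sum_add_distrib, ← Finset.sum_filter, Finset.sum_const, Finset.sum_const,
      nsmul_eq_mul, nsmul_eq_mul, Finset.card_univ, ← hnn] at h2
    have h3 : p * n / 4 * U.card ≤ p * (n - 1) / 2 * U.card := by
      have : 0 ≤ p * U.card * (n - 2) := mul_nonneg (by positivity) (by linarith)
      nlinarith
    have h4 : p / 8 * n * U.card ≤ Y.card * U.card := by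
      have := hUD.trans h2
      nlinarith
    exact le_of_mul_le_mul_right h4 hU0
  have hY0 : (0 : ℝ) < Y.card := lt_of_lt_of_le (by positivity) hYn
  refine exists_clique_minor_of_rich_pair G U Y r s t (t * (8 * r)) (p / 16) (by positivity)
    (by linarith) hr hs le_rfl ?_ ?_ (Finset.card_pos.1 (by exact_mod_cast hU0))
    (Finset.card_pos.1 (by exact_mod_cast hY0)) (hLM.trans (by gcongr)) (hnM.trans (by gcongr)) ht
  · intro S hSU hSc hS0 W hW
    obtain ⟨z, hz⟩ := hS0
    have hemb : ∃ a : Fin (s + 1) → V, (∀ i, a i ∈ U) ∧ ∀ x ∈ S, ∃ i, a i = x := by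
      refine ⟨fun i => if h : i.1 < S.card then (S.equivFin.symm ⟨i.1, h⟩ : V) else z, ?_, ?_⟩
      · intro i
        dsimp only
        split_ifs with h
        · exact hSU (S.equivFin.symm ⟨i.1, h⟩).2
        · exact hSU hz
      · intro x hx
        have hlt := (S.equivFin ⟨x, hx⟩).2
        exact ⟨⟨(S.equivFin ⟨x, hx⟩).1, by omega⟩, by simp⟩
    obtain ⟨a, haU, haS⟩ := hemb
    have h1 := hUm a haU
    obtain ⟨v, hv, hvW⟩ := Finset.exists_mem_notMem_of_card_lt_card
      (lt_of_le_of_lt hW (hm.trans_le h1))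
    refine ⟨v, hvW, fun x hx => ?_⟩
    obtain ⟨i, rfl⟩ := haS x hx
    exact (Finset.mem_filter.1 hv).2 i
  · intro y hy
    have := (Finset.mem_filter.1 hy).2
    linarith

lemma eventually_rpow_logb_bounds : ∃ n₀ : ℕ, ∀ n : ℕ, n₀ ≤ n →
    128 ≤ (n : ℝ) ^ (1 / 100 : ℝ) ∧ Real.logb 2 n ^ 2 ≤ (n : ℝ) ^ (1 / 100 : ℝ) ∧
      1 ≤ Real.logb 2 n := by
  have h1 : ∀ᶠ x : ℝ in Filter.atTop, 128 ≤ x ^ (1 / 100 : ℝ) :=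
    (tendsto_rpow_atTop (by norm_num)).eventually_ge_atTop 128
  have h2 : ∀ᶠ x : ℝ in Filter.atTop, Real.logb 2 x ^ 2 ≤ x ^ (1 / 100 : ℝ) := by
    have h := (isLittleO_log_rpow_atTop (r := 1 / 200) (by norm_num)).bound
      (c := Real.log 2) (Real.log_pos (by norm_num))
    filter_upwards [h, Filter.eventually_ge_atTop 1] with x hx hx1
    have hl : 0 ≤ Real.log x := Real.log_nonneg hx1
    have h2 : 0 < Real.log 2 := Real.log_pos (by norm_num)
    rw [Real.norm_of_nonneg hl, Real.norm_of_nonneg (by positivity)] at hx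
    have h3 : Real.logb 2 x ≤ x ^ (1 / 200 : ℝ) := by
      rw [Real.logb, div_le_iff₀ h2]; linarith
    have h4 : 0 ≤ Real.logb 2 x := by rw [Real.logb]; positivity
    calc Real.logb 2 x ^ 2 ≤ (x ^ (1 / 200 : ℝ)) ^ 2 := by gcongr
      _ = x ^ (1 / 100 : ℝ) := by
        rw [← Real.rpow_natCast, ← Real.rpow_mul (by linarith)]; norm_num
  have h3 : ∀ᶠ x : ℝ in Filter.atTop, 1 ≤ Real.logb 2 x :=
    (Real.tendsto_logb_atTop (by norm_num)).eventually_ge_atTop 1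
  obtain ⟨N, hN⟩ := Filter.eventually_atTop.1
    (tendsto_natCast_atTop_atTop.eventually ((h1.and h2).and h3) :
      ∀ᶠ n : ℕ in Filter.atTop, _)
  exact ⟨N, fun n hn => ⟨(hN n hn).1.1, (hN n hn).1.2, (hN n hn).2⟩⟩

/-- The degree condition needed for dependent random choice. -/
lemma dependent_random_choice_condition (x p l : ℝ) (r s m : ℕ) (hx : 1 ≤ x) (hp0 : 0 < p)
    (hp : x ^ (-(1 / 8) : ℝ) ≤ p) (hl : l = Real.logb 2 x)
    (h128 : 128 ≤ x ^ (1 / 100 : ℝ)) (hl2 : l ^ 2 ≤ x ^ (1 / 100 : ℝ)) (hl1 : 1 ≤ l)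
    (hr : 24 * p ^ (-(1 / 2) : ℝ) ≤ (r : ℝ)) (hr1 : (1 : ℝ) ≤ r)
    (hs : (s : ℝ) - 1 ≤ l / (32 * r)) (hs1 : 1 ≤ s) (hm : (m : ℝ) ≤ x ^ (1 / 10 : ℝ)) :
    2 * x ^ (2 * s + 2) * x ^ (1 / 4 : ℝ) + 2 * x ^ (s + 2) * (m : ℝ) ^ (2 * s + 2)
      ≤ (p * (x - 1)) ^ (2 * s + 2 + 1) := by
  have hx0 : 0 < x := by linarith
  have hlog : 0 ≤ Real.log x := Real.log_nonneg hx
  have hpow : x ^ (-(1 / 96) : ℝ) ≤ p ^ (2 * (s - 1)) := by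
    rw [← Real.exp_log hp0, ← Real.exp_nat_mul, Real.rpow_def_of_pos hx0]
    apply Real.exp_le_exp.2
    have h1 : -Real.log p ≤ 2 * p ^ (-(1 / 2) : ℝ) := by
      have := Real.log_le_sub_one_of_pos (Real.rpow_pos_of_pos hp0 (-(1 / 2)))
      rw [Real.log_rpow hp0] at this
      linarith
    have h2 : ((s - 1 : ℕ) : ℝ) * 768 * p ^ (-(1 / 2) : ℝ) ≤ l := by
      rw [Nat.cast_sub hs1, Nat.cast_one]
      rw [le_div_iff₀ (by positivity)] at hs
      have h0 : (0 : ℝ) ≤ s - 1 := by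
        have : (1 : ℝ) ≤ s := by exact_mod_cast hs1
        linarith
      nlinarith
    have h3 : l ≤ 2 * Real.log x := by
      have h4 : (1 / 2 : ℝ) < Real.log 2 := by linarith [Real.log_two_gt_d9]
      rw [hl, Real.logb, div_le_iff₀ (by linarith)]
      nlinarith
    have h0 : (0 : ℝ) ≤ ((s - 1 : ℕ) : ℝ) := Nat.cast_nonneg _
    push_cast
    nlinarith
  have hp5 : x ^ (-(5 / 8) : ℝ) ≤ p ^ 5 := by
    calc x ^ (-(5 / 8) : ℝ) = (x ^ (-(1 / 8) : ℝ)) ^ 5 := by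
          rw [← Real.rpow_natCast, ← Real.rpow_mul hx0.le]; norm_num
      _ ≤ p ^ 5 := by gcongr
  have hpq : x ^ (-(16 / 25) : ℝ) ≤ p ^ (2 * s + 2 + 1) := by
    calc x ^ (-(16 / 25) : ℝ) ≤ x ^ (-(5 / 8) + -(1 / 96) : ℝ) :=
          Real.rpow_le_rpow_of_exponent_le hx (by norm_num)
      _ = x ^ (-(5 / 8) : ℝ) * x ^ (-(1 / 96) : ℝ) := Real.rpow_add hx0 _ _
      _ ≤ p ^ 5 * p ^ (2 * (s - 1)) := by gcongr
      _ = p ^ (2 * s + 2 + 1) := by rw [← pow_add]; congr 1; omega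
  have hbern : (1 : ℝ) / 2 ≤ (1 - 1 / x) ^ (2 * s + 2 + 1) := by
    have h1 := one_add_mul_le_pow (a := -(1 / x)) (by
      have : 1 / x ≤ 1 := by rw [div_le_one hx0]; exact hx
      linarith) (2 * s + 2 + 1)
    have hsl : (s : ℝ) ≤ 1 + l := by
      have : l / (32 * r) ≤ l := div_le_self (by linarith) (by linarith)
      linarith
    have hll : l ≤ x / 128 := by
      have h1 : 128 * x ^ (1 / 100 : ℝ) ≤ x := by
        calc 128 * x ^ (1 / 100 : ℝ) ≤ x ^ (1 / 100 : ℝ) * x ^ (1 / 100 : ℝ) := by gcongr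
          _ = x ^ (1 / 100 + 1 / 100 : ℝ) := (Real.rpow_add hx0 _ _).symm
          _ ≤ x ^ (1 : ℝ) := Real.rpow_le_rpow_of_exponent_le hx (by norm_num)
          _ = x := Real.rpow_one x
      nlinarith
    have h2 : ((2 * s + 2 + 1 : ℕ) : ℝ) * (1 / x) ≤ 1 / 2 := by
      push_cast
      rw [mul_one_div, div_le_iff₀ hx0]
      linarith
    rw [← sub_eq_add_neg] at h1
    linarith
  have hR : x ^ (2 * s + 2) * x ^ (9 / 25 : ℝ) / 2 ≤ (p * (x - 1)) ^ (2 * s + 2 + 1) := by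
    have e : p * (x - 1) = p * x * (1 - 1 / x) := by field_simp
    rw [e, mul_pow, mul_pow]
    have e2 : x ^ (2 * s + 2) * x ^ (9 / 25 : ℝ) = x ^ (-(16 / 25) : ℝ) * x ^ (2 * s + 2 + 1) := by
      have : x ^ (9 / 25 : ℝ) = x ^ (-(16 / 25) : ℝ) * x := by
        rw [← Real.rpow_add_one hx0.ne']; norm_num
      rw [this]; ring
    rw [e2, div_eq_mul_one_div]
    gcongr
  have hm' : x ^ (s + 2) * (m : ℝ) ^ (2 * s + 2) ≤ x ^ (2 * s + 2) * x ^ (1 / 4 : ℝ) := by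
    calc x ^ (s + 2) * (m : ℝ) ^ (2 * s + 2)
        ≤ x ^ (s + 2) * (x ^ (1 / 10 : ℝ)) ^ (2 * s + 2) := by gcongr
      _ = x ^ ((s : ℝ) + 2 + 1 / 10 * (2 * s + 2)) := by
        rw [← Real.rpow_natCast, ← Real.rpow_natCast, ← Real.rpow_mul hx0.le, ← Real.rpow_add hx0]
        push_cast; rfl
      _ ≤ x ^ ((2 * s + 2 : ℝ) + 1 / 4) := by
        apply Real.rpow_le_rpow_of_exponent_le hx
        have : (1 : ℝ) ≤ s := by exact_mod_cast hs1
        linarith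
      _ = _ := by
        rw [Real.rpow_add hx0, ← Real.rpow_natCast x (2 * s + 2)]
        push_cast; rfl
  have h8 : 8 * x ^ (1 / 4 : ℝ) ≤ x ^ (9 / 25 : ℝ) := by
    calc 8 * x ^ (1 / 4 : ℝ) ≤ x ^ (1 / 100 : ℝ) * x ^ (1 / 4 : ℝ) := by gcongr; linarith
      _ = x ^ (1 / 100 + 1 / 4 : ℝ) := (Real.rpow_add hx0 _ _).symm
      _ ≤ _ := Real.rpow_le_rpow_of_exponent_le hx (by norm_num)
  have h9 := mul_le_mul_of_nonneg_left h8 (pow_nonneg hx0.le (2 * s + 2))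
  linarith

/-- The total size of the branch sets is small. -/
lemma mul_le_rpow_of_bounds (x p l r t : ℝ) (hx : 1 ≤ x) (hp0 : 0 < p)
    (hp : x ^ (-(1 / 8) : ℝ) ≤ p) (hl : l = Real.logb 2 x)
    (hl2 : l ^ 2 ≤ x ^ (1 / 100 : ℝ)) (hl1 : 1 ≤ l) (hr0 : 0 ≤ r)
    (hr : r ≤ 1 / 2 * Real.sqrt (p⁻¹ * l))
    (ht : t ≤ 1 / 32 * Real.exp (p * r ^ 2 / 256) * l) :
    t * (8 * r) ≤ x ^ (1 / 12 : ℝ) := by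
  have hx0 : 0 < x := by linarith
  have hlog : 0 ≤ Real.log x := Real.log_nonneg hx
  have h3 : l ≤ 2 * Real.log x := by
    have h4 : (1 / 2 : ℝ) < Real.log 2 := by linarith [Real.log_two_gt_d9]
    rw [hl, Real.logb, div_le_iff₀ (by linarith)]
    nlinarith
  have hrsq : p * r ^ 2 ≤ l / 4 := by
    have h1 : r ^ 2 ≤ (1 / 2 * Real.sqrt (p⁻¹ * l)) ^ 2 := by gcongr
    rw [mul_pow, Real.sq_sqrt (by positivity)] at h1
    calc p * r ^ 2 ≤ p * ((1 / 2) ^ 2 * (p⁻¹ * l)) := by gcongr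
      _ = l / 4 := by field_simp; norm_num
  have hexp : Real.exp (p * r ^ 2 / 256) ≤ x ^ (1 / 512 : ℝ) := by
    rw [Real.rpow_def_of_pos hx0]
    exact Real.exp_le_exp.2 (by linarith)
  have hpinv : p⁻¹ ≤ x ^ (1 / 8 : ℝ) := by
    rw [inv_le_comm₀ hp0 (by positivity), ← Real.rpow_neg hx0.le]
    exact hp
  have hr' : r ≤ 1 / 2 * (x ^ (1 / 16 : ℝ) * l) := by
    refine hr.trans ?_
    gcongr
    refine Real.sqrt_le_iff.2 ⟨by positivity, ?_⟩
    have : (x ^ (1 / 16 : ℝ)) ^ 2 = x ^ (1 / 8 : ℝ) := by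
      rw [← Real.rpow_natCast, ← Real.rpow_mul hx0.le]; norm_num
    rw [mul_pow, this]
    gcongr
    nlinarith
  calc t * (8 * r) ≤ (1 / 32 * x ^ (1 / 512 : ℝ) * l) * (8 * (1 / 2 * (x ^ (1 / 16 : ℝ) * l))) := by
        gcongr
        exact ht.trans (by gcongr)
    _ = 1 / 8 * (x ^ (1 / 512 : ℝ) * x ^ (1 / 16 : ℝ) * l ^ 2) := by ring
    _ ≤ 1 * (x ^ (1 / 512 : ℝ) * x ^ (1 / 16 : ℝ) * x ^ (1 / 100 : ℝ)) := by
        gcongr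
        norm_num
    _ = x ^ (1 / 512 + 1 / 16 + 1 / 100 : ℝ) := by
        rw [one_mul, Real.rpow_add hx0, Real.rpow_add hx0]
    _ ≤ _ := Real.rpow_le_rpow_of_exponent_le hx (by norm_num)

lemma miss_probability_bound (p l : ℝ) (r s t : ℕ) (hp0 : 0 < p) (hp1 : p ≤ 1) (hr : 2 ≤ r)
    (ht : (t : ℝ) ≤ 1 / 32 * Real.exp (p * (r : ℝ) ^ 2 / 256) * l)
    (hs : l / (32 * r) ≤ s) :
    ((1 - p / 16) ^ (r - 1)) ^ r * t ≤ (r * s : ℝ) := by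
  have hr2 : (2 : ℝ) ≤ r := by exact_mod_cast hr
  have h1 : ((1 - p / 16) ^ (r - 1)) ^ r ≤ Real.exp (-(p * (r : ℝ) ^ 2 / 256)) := by
    calc ((1 - p / 16) ^ (r - 1)) ^ r = (1 - p / 16) ^ ((r - 1) * r) := (pow_mul _ _ _).symm
      _ ≤ Real.exp (-(p / 16)) ^ ((r - 1) * r) := by
        refine pow_le_pow_left₀ (by linarith) ?_ _
        linarith [Real.add_one_le_exp (-(p / 16))]
      _ = Real.exp (((r - 1) * r : ℕ) * -(p / 16)) := (Real.exp_nat_mul _ _).symm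
      _ ≤ _ := by
        apply Real.exp_le_exp.2
        rw [Nat.cast_mul, Nat.cast_sub (by omega), Nat.cast_one]
        have : (r : ℝ) ^ 2 / 16 ≤ (r - 1) * r := by nlinarith
        nlinarith
  calc ((1 - p / 16) ^ (r - 1)) ^ r * t
      ≤ Real.exp (-(p * (r : ℝ) ^ 2 / 256)) * (1 / 32 * Real.exp (p * (r : ℝ) ^ 2 / 256) * l) := by
        gcongr
    _ = l / 32 := by
        rw [Real.exp_neg]
        field_simp
    _ ≤ r * s := by
        rw [div_le_iff₀ (by positivity)] at hs
        linarith

/-- **Small clique minors in dense graphs.** For all sufficiently large `n`: let `G` be a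
graph on `n` vertices with exactly `p·C(n,2)` edges where `p ≥ n^{−1/8}`, and let `r, t`
be positive integers with `24·p^{−1/2} ≤ r ≤ (1/2)·√(p^{−1} log n)` and
`t ≤ (1/32)·e^{p r²/256}·log n`. Then `G` contains a `K_t`-minor whose `t` branch sets
each have size at most `8r` (branch sets are pairwise disjoint, each induces a connected
subgraph, and every pair of distinct branch sets is joined by an edge of `G`).
(Logarithms are base 2.) -/
theorem stmt16 :
    ∃ n₀ : ℕ, ∀ n : ℕ, n₀ ≤ n → ∀ (G : SimpleGraph (Fin n)) (p : ℝ) (r t : ℕ),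
      0 < r → 0 < t → (G.edgeSet.ncard : ℝ) = p * (n.choose 2 : ℝ) →
      (n : ℝ) ^ (-(1 / 8) : ℝ) ≤ p →
      24 * p ^ (-(1 / 2) : ℝ) ≤ (r : ℝ) →
      (r : ℝ) ≤ (1 / 2) * Real.sqrt (p⁻¹ * Real.logb 2 n) →
      (t : ℝ) ≤ (1 / 32) * Real.exp (p * (r : ℝ) ^ 2 / 256) * Real.logb 2 n →
      ∃ B : Fin t → Finset (Fin n),
        (∀ i, (B i).card ≤ 8 * r) ∧
        (∀ i j, i ≠ j → Disjoint (B i) (B j)) ∧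
        (∀ i, (G.induce ((B i : Set (Fin n)))).Connected) ∧
        (∀ i j, i ≠ j → ∃ u ∈ B i, ∃ v ∈ B j, G.Adj u v) := by
  obtain ⟨n₀, h₀⟩ := eventually_rpow_logb_bounds
  refine ⟨max n₀ 2, fun n hn G p r t hr0 _ hE hp hr hr' ht => ?_⟩
  obtain ⟨h128, hl2, hl1⟩ := h₀ n (le_of_max_le_left hn)
  have hn2 : 2 ≤ n := le_of_max_le_right hn
  have hx2 : (2 : ℝ) ≤ n := by exact_mod_cast hn2
  set x : ℝ := (n : ℝ) with hxdef
  have hx : 1 ≤ x := by linarith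
  have hx0 : 0 < x := by linarith
  have hp0 : 0 < p := (Real.rpow_pos_of_pos hx0 _).trans_le hp
  have hp1 : p ≤ 1 := by
    have h1 : G.edgeSet.ncard ≤ n.choose 2 := by
      classical
      rw [Set.ncard_eq_toFinset_card']
      have := G.card_edgeFinset_le_card_choose_two
      rwa [Fintype.card_fin, SimpleGraph.edgeFinset] at this
    have h2 : (0 : ℝ) < n.choose 2 := by exact_mod_cast Nat.choose_pos hn2
    have h3 : (G.edgeSet.ncard : ℝ) ≤ n.choose 2 := by exact_mod_cast h1
    rw [hE] at h3
    exact le_of_mul_le_mul_right (by linarith) h2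
  have hr24 : (24 : ℝ) ≤ r := by
    have := Real.one_le_rpow_of_pos_of_le_one_of_nonpos hp0 hp1 (by norm_num : (-(1 / 2) : ℝ) ≤ 0)
    linarith
  have hr2 : 2 ≤ r := by
    have : (2 : ℝ) ≤ r := by linarith
    exact_mod_cast this
  set l := Real.logb 2 x with hl
  set s := ⌈l / (32 * r)⌉₊ with hsdef
  have hlr : 0 < l / (32 * r) := by positivity
  have hs1 : 1 ≤ s := Nat.one_le_ceil_iff.2 hlr
  have hs : l / (32 * r) ≤ s := Nat.le_ceil _
  have hs' : (s : ℝ) - 1 ≤ l / (32 * r) := by linarith [Nat.ceil_lt_add_one hlr.le]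
  have hM := mul_le_rpow_of_bounds x p l r t hx hp0 hp hl hl2 hl1 (by positivity) hr' ht
  have hM' : ((t * (8 * r) : ℕ) : ℝ) ≤ x ^ (1 / 12 : ℝ) := by exact_mod_cast hM
  have hgrow : ∀ a b : ℝ, a + 1 / 100 ≤ b → 128 * x ^ a ≤ x ^ b := by
    intro a b hab
    calc 128 * x ^ a ≤ x ^ (1 / 100 : ℝ) * x ^ a := by gcongr
      _ = x ^ (1 / 100 + a) := (Real.rpow_add hx0 _ _).symm
      _ ≤ x ^ b := Real.rpow_le_rpow_of_exponent_le hx (by linarith)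
  have hone : 1 ≤ x ^ (1 / 12 : ℝ) := Real.one_le_rpow hx (by norm_num)
  have key := exists_clique_minor_of_density G p (x ^ (1 / 4 : ℝ)) r s t (2 * s + 2)
    ⌊x ^ (1 / 10 : ℝ)⌋₊ hp0 hp1 hr0 hs1 (by simpa using hn2) (by simpa using hE)
    (by
      rw [← Nat.add_one_le_iff, Nat.le_floor_iff (by positivity)]
      have := hgrow (1 / 12) (1 / 10) (by norm_num)
      push_cast at hM' ⊢
      linarith)
    (by positivity)
    (by
      rw [Fintype.card_fin]
      exact dependent_random_choice_condition x p l r s _ hx hp0 hp hl h128 hl2 hl1 hr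
        (by linarith) hs' hs1 (Nat.floor_le (by positivity)))
    (by
      have h1 := hgrow (1 / 12) (1 / 8) (by norm_num)
      have h2 : x ^ (1 / 8 : ℝ) = x ^ (-(1 / 8) : ℝ) * x ^ (1 / 4 : ℝ) := by
        rw [← Real.rpow_add hx0]; norm_num
      have h3 : x ^ (-(1 / 8) : ℝ) * x ^ (1 / 4 : ℝ) ≤ p * x ^ (1 / 4 : ℝ) := by gcongr
      linarith)
    (by
      rw [Fintype.card_fin]
      have h1 := hgrow (1 / 12) (3 / 4) (by norm_num)
      have h2 : x ^ (3 / 4 : ℝ) = x ^ (-(1 / 8) : ℝ) * (x ^ (-(1 / 8) : ℝ) * x) := by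
        rw [← Real.rpow_add_one hx0.ne', ← Real.rpow_add hx0]; norm_num
      have h3 : x ^ (-(1 / 8) : ℝ) * (x ^ (-(1 / 8) : ℝ) * x) ≤ p * (p * x) := by gcongr
      linarith)
    (miss_probability_bound p l r s t hp0 hp1 hr2 ht hs)
  exact key
end
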